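/- Let q ≥ 2 be an integer, K a number field, f(z) ∈ K[[z]] an M_q-function, and R a real number with 0 < R < 1. Then there exist rational functions R_1(z), R_2(z) ∈ K(z) and an M_q-function g(z) ∈ K[[z]], analytic on the open disk D(0,R) and purely transcendental on D(0,R), such that f(z) = R_1(z) + R_2(z)g(z). -/

import Mathlib

noncomputable section

/-- The derivative `d/dz` of a formal power series over `ℂ`. -/
def psD (f : PowerSeries ℂ) : PowerSeries ℂ :=
  PowerSeries.mk fun n => ((n : ℂ) + 1) * PowerSeries.coeff (n + 1) f

/-- The Mahler operator `σ_q : f(z) ↦ f(z^q)` on formal power series over `ℂ`. -/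
def psSigma (q : ℕ) (f : PowerSeries ℂ) : PowerSeries ℂ :=
  PowerSeries.mk fun n => if q ∣ n then PowerSeries.coeff (n / q) f else 0

/-- The canonical embedding of polynomials into power series. -/
def polyPS : Polynomial ℂ →+* PowerSeries ℂ := Polynomial.coeToPowerSeries.ringHom

/-- The power series `∑ (a n / n!) zⁿ` attached to a sequence `a` of coefficients. -/
def ePS (a : ℕ → ℂ) : PowerSeries ℂ := PowerSeries.mk fun n => a n / (n.factorial : ℂ)

/-- `IsE a` : the power series `∑ (a n / n!) zⁿ` is an E-function: its coefficients are
algebraic, it satisfies a nonzero linear differential equation over `ℚ̄[z]`, and the size of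
the conjugates of the `a n` as well as their common denominators grow at most geometrically. -/
def IsE (a : ℕ → ℂ) : Prop :=
  (∀ n, IsAlgebraic ℚ (a n)) ∧
  (∃ (m : ℕ) (p : ℕ → Polynomial ℂ),
      (∀ i k, IsAlgebraic ℚ ((p i).coeff k)) ∧ (∃ i, i ≤ m ∧ p i ≠ 0) ∧
      ∑ i ∈ Finset.range (m + 1), polyPS (p i) * psD^[i] (ePS a) = 0) ∧
  (∃ C : ℝ, 0 < C ∧ ∃ d : ℕ → ℕ, ∀ n : ℕ, 1 ≤ n →
      1 ≤ d n ∧ (d n : ℝ) ≤ C ^ n ∧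
      (∀ σ : (integralClosure ℚ ℂ) →+* ℂ, ∀ h : a n ∈ integralClosure ℚ ℂ,
        ‖σ ⟨a n, h⟩‖ ≤ C ^ n) ∧
      (∀ i, 1 ≤ i → i ≤ n → IsIntegral ℤ ((d n : ℂ) * a i)))

/-- The value at `α` of the E-function with coefficient sequence `a`
(E-functions are entire, so this series converges for all `α`). -/
def evalE (a : ℕ → ℂ) (α : ℂ) : ℂ := ∑' n : ℕ, a n / (n.factorial : ℂ) * α ^ n

/-- `IsM q f` : the formal power series `f` is an M_q-function, i.e. it has algebraic
coefficients and satisfies a linear `σ_q`-difference equation over `ℚ̄[z]` with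
not-all-zero polynomial coefficients. -/
def IsM (q : ℕ) (f : PowerSeries ℂ) : Prop :=
  (∀ n, IsAlgebraic ℚ (PowerSeries.coeff n f)) ∧
  ∃ (m : ℕ) (p : ℕ → Polynomial ℂ),
    (∀ i k, IsAlgebraic ℚ ((p i).coeff k)) ∧ (∃ i, i ≤ m ∧ p i ≠ 0) ∧
    ∑ i ∈ Finset.range (m + 1), polyPS (p i) * (psSigma q)^[i] f = 0

/-- `MahlerValue f α v` : the meromorphic extension of (the sum of) the power series `f`
to the open unit disk has no pole at `α` and takes the value `v` there. -/
def MahlerValue (f : PowerSeries ℂ) (α v : ℂ) : Prop :=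
  ∃ F : ℂ → ℂ, MeromorphicOn F (Metric.ball (0 : ℂ) 1) ∧
    (∀ᶠ z in nhds (0 : ℂ), HasSum (fun n => PowerSeries.coeff n f * z ^ n) (F z)) ∧
    AnalyticAt ℂ F α ∧ F α = v

/-- The power series `f` converges (hence defines an analytic function) on the open
disk `D(0,R)`. -/
def AnOnBall (f : PowerSeries ℂ) (R : ℝ) : Prop :=
  ∀ z : ℂ, ‖z‖ < R → Summable fun n => PowerSeries.coeff n f * z ^ n

/-- The value at `z` of (the sum of) the power series `f`. -/
def psEval (f : PowerSeries ℂ) (z : ℂ) : ℂ := ∑' n : ℕ, PowerSeries.coeff n f * z ^ n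

/-- `Banal fv α P` : the homogeneous algebraic relation `P` among the values at `α` of the
power series `fv 1, …, fv r` is banal: it is the specialization at `z = α` of some
`Q ∈ ℚ̄[z, X₁, …, X_r]`, homogeneous in `X₁, …, X_r`, with `Q(z, fv 1, …, fv r) = 0`. -/
def Banal {r : ℕ} (fv : Fin r → PowerSeries ℂ) (α : ℂ) (P : MvPolynomial (Fin r) ℂ) : Prop :=
  ∃ Q : MvPolynomial (Fin r) (Polynomial ℂ),
    (∀ v k, IsAlgebraic ℚ ((MvPolynomial.coeff v Q).coeff k)) ∧
    (∃ e, Q.IsHomogeneous e) ∧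
    MvPolynomial.eval₂ polyPS fv Q = 0 ∧
    MvPolynomial.map (Polynomial.evalRingHom α) Q = P

/-- `Eset S` : the set of values at `z = 1` of all E-functions with coefficients in `S`. -/
def Eset (S : Set ℂ) : Set ℂ :=
  {x | ∃ a : ℕ → ℂ, IsE a ∧ (∀ n, a n ∈ S) ∧ x = evalE a 1}

/-- `Mset q α S` : the set of values at `α` of all M_q-functions with coefficients in `S`
having no pole at `α`. -/
def Mset (q : ℕ) (α : ℂ) (S : Set ℂ) : Set ℂ :=
  {x | ∃ f : PowerSeries ℂ, IsM q f ∧ (∀ n, PowerSeries.coeff n f ∈ S) ∧ MahlerValue f α x}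

open Polynomial

theorem exists_algebraic_relation_of_algebraic {F C Ω ι : Type*} [Field F] [Field C] [Field Ω]
    [CharZero C] [Algebra F C] [Algebra C Ω] [Algebra F Ω] [IsScalarTower F C Ω] [Fintype ι]
    (u : ι → Ω) (hu : ∀ i, IsAlgebraic F (u i)) (hu0 : u ≠ 0) (c : ι → C)
    (h : ∑ i, u i * algebraMap C Ω (c i) = 0) :
    ∃ v : ι → C, v ≠ 0 ∧ (∀ i, IsAlgebraic F (v i)) ∧ ∑ i, v i * c i = 0 := by
  obtain ⟨j, hj⟩ := Function.ne_iff.1 hu0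
  set L := IntermediateField.adjoin C (Set.range fun i => u i / u j)
  have hintegral (i) : IsIntegral F (u i / u j) :=
    div_eq_mul_inv (u i) (u j) ▸ ((hu i).mul (hu j).inv).isIntegral
  have : FiniteDimensional C L := by
    apply IntermediateField.finiteDimensional_adjoin
    rintro _ ⟨i, rfl⟩
    exact (hintegral i).tower_top
  let w : ι → L := fun i => ⟨u i / u j, IntermediateField.subset_adjoin _ _ ⟨i, rfl⟩⟩
  refine ⟨fun i => Algebra.trace C L (w i), ?_, fun i => ?_, ?_⟩
  · refine Function.ne_iff.2 ⟨j, ?_⟩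
    have h1 : w j = algebraMap C L 1 := by
      apply Subtype.ext
      simp [w, div_self hj]
    simp only [h1, Algebra.trace_algebraMap]
    simpa using (Module.finrank_pos (R := C) (M := L)).ne'
  · apply IsIntegral.isAlgebraic
    apply Algebra.isIntegral_trace
    have : IsScalarTower F L Ω := IsScalarTower.of_algebraMap_eq fun x => by
      rw [IsScalarTower.algebraMap_apply F C Ω, IsScalarTower.algebraMap_apply F C L]
      rfl
    exact (isIntegral_algebraMap_iff (A := L) (B := Ω) (algebraMap L Ω).injective).1 (hintegral i)
  · have h2 : ∑ i, c i • w i = 0 := by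
      apply Subtype.ext
      have : ∑ i, (u i / u j) * algebraMap C Ω (c i) = 0 := by
        rw [← mul_zero (u j)⁻¹, ← h, Finset.mul_sum]
        exact Finset.sum_congr rfl fun i _ => by ring
      refine Eq.trans ?_ this
      simp [w, Algebra.smul_def, mul_comm]
    have := congrArg (Algebra.trace C L) h2
    simpa [map_sum, mul_comm] using this

/-- Specialisation of a purely transcendental parameter. -/
theorem exists_algebraic_relation_of_algebraic_adjoin {k C Ω ι κ : Type*} [Field k] [Field C]
    [Field Ω] [CharZero k] [CharZero C] [CharZero Ω] [Algebra k C] [Algebra C Ω] [Algebra k Ω]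
    [IsScalarTower k C Ω] [Fintype ι] (t : κ → Ω) (ht : AlgebraicIndependent C t)
    (u : ι → Ω) (hu : ∀ i, IsAlgebraic (Algebra.adjoin k (Set.range t)) (u i)) (hu0 : u ≠ 0)
    (c : ι → C) (h : ∑ i, u i * algebraMap C Ω (c i) = 0) :
    ∃ v : ι → C, v ≠ 0 ∧ (∀ i, IsAlgebraic k (v i)) ∧ ∑ i, v i * c i = 0 := by
  classical
  set F' := IntermediateField.adjoin k (Set.range t)
  set C' := IntermediateField.adjoin C (Set.range t)
  have hle : F' ≤ C'.restrictScalars k :=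
    IntermediateField.adjoin_le_iff.2 (IntermediateField.subset_adjoin C (Set.range t))
  let : Algebra F' C' := (IntermediateField.inclusion hle).toRingHom.toAlgebra
  have : IsScalarTower F' C' Ω := IsScalarTower.of_algebraMap_eq fun x => rfl
  obtain ⟨v, hv0, hv, hvc⟩ := exists_algebraic_relation_of_algebraic (F := F') (C := C') u
    (fun i => by rw [IntermediateField.isAlgebraic_adjoin_iff]; exact hu i) hu0
    (fun i => algebraMap C C' (c i)) (by simpa [← IsScalarTower.algebraMap_apply C C' Ω] using h)
  obtain ⟨j, hj⟩ := Function.ne_iff.1 hv0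
  have hinj : Function.Injective (MvPolynomial.aeval (R := C) t) := ht
  have hv' (i) : ∃ p d : MvPolynomial κ C, d ≠ 0 ∧
      (v i : Ω) * MvPolynomial.aeval t d = MvPolynomial.aeval t p := by
    obtain ⟨r, s, hrs⟩ := (IntermediateField.mem_adjoin_range_iff C t (v i : Ω)).1 (v i).2
    by_cases hs : s = 0
    · exact ⟨0, 1, one_ne_zero, by simp [hrs, hs]⟩
    · refine ⟨r, s, hs, ?_⟩
      rw [hrs, div_mul_cancel₀]
      simpa using hinj.ne hs
  choose p d hd hpd using hv'
  have hQ (i) : ∃ Q : Polynomial (MvPolynomial κ k), Q ≠ 0 ∧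
      Polynomial.eval₂ (MvPolynomial.aeval (R := k) t : MvPolynomial κ k →ₐ[k] Ω).toRingHom
        (v i : Ω) Q = 0 := by
    have h1 : IsAlgebraic F' (v i : Ω) :=
      (isAlgebraic_algebraMap_iff (algebraMap C' Ω).injective).2 (hv i)
    rw [IntermediateField.isAlgebraic_adjoin_iff] at h1
    obtain ⟨Q, hQ0, hQ⟩ := h1
    let φ : MvPolynomial κ k →+* Algebra.adjoin k (Set.range t) :=
      ((MvPolynomial.aeval (R := k) t).codRestrict _ fun x => by
        rw [Algebra.adjoin_range_eq_range_aeval]; exact ⟨x, rfl⟩).toRingHom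
    have hφ : Function.Surjective φ := by
      rintro ⟨x, hx⟩
      obtain ⟨y, rfl⟩ := (Algebra.adjoin_range_eq_range_aeval k t ▸ hx :)
      exact ⟨y, rfl⟩
    obtain ⟨Q', rfl⟩ := Polynomial.map_surjective φ hφ Q
    refine ⟨Q', fun h => hQ0 (by simp [h]), ?_⟩
    rw [Polynomial.aeval_def, Polynomial.eval₂_map] at hQ
    exact hQ
  choose Q hQ0 hQ using hQ
  have hlc (i) : ∃ n, (Q i).coeff n ≠ 0 := by
    by_contra! hn
    exact hQ0 i (Polynomial.ext fun n => by simpa using hn n)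
  choose n hn using hlc
  have hpj : p j ≠ 0 := by
    intro h0
    have := hpd j
    rw [h0, map_zero, mul_eq_zero] at this
    rcases this with h1 | h1
    · exact hj (Subtype.ext h1)
    · exact hd j (hinj (by simpa using h1))
  set D := ∏ i, d i
  have hD : D ≠ 0 := Finset.prod_ne_zero_iff.2 fun i _ => hd i
  set H : MvPolynomial κ C :=
    D * p j * ∏ i, MvPolynomial.map (algebraMap k C) ((Q i).coeff (n i))
  have hH : H ≠ 0 := by
    refine mul_ne_zero (mul_ne_zero hD hpj) (Finset.prod_ne_zero_iff.2 fun i _ => ?_)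
    exact (MvPolynomial.map_injective _ (algebraMap k C).injective).ne_iff' (map_zero _) |>.2 (hn i)
  obtain ⟨a, ha⟩ : ∃ a : κ → k, MvPolynomial.eval (fun x => algebraMap k C (a x)) H ≠ 0 := by
    by_contra! hcon
    apply hH
    apply MvPolynomial.funext_set (fun _ => Set.range (algebraMap k C))
    · intro _
      exact Set.infinite_range_of_injective (algebraMap k C).injective
    · intro x hx
      have : ∀ y, ∃ b, algebraMap k C b = x y := fun y => hx y trivial
      choose b hb using this
      simpa [← funext hb] using hcon b
  set e : MvPolynomial κ C →+* C := MvPolynomial.eval (fun x => algebraMap k C (a x))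
  have hH' : e D ≠ 0 ∧ e (p j) ≠ 0 ∧ ∀ i, e (MvPolynomial.map (algebraMap k C)
      ((Q i).coeff (n i))) ≠ 0 := by
    simp only [H, map_mul, map_prod, mul_ne_zero_iff, Finset.prod_ne_zero_iff] at ha
    exact ⟨by simpa [D, map_prod, Finset.prod_ne_zero_iff] using ha.1.1, ha.1.2,
      fun i => ha.2 i (Finset.mem_univ _)⟩
  obtain ⟨heD, hepj, heQ⟩ := hH'
  have hed (i) : e (d i) ≠ 0 := by
    simp only [D, map_prod, Finset.prod_ne_zero_iff] at heD
    exact heD i (Finset.mem_univ _)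
  let M := Localization.Away D
  have hφD : IsUnit ((MvPolynomial.aeval (R := C) t).toRingHom D) := by
    refine isUnit_iff_ne_zero.2 ?_
    exact (hinj.ne_iff' (map_zero _)).2 hD
  let φ : M →+* Ω := IsLocalization.Away.lift D hφD
  let ψ : M →+* C := IsLocalization.Away.lift D (isUnit_iff_ne_zero.2 heD)
  have hφ (x) : φ (algebraMap _ M x) = MvPolynomial.aeval t x := IsLocalization.Away.lift_eq D hφD x
  have hψ (x) : ψ (algebraMap _ M x) = e x := IsLocalization.Away.lift_eq D _ x
  have hφinj : Function.Injective φ := by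
    rw [injective_iff_map_eq_zero]
    intro x hx
    obtain ⟨⟨y, s⟩, hys⟩ := IsLocalization.surj (Submonoid.powers D) x
    have h1 := congrArg φ hys
    rw [map_mul, hx, zero_mul, hφ] at h1
    have hy : y = 0 := hinj (by simpa using h1.symm)
    rw [hy, map_zero] at hys
    exact (IsUnit.mul_left_eq_zero (IsLocalization.map_units M s)).1 hys
  have hdu (i) : IsUnit (algebraMap _ M (d i)) :=
    isUnit_of_dvd_unit (map_dvd _ (Finset.dvd_prod_of_mem d (Finset.mem_univ i)))
      (IsLocalization.Away.algebraMap_isUnit D)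
  let w : ι → M := fun i => algebraMap _ M (p i) * ↑(hdu i).unit⁻¹
  have hw (i) : w i * algebraMap _ M (d i) = algebraMap _ M (p i) := by
    simp [w, mul_assoc]
  have hφw (i) : φ (w i) = v i := by
    have := congrArg φ (hw i)
    rw [map_mul, hφ, hφ, ← hpd] at this
    exact mul_right_cancel₀ ((hinj.ne_iff' (map_zero _)).2 (hd i)) this
  refine ⟨fun i => ψ (w i), Function.ne_iff.2 ⟨j, fun h0 => ?_⟩, fun i => ?_, ?_⟩
  · have := congrArg ψ (hw j)
    rw [map_mul, hψ, hψ] at this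
    have h0 : ψ (w j) = 0 := h0
    rw [h0, zero_mul] at this
    exact hepj this.symm
  · refine ⟨(Q i).map (MvPolynomial.eval a), fun h0 => heQ i ?_, ?_⟩
    · have h1 := congrArg (fun P => algebraMap k C (P.coeff (n i))) h0
      simp only [Polynomial.coeff_map, Polynomial.coeff_zero, map_zero] at h1
      rw [← h1]
      simp only [e]
      rw [MvPolynomial.eval_map, ← MvPolynomial.eval₂_id, MvPolynomial.eval₂_comp_left]
      rfl
    · have h1 : Polynomial.eval₂ ((algebraMap _ M).comp (MvPolynomial.map (algebraMap k C)))
          (w i) (Q i) = 0 := by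
        apply hφinj
        rw [Polynomial.hom_eval₂, hφw, map_zero, ← hQ i]
        congr 1
        refine RingHom.ext fun x => ?_
        simp only [RingHom.comp_apply, hφ]
        simp [MvPolynomial.aeval_map_algebraMap]
      have h2 := congrArg ψ h1
      rw [Polynomial.hom_eval₂, map_zero] at h2
      rw [Polynomial.aeval_def, Polynomial.eval₂_map, ← h2]
      congr 1
      refine RingHom.ext fun x => ?_
      simp only [RingHom.comp_apply, hψ, e]
      rw [MvPolynomial.eval_map, ← MvPolynomial.eval₂_id, MvPolynomial.eval₂_comp_left]
      rfl
  · have h1 : ∑ i, w i * algebraMap (MvPolynomial κ C) M (MvPolynomial.C (c i)) = 0 := by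
      apply hφinj
      rw [map_sum, map_zero]
      have := congrArg (algebraMap C' Ω) hvc
      rw [map_zero, map_sum] at this
      rw [← this]
      refine Finset.sum_congr rfl fun i _ => ?_
      rw [map_mul, hφw, hφ, map_mul, ← IsScalarTower.algebraMap_apply]
      simp
    have := congrArg ψ h1
    simpa [map_sum, hψ, e] using this

/-- If algebraic independence over `k` of subfamilies of `u` persists over `C`, then a linear
relation over `C` satisfied by `u` descends to one with coefficients in `C` algebraic over `k`. -/
theorem exists_algebraic_relation_of_free {k C Ω ι : Type*} [Field k] [Field C]
    [Field Ω] [CharZero k] [CharZero C] [CharZero Ω] [Algebra k C] [Algebra C Ω] [Algebra k Ω]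
    [IsScalarTower k C Ω] [Fintype ι] (u : ι → Ω)
    (hfree : ∀ s : Set ι, AlgebraicIndepOn k u s → AlgebraicIndepOn C u s)
    (hu0 : u ≠ 0) (c : ι → C) (h : ∑ i, u i * algebraMap C Ω (c i) = 0) :
    ∃ v : ι → C, v ≠ 0 ∧ (∀ i, IsAlgebraic k (v i)) ∧ ∑ i, v i * c i = 0 := by
  obtain ⟨s, hs⟩ := (Set.toFinite {s : Set ι | AlgebraicIndepOn k u s}).exists_maximal
    ⟨∅, by
      simp only [Set.mem_ofPred_eq, AlgebraicIndepOn]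
      exact (algebraicIndependent_empty_type_iff (ι := (∅ : Set ι))).2
        (algebraMap k Ω).injective⟩
  refine exists_algebraic_relation_of_algebraic_adjoin (k := k) (fun i : s => u i)
    (hfree s hs.prop) u (fun i => ?_) hu0 c h
  rw [show Set.range (fun i : s => u i) = u '' s from by rw [Set.image_eq_range]]
  by_contra hi
  have h1 : AlgebraicIndepOn k u (insert i s) := AlgebraicIndepOn.insert hs.prop hi
  have h2 : i ∈ s := hs.le_of_ge h1 (Set.subset_insert i s) (Set.mem_insert i s)
  exact hi (isAlgebraic_algebraMap
    (⟨_, Algebra.subset_adjoin ⟨i, h2, rfl⟩⟩ : Algebra.adjoin k (u '' s)))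

section FunctionField

variable {F : Type*} [Field F]

theorem PowerSeries.algebraMap_polynomial (p : F[X]) :
    algebraMap F[X] (PowerSeries F) p = (p : PowerSeries F) := by
  rw [PowerSeries.algebraMap_apply']
  simp [Algebra.algebraMap_self]

open scoped Classical in
/-- The valuation ring at infinity of the rational function field. -/
noncomputable abbrev inftyRing (F : Type*) [Field F] : ValuationSubring (RatFunc F) :=
  (RatFunc.inftyValuation F).valuationSubring

theorem mem_inftyRing_iff (r : RatFunc F) : r ∈ inftyRing F ↔ r = 0 ∨ r.intDegree ≤ 0 := by
  classical
  rw [Valuation.mem_valuationSubring_iff]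
  by_cases hr : r = 0
  · simp [hr]
  · rw [RatFunc.inftyValuation_apply, RatFunc.inftyValuation_of_nonzero _ hr]
    simp only [hr, false_or]
    rw [← WithZero.exp_zero, WithZero.exp_le_exp]

theorem intDegree_X_inv_pow (n : ℕ) : ((RatFunc.X : RatFunc F)⁻¹ ^ n).intDegree = -n := by
  induction n with
  | zero => simp
  | succ n ih =>
    rw [pow_succ, RatFunc.intDegree_mul (pow_ne_zero _ (inv_ne_zero RatFunc.X_ne_zero))
      (inv_ne_zero RatFunc.X_ne_zero), ih, RatFunc.intDegree_inv, RatFunc.intDegree_X]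
    push_cast; ring

theorem polynomial_mul_X_inv_pow_mem_inftyRing (a : F[X]) {n : ℕ} (h : a.natDegree ≤ n) :
    algebraMap F[X] (RatFunc F) a * (RatFunc.X : RatFunc F)⁻¹ ^ n ∈ inftyRing F := by
  rw [mem_inftyRing_iff]
  by_cases ha : a = 0
  · simp [ha]
  right
  rw [RatFunc.intDegree_mul ((map_ne_zero_iff _ (IsFractionRing.injective _ _)).2 ha)
    (pow_ne_zero _ (inv_ne_zero RatFunc.X_ne_zero)), intDegree_X_inv_pow,
    RatFunc.intDegree_polynomial]
  omega

theorem natDegree_le_of_mem_inftyRing {a : F[X]} {n : ℕ} (ha : a ≠ 0)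
    (h : algebraMap F[X] (RatFunc F) a * (RatFunc.X : RatFunc F)⁻¹ ^ n ∈ inftyRing F) :
    a.natDegree ≤ n := by
  have h1 := (map_ne_zero_iff _ (IsFractionRing.injective F[X] (RatFunc F))).2 ha
  have h2 : (RatFunc.X : RatFunc F)⁻¹ ^ n ≠ 0 := pow_ne_zero _ (inv_ne_zero RatFunc.X_ne_zero)
  rw [mem_inftyRing_iff, or_iff_right (mul_ne_zero h1 h2), RatFunc.intDegree_mul h1 h2,
    intDegree_X_inv_pow, RatFunc.intDegree_polynomial] at h
  omega

variable {L : Type*} [Field L] [Algebra F[X] L] [Algebra (RatFunc F) L]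
  [IsScalarTower F[X] (RatFunc F) L]

theorem isIntegral_inftyRing_of_monic {p : F[X][X]} (hp : p.Monic) {y : L} (hy : aeval y p = 0)
    {c : ℕ} (hc : ∀ i, (p.coeff i).natDegree ≤ c) :
    IsIntegral (inftyRing F) ((RatFunc.X : RatFunc F)⁻¹ ^ c • y) := by
  set s : RatFunc F := (RatFunc.X : RatFunc F)⁻¹ ^ c
  set P := (p.map (algebraMap F[X] (RatFunc F))).scaleRoots s
  have hPm : P.Monic := (monic_scaleRoots_iff s).2 (hp.map _)
  have hP0 : aeval (s • y) P = 0 := by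
    rw [Algebra.smul_def]
    apply scaleRoots_aeval_eq_zero
    rwa [aeval_map_algebraMap]
  have hPc : (P.coeffs : Set (RatFunc F)) ⊆ (inftyRing F).toSubring := by
    intro x hx
    obtain ⟨n, hn, rfl⟩ := mem_coeffs_iff.1 (Finset.mem_coe.1 hx)
    have hn' : n ≤ p.natDegree := by
      have := le_natDegree_of_mem_supp n hn
      rwa [natDegree_scaleRoots, hp.natDegree_map] at this
    show _ ∈ inftyRing F
    rw [coeff_scaleRoots, coeff_map, hp.natDegree_map, ← pow_mul]
    rcases hn'.eq_or_lt with rfl | hlt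
    · simp [hp.coeff_natDegree]
    · apply polynomial_mul_X_inv_pow_mem_inftyRing
      exact (hc n).trans (Nat.le_mul_of_pos_right c (by omega))
  refine ⟨P.toSubring _ hPc, (monic_toSubring _ _ hPc).2 hPm, ?_⟩
  have h2 : (P.toSubring _ hPc).map (algebraMap (inftyRing F) (RatFunc F)) = P :=
    Polynomial.ext fun n => by
      rw [coeff_map]
      exact coeff_toSubring P _ hPc
  rw [← aeval_def, ← aeval_map_algebraMap (RatFunc F), h2, hP0]

variable [Algebra (PowerSeries F) L] [IsFractionRing (PowerSeries F) L]
  [IsScalarTower F[X] (PowerSeries F) L]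

theorem powerSeries_eq_zero_of_integral_of_X_pow_dvd {x : PowerSeries F} {s d N : ℕ}
    (hx : IsIntegral F[X] (algebraMap (PowerSeries F) L x))
    (hs : IsIntegral (inftyRing F)
      ((RatFunc.X : RatFunc F)⁻¹ ^ s • algebraMap (PowerSeries F) L x))
    (hd : (minpoly (RatFunc F) (algebraMap (PowerSeries F) L x)).natDegree ≤ d)
    (hN : PowerSeries.X ^ N ∣ x) (hds : d * s < N) : x = 0 := by
  by_contra hx0
  set y := algebraMap (PowerSeries F) L x
  have hinj : Function.Injective (algebraMap (PowerSeries F) L) := IsFractionRing.injective _ _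
  have hy0 : y ≠ 0 := (map_ne_zero_iff _ hinj).2 hx0
  set m := minpoly F[X] y
  have hm : minpoly (RatFunc F) y = m.map (algebraMap F[X] (RatFunc F)) :=
    minpoly.isIntegrallyClosed_eq_field_fractions' _ hx
  have hym : aeval y m = 0 := minpoly.aeval _ _
  have hm0 : m.coeff 0 ≠ 0 := by
    intro h
    apply minpoly.coeff_zero_ne_zero (A := RatFunc F) (x := y) (hx.tower_top) hy0
    rw [hm, coeff_map, h, map_zero]
  have hdeg : (m.coeff 0).natDegree ≤ s * m.natDegree := by
    apply natDegree_le_of_mem_inftyRing hm0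
    have h1 := minpoly.isIntegrallyClosed_eq_field_fractions' (RatFunc F) hs
    rw [IsIntegrallyClosed.minpoly_smul (pow_ne_zero _ (inv_ne_zero RatFunc.X_ne_zero))
      hx.tower_top, hm] at h1
    have h2 := congrArg (fun P => P.coeff 0) h1
    simp only [coeff_scaleRoots, coeff_map] at h2
    rw [(minpoly.monic hx).natDegree_map, Nat.sub_zero, ← pow_mul] at h2
    rw [h2]
    exact ((minpoly (inftyRing F) _).coeff 0).2
  have hdvd : PowerSeries.X ^ N ∣ ((m.coeff 0 : F[X]) : PowerSeries F) := by
    refine hN.trans ⟨- aeval x m.divX, ?_⟩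
    apply hinj
    have h1 := hym
    rw [← m.divX_mul_X_add, map_add, map_mul, aeval_X, aeval_C] at h1
    rw [← PowerSeries.algebraMap_polynomial, ← IsScalarTower.algebraMap_apply, map_mul, map_neg,
      ← aeval_algebraMap_apply]
    linear_combination h1
  have hN' : N ≤ (m.coeff 0).natDegree := by
    by_contra! hlt
    have h1 := (PowerSeries.X_pow_dvd_iff.1 hdvd) _ hlt
    rw [Polynomial.coeff_coe] at h1
    exact hm0 (leadingCoeff_eq_zero.1 h1)
  rw [hm, (minpoly.monic hx).natDegree_map] at hd
  rw [mul_comm] at hdeg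
  exact absurd (hN'.trans (hdeg.trans (Nat.mul_le_mul_right s hd))) (by omega)

end FunctionField

theorem exists_polynomials_coeff_sum_mul_eq_zero {R ι κ : Type*} [CommRing R] [Nontrivial R]
    [Fintype ι] [Fintype κ] (H : κ → ι → PowerSeries R) (D N : ℕ)
    (h : Fintype.card κ * N < Fintype.card ι * D) :
    ∃ P : ι → R[X], P ≠ 0 ∧ (∀ i, (P i).degree < D) ∧
      ∀ k, ∀ n < N, PowerSeries.coeff n (∑ i, (P i : PowerSeries R) * H k i) = 0 := by
  classical
  let M : Matrix (κ × Fin N) (ι × Fin D) R :=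
    fun kn ia => PowerSeries.coeff kn.2 (PowerSeries.X ^ (ia.2 : ℕ) * H kn.1 ia.1)
  have hM : ¬ Function.Injective M.mulVecLin := by
    intro hinj
    have := LinearMap.finrank_le_finrank_of_injective hinj
    simp only [Module.finrank_fintype_fun_eq_card, Fintype.card_prod, Fintype.card_fin] at this
    omega
  rw [injective_iff_map_eq_zero] at hM
  push Not at hM
  obtain ⟨x, hx, hx0⟩ := hM
  refine ⟨fun i => ∑ a : Fin D, C (x (i, a)) * X ^ (a : ℕ), fun h0 => hx0 ?_, fun i => ?_, ?_⟩
  · ext ⟨i, a⟩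
    have := congrArg (fun p => p.coeff a) (congrFun h0 i)
    simpa [finsetSum_coeff, coeff_X_pow, Fin.val_inj] using this
  · exact degree_sum_fin_lt _
  · intro k n hn
    have h1 := congrFun hx (k, ⟨n, hn⟩)
    rw [← show M.mulVecLin x (k, ⟨n, hn⟩) = 0 from h1, Matrix.mulVecLin_apply, Matrix.mulVec,
      dotProduct, Fintype.sum_prod_type, map_sum]
    refine Finset.sum_congr rfl fun i _ => ?_
    rw [← Polynomial.coeToPowerSeries.ringHom_apply, map_sum, Finset.sum_mul, map_sum]
    refine Finset.sum_congr rfl fun a _ => ?_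
    simp only [M, map_mul, coeToPowerSeries.ringHom_apply, coe_C, map_pow, coe_X, mul_assoc,
      PowerSeries.coeff_C_mul]
    exact mul_comm _ _

section FunctionField

variable {F : Type*} [Field F] {L : Type*} [Field L] [Algebra F[X] L] [Algebra (RatFunc F) L]
  [IsScalarTower F[X] (RatFunc F) L] [Algebra (PowerSeries F) L] [IsFractionRing (PowerSeries F) L]
  [IsScalarTower F[X] (PowerSeries F) L]

theorem sum_mul_eq_zero_of_X_pow_dvd {ι : Type*} [Fintype ι]
    (E : IntermediateField (RatFunc F) L) [FiniteDimensional (RatFunc F) E]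
    (H : ι → PowerSeries F) (hHE : ∀ i, algebraMap (PowerSeries F) L (H i) ∈ E) (c : ℕ)
    (hH : ∀ i, ∃ p : F[X][X], p.Monic ∧ aeval (H i) p = 0 ∧ ∀ n, (p.coeff n).natDegree ≤ c)
    (P : ι → F[X]) (D : ℕ) (hP : ∀ i, (P i).natDegree ≤ D) (N : ℕ)
    (hN : Module.finrank (RatFunc F) E * (D + c) < N)
    (hdvd : PowerSeries.X ^ N ∣ ∑ i, (P i : PowerSeries F) * H i) :
    ∑ i, (P i : PowerSeries F) * H i = 0 := by
  have hcoe (i) : algebraMap (PowerSeries F) L (P i) = algebraMap F[X] L (P i) := by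
    rw [← PowerSeries.algebraMap_polynomial, ← IsScalarTower.algebraMap_apply]
  have hmem : algebraMap (PowerSeries F) L (∑ i, (P i : PowerSeries F) * H i) ∈ E := by
    rw [map_sum]
    refine sum_mem fun i _ => ?_
    rw [map_mul, hcoe, IsScalarTower.algebraMap_apply F[X] (RatFunc F) L]
    exact mul_mem (E.algebraMap_mem _) (hHE i)
  refine powerSeries_eq_zero_of_integral_of_X_pow_dvd (L := L) (s := D + c)
    (d := Module.finrank (RatFunc F) E) ?_ ?_ ?_ hdvd hN
  · apply IsIntegral.algebraMap
    refine IsIntegral.sum _ fun i _ => ?_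
    obtain ⟨p, hp, hp0, -⟩ := hH i
    rw [← PowerSeries.algebraMap_polynomial]
    exact isIntegral_algebraMap.mul ⟨p, hp, hp0⟩
  · rw [map_sum, Finset.smul_sum]
    refine IsIntegral.sum _ fun i _ => ?_
    obtain ⟨p, hp, hp0, hpc⟩ := hH i
    have h1 := isIntegral_inftyRing_of_monic (L := L) hp
      (y := algebraMap (PowerSeries F) L (H i))
      (by rw [aeval_algebraMap_apply, hp0, map_zero]) hpc
    have h2 := h1.smul (⟨_, polynomial_mul_X_inv_pow_mem_inftyRing (P i) (hP i)⟩ : inftyRing F)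
    rw [map_mul, hcoe, IsScalarTower.algebraMap_apply F[X] (RatFunc F) L]
    refine (congrArg (IsIntegral (inftyRing F)) ?_).mpr h2
    change _ = (algebraMap F[X] (RatFunc F) (P i) * (RatFunc.X : RatFunc F)⁻¹ ^ D) •
      (((RatFunc.X : RatFunc F)⁻¹ ^ c) • algebraMap (PowerSeries F) L (H i))
    simp only [Algebra.smul_def, map_mul, pow_add]
    ring
  · have h := minpoly.natDegree_le (A := RatFunc F)
      (⟨algebraMap (PowerSeries F) L (∑ i, (P i : PowerSeries F) * H i), hmem⟩ : E)
    rwa [← minpoly.algebraMap_eq (algebraMap E L).injective] at h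

theorem Polynomial.coe_comp_C_mul_X (p : F[X]) (ζ : F) :
    ((p.comp (C ζ * X) : F[X]) : PowerSeries F) = PowerSeries.rescale ζ (p : PowerSeries F) := by
  ext n
  rw [coeff_coe, comp_C_mul_X_coeff, PowerSeries.coeff_rescale, coeff_coe, mul_comm]

theorem exists_monic_aeval_rescale {φ : PowerSeries F} {c : ℕ} {p : F[X][X]} (hp : p.Monic)
    (h0 : aeval φ p = 0) (hc : ∀ n, (p.coeff n).natDegree ≤ c) (ζ : F) :
    ∃ p : F[X][X], p.Monic ∧ aeval (PowerSeries.rescale ζ φ) p = 0 ∧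
      ∀ n, (p.coeff n).natDegree ≤ c := by
  refine ⟨p.map (compRingHom (C ζ * X)), hp.map _, ?_, fun n => ?_⟩
  · have := congrArg (PowerSeries.rescale ζ) h0
    rw [map_zero, aeval_def, hom_eval₂] at this
    rw [aeval_def, eval₂_map, ← this]
    congr 1
    refine RingHom.ext fun a => ?_
    simp only [RingHom.comp_apply, PowerSeries.algebraMap_polynomial, coe_compRingHom_apply,
      Polynomial.coe_comp_C_mul_X]
  · rw [coeff_map]
    refine (natDegree_comp_le (p := p.coeff n) (q := C ζ * X)).trans ?_
    have : (C ζ * X : F[X]).natDegree ≤ 1 := (natDegree_C_mul_le ζ X).trans natDegree_X_le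
    have h2 := hc n
    nlinarith

end FunctionField

section FunctionField

variable {F : Type*} [Field F]

theorem exists_monic_natDegree_le_of_isIntegral {ι : Type*} [Finite ι] {y : ι → PowerSeries F}
    (hy : ∀ i, IsIntegral F[X] (y i)) :
    ∃ c : ℕ, ∀ i, ∃ p : F[X][X], p.Monic ∧ aeval (y i) p = 0 ∧
      ∀ n, (p.coeff n).natDegree ≤ c := by
  cases nonempty_fintype ι
  choose p hp h0 using hy
  refine ⟨∑ i, ∑ n ∈ (p i).support, ((p i).coeff n).natDegree, fun i =>
    ⟨p i, hp i, h0 i, fun n => ?_⟩⟩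
  by_cases hn : n ∈ (p i).support
  · exact (Finset.single_le_sum (f := fun n => ((p i).coeff n).natDegree)
      (fun _ _ => Nat.zero_le _) hn).trans (Finset.single_le_sum
      (f := fun i => ∑ n ∈ (p i).support, ((p i).coeff n).natDegree)
      (fun _ _ => Nat.zero_le _) (Finset.mem_univ i))
  · simp [notMem_support_iff.1 hn]

/-- A power series `φ` for which `φ(tz)` satisfies a nontrivial relation over `F[t, z]` modulo
power series with constant coefficients in `t` is rational. -/
theorem exists_polynomial_mul_eq_of_twist_relation {ι : Type*} [Fintype ι] (φ : PowerSeries F)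
    (e : ι → PowerSeries F) (A : F[X][X]) (hA : A ≠ 0) (P : ι → F[X][X])
    (h : (A : PowerSeries F[X]) * PowerSeries.mk (fun n => C (PowerSeries.coeff n φ) * X ^ n) +
      ∑ i, (P i : PowerSeries F[X]) * (e i).map C = 0) :
    ∃ a b : F[X], a ≠ 0 ∧ (a : PowerSeries F) * φ = b := by
  obtain ⟨a₀, ha₀⟩ : ∃ a, A.coeff a ≠ 0 := by
    by_contra! hn
    exact hA (Polynomial.ext fun n => by simpa using hn n)
  obtain ⟨b₀, hb₀⟩ : ∃ b, (A.coeff a₀).coeff b ≠ 0 := by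
    by_contra! hn
    exact ha₀ (Polynomial.ext fun n => by simpa using hn n)
  obtain ⟨T, hT⟩ : ∃ T, ∀ i n, ((P i).coeff n).natDegree ≤ T := by
    refine ⟨∑ i, ∑ n ∈ (P i).support, ((P i).coeff n).natDegree, fun i n => ?_⟩
    by_cases hn : n ∈ (P i).support
    · exact (Finset.single_le_sum (f := fun n => ((P i).coeff n).natDegree)
        (fun _ _ => Nat.zero_le _) hn).trans (Finset.single_le_sum
        (f := fun i => ∑ n ∈ (P i).support, ((P i).coeff n).natDegree)
        (fun _ _ => Nat.zero_le _) (Finset.mem_univ i))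
    · simp [notMem_support_iff.1 hn]
  let a : F[X] := ∑ j ∈ Finset.range (A.natDegree + 1),
    monomial j (if a₀ ≤ j + b₀ then (A.coeff j).coeff (j + b₀ - a₀) else 0)
  have hac (j) : a.coeff j = if a₀ ≤ j + b₀ then (A.coeff j).coeff (j + b₀ - a₀) else 0 := by
    simp only [a, finsetSum_coeff, coeff_monomial]
    rw [Finset.sum_ite_eq']
    split_ifs with h1 h2 h2 <;> try rfl
    rw [coeff_eq_zero_of_natDegree_lt (p := A) (by simpa [Nat.lt_succ_iff] using h1), coeff_zero]
  have hvan (n) (hn : a₀ + T < n) : PowerSeries.coeff n ((a : PowerSeries F) * φ) = 0 := by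
    have h1 := congrArg (fun f => (PowerSeries.coeff n f).coeff (n + b₀ - a₀)) h
    simp only [map_add, map_sum, map_zero, coeff_zero, coeff_add, finsetSum_coeff,
      PowerSeries.coeff_mul, PowerSeries.coeff_map, PowerSeries.coeff_mk, coeff_coe] at h1
    rw [Finset.sum_eq_zero (s := Finset.univ), add_zero] at h1
    · rw [PowerSeries.coeff_mul, ← h1]
      refine Finset.sum_congr rfl fun x hx => ?_
      have hx' := Finset.HasAntidiagonal.mem_antidiagonal.1 hx
      rw [coeff_coe, hac, mul_left_comm, coeff_C_mul, coeff_mul_X_pow']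
      by_cases hc : a₀ ≤ x.1 + b₀
      · rw [if_pos hc, if_pos (by omega), mul_comm, show n + b₀ - a₀ - x.2 = x.1 + b₀ - a₀ by omega]
      · rw [if_neg hc, if_neg (by omega), zero_mul, mul_zero]
    · intro i _
      refine Finset.sum_eq_zero fun x hx => ?_
      rw [coeff_mul_C, coeff_eq_zero_of_natDegree_lt (by have := hT i x.1; omega), zero_mul]
  refine ⟨a, ((a : PowerSeries F) * φ).trunc (a₀ + T + 1), fun h0 => hb₀ ?_, ?_⟩
  · have := hac a₀
    rw [h0, coeff_zero, if_pos (by omega), Nat.add_sub_cancel_left] at this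
    exact this.symm
  · ext n
    rw [coeff_coe, PowerSeries.coeff_trunc]
    split_ifs with hn
    · rfl
    · exact hvan n (by omega)

variable {L : Type*} [Field L] [Algebra F[X] L] [Algebra (RatFunc F) L]
  [IsScalarTower F[X] (RatFunc F) L] [Algebra (PowerSeries F) L] [IsFractionRing (PowerSeries F) L]
  [IsScalarTower F[X] (PowerSeries F) L]

theorem exists_polynomial_mul_eq_of_rescale_mem_of_isIntegral
    (E : IntermediateField (RatFunc F) L) [FiniteDimensional (RatFunc F) E]
    {d : ℕ} (hd : Module.finrank (RatFunc F) E = d) (e : Fin d → PowerSeries F)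
    (heE : ∀ i, algebraMap (PowerSeries F) L (e i) ∈ E) (he : ∀ i, IsIntegral F[X] (e i))
    (hind : LinearIndependent F[X] e) (φ : PowerSeries F) (hφ : IsIntegral F[X] φ)
    (S : Set F) (hS : S.Infinite)
    (hSE : ∀ ζ ∈ S, algebraMap (PowerSeries F) L (PowerSeries.rescale ζ φ) ∈ E) :
    ∃ a b : F[X], a ≠ 0 ∧ (a : PowerSeries F) * φ = b := by
  obtain ⟨c, hc⟩ := exists_monic_natDegree_le_of_isIntegral
    (y := fun i : Option (Fin d) => i.elim φ e) (by rintro (_ | i); exacts [hφ, he i])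
  let Φ : PowerSeries F[X] := PowerSeries.mk (fun n => C (PowerSeries.coeff n φ) * X ^ n)
  let H : Option (Fin d) → PowerSeries F[X] := fun i => i.elim Φ fun j => (e j).map C
  set D := d * c + 1
  set N := (d + 1) * (D + 1) - 1
  obtain ⟨P, hP0, hPD, hPN⟩ := exists_polynomials_coeff_sum_mul_eq_zero (κ := Unit)
    (fun _ => H) (D + 1) N (by
      simp only [Fintype.card_unit, Fintype.card_option, Fintype.card_fin, N]
      have : 0 < (d + 1) * (D + 1) := by positivity
      omega)
  have hzero : ∑ i, (P i : PowerSeries F[X]) * H i = 0 := by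
    ext1 n
    rw [map_zero]
    refine Polynomial.eq_zero_of_infinite_isRoot _ (hS.mono fun ζ hζ => ?_)
    let ev := PowerSeries.map (evalRingHom ζ)
    have hev : ev (∑ i, (P i : PowerSeries F[X]) * H i) =
        ∑ i, (((P i).map (evalRingHom ζ) : F[X]) : PowerSeries F) *
          (i.elim (PowerSeries.rescale ζ φ) e : PowerSeries F) := by
      rw [map_sum]
      refine Finset.sum_congr rfl fun i _ => ?_
      rw [map_mul, Polynomial.polynomial_map_coe]
      congr 1
      rcases i with _ | j
      · ext n
        simp only [ev, H, Φ, Option.elim, PowerSeries.coeff_rescale, PowerSeries.coeff_map,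
          PowerSeries.coeff_mk, coe_evalRingHom, eval_mul, eval_C, eval_pow, eval_X]
        exact mul_comm _ _
      · ext n
        simp [ev, H]
    have h1 : ev (∑ i, (P i : PowerSeries F[X]) * H i) = 0 := by
      rw [hev]
      refine sum_mul_eq_zero_of_X_pow_dvd E _ ?_ c ?_ _ D ?_ N ?_ ?_
      · rintro (_ | j)
        exacts [hSE ζ hζ, heE j]
      · rintro (_ | j)
        · obtain ⟨p, hp, h0, hpc⟩ := hc none
          exact exists_monic_aeval_rescale hp h0 hpc ζ
        · exact hc (some j)
      · intro i
        refine natDegree_map_le.trans ?_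
        by_cases hi : P i = 0
        · simp [hi]
        · exact Nat.lt_succ_iff.1 ((natDegree_lt_iff_degree_lt hi).2 (hPD i))
      · rw [hd]
        show d * (D + c) < (d + 1) * (D + 1) - 1
        have : (d + 1) * (D + 1) = d * D + d + D + 1 := by ring
        rw [this, mul_add]
        omega
      · rw [← hev, PowerSeries.X_pow_dvd_iff]
        intro m hm
        rw [PowerSeries.coeff_map, hPN () m hm, map_zero]
    have h2 := congrArg (PowerSeries.coeff n) h1
    rw [PowerSeries.coeff_map, map_zero] at h2
    exact h2
  rw [Fintype.sum_option] at hzero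
  refine exists_polynomial_mul_eq_of_twist_relation φ e (P none) (fun hn => hP0 ?_)
    (fun i => P (some i)) hzero
  rw [hn, Polynomial.coe_zero, zero_mul, zero_add] at hzero
  funext i
  rcases i with _ | i
  · exact hn
  · ext n m
    let Q : ℕ → Fin d → F[X] := fun m i =>
      ∑ n ∈ Finset.range ((P (some i)).natDegree + 1), monomial n (((P (some i)).coeff n).coeff m)
    have hQ (m i n) : (Q m i).coeff n = ((P (some i)).coeff n).coeff m := by
      simp only [Q, finsetSum_coeff, coeff_monomial]
      rw [Finset.sum_ite_eq']
      split_ifs with h1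
      · rfl
      · rw [coeff_eq_zero_of_natDegree_lt (p := P (some i))
          (by simpa [Nat.lt_succ_iff] using h1), coeff_zero]
    have hsum : ∑ i, Q m i • e i = 0 := by
      ext k
      have h1 := congrArg (fun f => (PowerSeries.coeff k f).coeff m) hzero
      simp only [map_sum, map_zero, coeff_zero, finsetSum_coeff, PowerSeries.coeff_mul,
        coeff_coe] at h1
      rw [map_zero, ← h1, map_sum]
      refine Finset.sum_congr rfl fun i _ => ?_
      rw [Algebra.smul_def, PowerSeries.algebraMap_polynomial, PowerSeries.coeff_mul]
      refine Finset.sum_congr rfl fun x _ => ?_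
      simp only [coeff_coe, hQ, H, Option.elim, PowerSeries.coeff_map, coeff_mul_C]
    have := Fintype.linearIndependent_iff.1 hind _ hsum i
    rw [← hQ, this]
    simp

end FunctionField

section FunctionField

variable {F : Type*} [Field F] {L : Type*} [Field L] [Algebra (PowerSeries F) L]
  [IsFractionRing (PowerSeries F) L]

variable (L) in
/-- The rotation `f(z) ↦ f(ζ z)` on the field of fractions of the power series ring. -/
noncomputable def rotate (ζ : Fˣ) : L →+* L :=
  IsFractionRing.lift (A := PowerSeries F)
    (g := (algebraMap (PowerSeries F) L).comp (PowerSeries.rescale (ζ : F)))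
    ((IsFractionRing.injective _ _).comp (PowerSeries.rescale_injective ζ.ne_zero))

theorem rotate_algebraMap (ζ : Fˣ) (f : PowerSeries F) :
    rotate L ζ (algebraMap _ L f) = algebraMap _ L (PowerSeries.rescale (ζ : F) f) :=
  IsFractionRing.lift_algebraMap _ _

variable [Algebra F[X] L] [IsScalarTower F[X] (PowerSeries F) L]

theorem rotate_algebraMap_polynomial (ζ : Fˣ) (p : F[X]) :
    rotate L ζ (algebraMap F[X] L p) = algebraMap F[X] L (p.comp (C (ζ : F) * X)) := by
  simp only [IsScalarTower.algebraMap_apply F[X] (PowerSeries F) L, rotate_algebraMap,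
    PowerSeries.algebraMap_polynomial, Polynomial.coe_comp_C_mul_X]

theorem exists_powerSeries_of_isIntegral {y : L} (hy : IsIntegral F[X] y) :
    ∃ f : PowerSeries F, IsIntegral F[X] f ∧ algebraMap _ L f = y := by
  obtain ⟨f, rfl⟩ := IsIntegrallyClosed.isIntegral_iff.1 (hy.tower_top (A := PowerSeries F))
  exact ⟨f, (isIntegral_algebraMap_iff (IsFractionRing.injective _ _)).1 hy, rfl⟩

variable [Algebra (RatFunc F) L] [IsScalarTower F[X] (RatFunc F) L]

/-- An element of a finite extension `E` of `F(z)` inside the field of Laurent series having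
infinitely many of its rotations in `E` is rational. -/
theorem mem_range_algebraMap_of_rotate_mem (E : IntermediateField (RatFunc F) L)
    [FiniteDimensional (RatFunc F) E] (φ : L) (hφ : φ ∈ E) (S : Set Fˣ) (hS : S.Infinite)
    (hSE : ∀ ζ ∈ S, rotate L ζ φ ∈ E) : ∃ r : RatFunc F, algebraMap _ L r = φ := by
  have hinj : Function.Injective (algebraMap F[X] L) := by
    rw [IsScalarTower.algebraMap_eq F[X] (RatFunc F) L]
    exact (algebraMap (RatFunc F) L).injective.comp (IsFractionRing.injective _ _)
  have hmul (y : L) (hy : y ∈ E) : ∃ (a : F[X]) (f : PowerSeries F), a ≠ 0 ∧ IsIntegral F[X] f ∧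
      algebraMap _ L f = a • y := by
    have h1 : IsAlgebraic (RatFunc F) y :=
      (isAlgebraic_algebraMap_iff (algebraMap E L).injective).2
        (Algebra.IsAlgebraic.isAlgebraic (R := RatFunc F) (⟨y, hy⟩ : E))
    obtain ⟨a, ha, hy⟩ :=
      ((IsFractionRing.isAlgebraic_iff F[X] (RatFunc F) L).2 h1).exists_integral_multiple
    obtain ⟨f, hf, hfy⟩ := exists_powerSeries_of_isIntegral hy
    exact ⟨a, f, ha, hf, hfy⟩
  have hsmul (a : F[X]) (y : L) (hy : y ∈ E) : a • y ∈ E := by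
    rw [Algebra.smul_def, IsScalarTower.algebraMap_apply F[X] (RatFunc F) L]
    exact mul_mem (E.algebraMap_mem _) hy
  let b := Module.finBasis (RatFunc F) E
  choose a e ha he hae using fun i => hmul (b i) (b i).2
  obtain ⟨a', ψ, ha', hψ, haψ⟩ := hmul φ hφ
  have hind : LinearIndependent F[X] e := by
    rw [Fintype.linearIndependent_iff]
    intro g hg i
    have h1 : ∑ i, (algebraMap F[X] (RatFunc F) (g i * a i)) • b i = 0 := by
      apply Subtype.ext
      have := congrArg (algebraMap _ L) hg
      rw [map_sum, map_zero] at this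
      refine Eq.trans ?_ this
      rw [AddSubmonoidClass.coe_finsetSum]
      refine Finset.sum_congr rfl fun i _ => ?_
      have h2 : algebraMap (PowerSeries F) L (g i • e i) = g i • algebraMap _ L (e i) := by
        rw [Algebra.smul_def (g i), Algebra.smul_def (g i), map_mul,
          ← IsScalarTower.algebraMap_apply]
      rw [h2, hae, IntermediateField.coe_smul, Algebra.smul_def, Algebra.smul_def,
        Algebra.smul_def, ← IsScalarTower.algebraMap_apply, map_mul, mul_assoc]
    have := Fintype.linearIndependent_iff.1 b.linearIndependent _ h1 i
    rw [map_eq_zero_iff _ (IsFractionRing.injective _ _)] at this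
    exact (mul_eq_zero.1 this).resolve_right (ha i)
  have hrot : ∀ x ∈ Units.val '' S, algebraMap (PowerSeries F) L (PowerSeries.rescale x ψ) ∈ E := by
    rintro _ ⟨ζ, hζ, rfl⟩
    rw [← rotate_algebraMap, haψ, Algebra.smul_def, map_mul, rotate_algebraMap_polynomial,
      ← Algebra.smul_def]
    exact hsmul _ _ (hSE ζ hζ)
  obtain ⟨p, r, hp, hpr⟩ := exists_polynomial_mul_eq_of_rescale_mem_of_isIntegral (L := L) E rfl e
    (fun i => by rw [hae]; exact hsmul _ _ (b i).2) he hind ψ hψ (Units.val '' S)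
    (hS.image Units.val_injective.injOn) hrot
  refine ⟨algebraMap _ _ r / (algebraMap _ _ p * algebraMap _ _ a'), ?_⟩
  have hp' := (map_ne_zero_iff _ hinj).2 hp
  have ha'' := (map_ne_zero_iff _ hinj).2 ha'
  rw [map_div₀, map_mul, ← IsScalarTower.algebraMap_apply, ← IsScalarTower.algebraMap_apply,
    ← IsScalarTower.algebraMap_apply, div_eq_iff (mul_ne_zero hp' ha'')]
  have := congrArg (algebraMap _ L) hpr
  rw [map_mul, haψ, ← PowerSeries.algebraMap_polynomial, ← PowerSeries.algebraMap_polynomial,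
    ← IsScalarTower.algebraMap_apply, ← IsScalarTower.algebraMap_apply, Algebra.smul_def] at this
  rw [← this]
  ring_nf

end FunctionField

section FunctionField

variable {F : Type*} [Field F] {L : Type*} [Field L] [Algebra (PowerSeries F) L]
  [IsFractionRing (PowerSeries F) L]

theorem rotate_inv_rotate (ζ : Fˣ) (x : L) : rotate L ζ⁻¹ (rotate L ζ x) = x := by
  obtain ⟨a, b, -, rfl⟩ := IsFractionRing.div_surjective (A := PowerSeries F) x
  simp only [map_div₀, rotate_algebraMap, PowerSeries.rescale_rescale]
  simp

variable [Algebra F[X] L] [IsScalarTower F[X] (PowerSeries F) L]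
  [Algebra (RatFunc F) L] [IsScalarTower F[X] (RatFunc F) L]

theorem isAlgebraic_rotate {x : L} (ζ : Fˣ) (hx : IsAlgebraic (RatFunc F) x) :
    IsAlgebraic (RatFunc F) (rotate L ζ x) := by
  rw [← IsFractionRing.isAlgebraic_iff F[X]] at hx ⊢
  refine hx.ringHom_of_comp_eq (Polynomial.compRingHom (C (ζ : F) * X)) (rotate L ζ) ?_ ?_
  · intro p r h
    have h' := congrArg (fun p : F[X] => p.comp (C ((ζ⁻¹ : Fˣ) : F) * X)) h
    simp only [coe_compRingHom_apply, comp_assoc, mul_comp, C_comp, X_comp] at h'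
    rw [← mul_assoc, ← C_mul] at h'
    simpa using h'
  · ext1
    · ext x
      simp [rotate_algebraMap_polynomial]
    · simp [rotate_algebraMap_polynomial]

/-- Rotation stable spaces of Laurent series are linearly disjoint from the algebraic ones. -/
theorem eq_zero_of_isAlgebraic_of_sum_mul_eq_zero {ι : Type*} [Fintype ι] (w : ι → L)
    (hw : LinearIndependent (RatFunc F) w) (S : Set Fˣ) (hS : S.Infinite)
    (hstab : ∀ ζ ∈ S, ∀ j, ∃ M : ι → RatFunc F,
      rotate L ζ (w j) = ∑ i, algebraMap _ L (M i) * w i)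
    (v : ι → L) (hv : ∀ i, IsAlgebraic (RatFunc F) (v i)) (h : ∑ i, v i * w i = 0) : v = 0 := by
  classical
  obtain ⟨κ, a, ha, hspan, hind⟩ := exists_linearIndependent' (algebraicClosure (RatFunc F) L) w
  have : Fintype κ := Fintype.ofInjective a ha
  have hind' (c : κ → L) (hc : ∀ i, IsAlgebraic (RatFunc F) (c i))
      (h : ∑ i, c i * w (a i) = 0) (i : κ) : c i = 0 := by
    have := Fintype.linearIndependent_iff.1 hind
      (fun i => ⟨c i, mem_algebraicClosure_iff.2 (hc i)⟩) h i
    exact congrArg Subtype.val this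
  have hφ (j : ι) : ∃ φ : κ → L, (∀ k, IsAlgebraic (RatFunc F) (φ k)) ∧
      w j = ∑ k, φ k * w (a k) := by
    have : w j ∈ Submodule.span (algebraicClosure (RatFunc F) L) (Set.range (w ∘ a)) := by
      rw [hspan]
      exact Submodule.subset_span ⟨j, rfl⟩
    obtain ⟨φ, hφ⟩ := (Submodule.mem_span_range_iff_exists_fun _).1 this
    exact ⟨fun k => φ k, fun k => mem_algebraicClosure_iff.1 (φ k).2, hφ.symm⟩
  choose φ hφalg hφ using hφ
  let E := IntermediateField.adjoin (RatFunc F) (Set.range fun p : ι × κ => φ p.1 p.2)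
  have hφE (j k) : φ j k ∈ E := IntermediateField.subset_adjoin _ _ ⟨(j, k), rfl⟩
  have : FiniteDimensional (RatFunc F) E := by
    refine IntermediateField.finiteDimensional_adjoin ?_
    rintro _ ⟨p, rfl⟩
    exact (hφalg _ _).isIntegral
  have hEalg {x : L} (hx : x ∈ E) : IsAlgebraic (RatFunc F) x :=
    (isAlgebraic_algebraMap_iff (algebraMap E L).injective).2
        (Algebra.IsAlgebraic.isAlgebraic (R := RatFunc F) (⟨x, hx⟩ : E))
  have hrot (ζ) (hζ : ζ ∈ S) (j : ι) (k : κ) : rotate L ζ (φ j k) ∈ E := by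
    have hN (j : ι) : ∃ N : κ → E, rotate L ζ (w j) = ∑ l, (N l : L) * w (a l) := by
      obtain ⟨M, hM⟩ := hstab ζ hζ j
      refine ⟨fun l => ∑ i, algebraMap (RatFunc F) E (M i) * ⟨φ i l, hφE i l⟩, ?_⟩
      rw [hM]
      conv_lhs => enter [2, i]; rw [hφ i, Finset.mul_sum]
      rw [Finset.sum_comm]
      refine Finset.sum_congr rfl fun l _ => ?_
      rw [AddSubmonoidClass.coe_finsetSum, Finset.sum_mul]
      refine Finset.sum_congr rfl fun i _ => ?_
      rw [← mul_assoc]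
      rfl
    choose N hN using hN
    let M : Matrix κ κ E := fun k l => N (a k) l
    have hdet : M.det ≠ 0 := by
      intro h0
      obtain ⟨c, hc0, hc⟩ := Matrix.exists_vecMul_eq_zero_iff.2 h0
      apply hc0
      have h1 : ∑ k, (c k : L) * rotate L ζ (w (a k)) = 0 := by
        conv_lhs => enter [2, k]; rw [hN, Finset.mul_sum]
        rw [Finset.sum_comm]
        refine Finset.sum_eq_zero fun l _ => ?_
        have := congrArg Subtype.val (congrFun hc l)
        rw [Matrix.vecMul, dotProduct, AddSubmonoidClass.coe_finsetSum] at this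
        simp_rw [← mul_assoc]
        rw [← Finset.sum_mul]
        exact mul_eq_zero_of_left this _
      have h2 := congrArg (rotate L ζ⁻¹) h1
      simp_rw [map_sum, map_mul, rotate_inv_rotate, map_zero] at h2
      ext k
      have := hind' _ (fun i => isAlgebraic_rotate _ (hEalg (c i).2)) h2 k
      rwa [map_eq_zero] at this
    have hmul : Matrix.vecMul (fun k => rotate L ζ (φ j k)) (M.map (algebraMap E L)) =
        fun l => (N j l : L) := by
      have h1 : ∑ l, ((∑ k, rotate L ζ (φ j k) * (M k l : L)) - N j l) * w (a l) = 0 := by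
        simp_rw [sub_mul, Finset.sum_sub_distrib]
        rw [← hN, sub_eq_zero]
        conv_rhs => rw [hφ j, map_sum]
        simp_rw [Finset.sum_mul]
        rw [Finset.sum_comm]
        refine Finset.sum_congr rfl fun k _ => ?_
        rw [map_mul, hN, Finset.mul_sum]
        exact Finset.sum_congr rfl fun l _ => mul_assoc _ _ _
      ext l
      refine sub_eq_zero.1 (hind' _ (fun l => ?_) h1 l)
      refine IsAlgebraic.sub ?_ (hEalg (N j l).2)
      exact mem_algebraicClosure_iff.1 <| sum_mem fun k _ => mem_algebraicClosure_iff.2 <|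
        (isAlgebraic_rotate _ (hφalg _ _)).mul (hEalg (M k l).2)
    have hinv : M.map (algebraMap E L) * (M⁻¹).map (algebraMap E L) = 1 := by
      rw [← Matrix.map_mul, Matrix.mul_nonsing_inv _ (isUnit_iff_ne_zero.2 hdet),
        Matrix.map_one _ (map_zero _) (map_one _)]
    have h3 := congrArg (fun x => Matrix.vecMul x ((M⁻¹).map (algebraMap E L))) hmul
    simp only [Matrix.vecMul_vecMul, hinv, Matrix.vecMul_one] at h3
    rw [congrFun h3 k, Matrix.vecMul, dotProduct]
    exact sum_mem fun l _ => mul_mem (N j l).2 (M⁻¹ l k).2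
  choose r hr using fun j k => mem_range_algebraMap_of_rotate_mem E (φ j k) (hφE j k) S hS
    fun ζ hζ => hrot ζ hζ j k
  have hsurj : Function.Surjective a := by
    intro j
    by_contra hj
    have h1 : ∑ i, (Pi.single j 1 - ∑ k, Pi.single (a k) (r j k) : ι → RatFunc F) i • w i = 0 := by
      simp only [Pi.sub_apply, sub_smul, Finset.sum_sub_distrib, Finset.sum_apply,
        Finset.sum_smul, Pi.single_apply, ite_smul, one_smul, zero_smul]
      rw [Finset.sum_comm (s := Finset.univ) (t := Finset.univ)]
      simp only [Finset.sum_ite_eq', Finset.mem_univ, if_true]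
      rw [sub_eq_zero, hφ j]
      exact Finset.sum_congr rfl fun k _ => by rw [Algebra.smul_def, hr]
    have h2 := Fintype.linearIndependent_iff.1 hw _ h1 j
    rw [Pi.sub_apply, Pi.single_eq_same, Finset.sum_apply, Finset.sum_eq_zero, sub_zero] at h2
    · exact one_ne_zero h2
    · intro k _
      exact Pi.single_eq_of_ne (fun h => hj ⟨k, h.symm⟩) _
  ext j
  obtain ⟨k, rfl⟩ := hsurj j
  refine hind' (fun k => v (a k)) (fun k => hv _) ?_ k
  rw [← h]
  exact Fintype.sum_bijective a ⟨ha, hsurj⟩ _ _ fun _ => rfl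

end FunctionField

section Heights

open Height

variable {k : Type*} [Field k] [NumberField k]

theorem Height.logHeight_powers_le (z : k) (d : ℕ) :
    logHeight (fun t : Fin (d + 1) => z ^ (t : ℕ)) ≤ d * logHeight₁ z := by
  have h1 := logHeight_fun_prod_eq (K := k) (α := Fin d) (ι := fun _ => Fin 2)
    (x := fun _ => ![z, 1]) (fun _ => by simp)
  simp only [Finset.sum_const, Finset.card_univ, Fintype.card_fin, nsmul_eq_mul,
    ← logHeight₁_eq_logHeight] at h1
  rw [← h1]
  refine le_trans (le_of_eq ?_) (logHeight_comp_le
    (fun (t : Fin (d + 1)) (a : Fin d) => if (a : ℕ) < t then (0 : Fin 2) else 1) _)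
  congr 1
  ext t
  have h2 (a : Fin d) : ![z, 1] (if (a : ℕ) < t then (0 : Fin 2) else 1) =
      if (a : ℕ) < t then z else 1 := by
    split_ifs <;> rfl
  simp only [Function.comp_def, h2]
  rw [Finset.prod_ite, Finset.prod_const_one, mul_one, Finset.prod_const]
  congr 1
  have : t ≤ d := Nat.lt_succ_iff.1 t.2
  rw [Fin.card_filter_val_lt, min_eq_right this]

theorem Height.logHeight_le_sum_logHeight₁ {ι : Type*} [Fintype ι] (x : ι → k) :
    logHeight x ≤ ∑ i, logHeight₁ (x i) := by
  classical
  have h1 := logHeight_fun_prod_eq (K := k) (α := ι) (ι := fun _ => Fin 2)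
    (x := fun i => ![x i, 1]) (fun _ => by simp)
  simp only [← logHeight₁_eq_logHeight] at h1
  rw [← h1]
  refine le_trans (le_of_eq ?_) (logHeight_comp_le
    (fun (i j : ι) => if j = i then (0 : Fin 2) else 1) _)
  congr 1
  ext i
  rw [Function.comp_apply, Finset.prod_eq_single i]
  · simp
  · intro j _ hj
    simp [hj]
  · simp

theorem Height.exists_logHeight₁_sum_mul_le {ι : Type*} [Fintype ι] (c : ι → k) :
    ∃ C : ℝ, ∀ x : ι → k, (∃ i, x i = 1) → logHeight₁ (∑ i, c i * x i) ≤ C + logHeight x := by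
  classical
  let A (i₀ : ι) : Fin 2 × ι → k := fun p => ![c, Pi.single i₀ 1] p.1 p.2
  refine ⟨∑ i₀, (totalWeight k * Real.log (Nat.card ι) + logHeight (A i₀)), ?_⟩
  rintro x ⟨i₀, hi₀⟩
  have h1 := logHeight_linearMap_apply_le (A i₀) x
  have h2 : (fun j : Fin 2 => ∑ i, A i₀ (j, i) * x i) = ![∑ i, c i * x i, 1] := by
    ext j
    fin_cases j
    · simp [A]
    · simp [A, Pi.single_apply, hi₀]
  rw [h2, ← logHeight₁_eq_logHeight] at h1
  refine h1.trans (add_le_add_left ?_ _)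
  refine Finset.single_le_sum (f := fun i₀ =>
    totalWeight k * Real.log (Nat.card ι) + logHeight (A i₀)) (fun i _ => ?_) (Finset.mem_univ i₀)
  have := logHeight_nonneg (A i)
  positivity

theorem Height.exists_logHeight₁_sum_eval_mul_le {ι : Type*} [Fintype ι] (P : ι → k[X]) (d : ℕ)
    (hP : ∀ i, (P i).natDegree ≤ d) :
    ∃ C : ℝ, ∀ (z : k) (x : ι → k), (∃ i, x i = 1) →
      logHeight₁ (∑ i, (P i).eval z * x i) ≤ C + d * logHeight₁ z + ∑ i, logHeight₁ (x i) := by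
  obtain ⟨C, hC⟩ := exists_logHeight₁_sum_mul_le
    (fun p : Fin (d + 1) × ι => (P p.2).coeff (p.1 : ℕ))
  refine ⟨C, fun z x hx => ?_⟩
  obtain ⟨i₀, hi₀⟩ := hx
  have h1 := hC (fun p => z ^ (p.1 : ℕ) * x p.2) ⟨(0, i₀), by simp [hi₀]⟩
  rw [logHeight_fun_mul_eq (x := fun t : Fin (d + 1) => z ^ (t : ℕ))
    (fun h => by simpa using congrFun h 0)
    (fun h => by simpa [hi₀] using congrFun h i₀), Fintype.sum_prod_type_right] at h1
  have h2 : ∑ i, (P i).eval z * x i =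
      ∑ i, ∑ t : Fin (d + 1), (P i).coeff (t : ℕ) * (z ^ (t : ℕ) * x i) := by
    refine Finset.sum_congr rfl fun i _ => ?_
    rw [eval_eq_sum_range' (Nat.lt_succ_of_le (hP i)), Finset.sum_mul, Finset.sum_range]
    exact Finset.sum_congr rfl fun t _ => mul_assoc _ _ _
  rw [h2]
  linarith [logHeight_powers_le z d, logHeight_le_sum_logHeight₁ x]

theorem Height.exists_logHeight₁_eval_le (p : k[X]) :
    ∃ C : ℝ, ∀ z : k, logHeight₁ (p.eval z) ≤ C + p.natDegree * logHeight₁ z := by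
  obtain ⟨C, hC⟩ := exists_logHeight₁_sum_eval_mul_le (fun _ : Unit => p) p.natDegree fun _ => le_rfl
  exact ⟨C, fun z => by simpa using hC z (fun _ => 1) ⟨(), rfl⟩⟩

theorem NumberField.log_norm_le_logHeight₁ (φ : k →+* ℂ) (x : k) :
    Real.log ‖φ x‖ ≤ logHeight₁ x := by
  rw [NumberField.logHeight₁_eq]
  have h1 : 0 ≤ ∑ᶠ v : FinitePlace k, Real.posLog (v x) :=
    finsum_nonneg fun v => Real.posLog_nonneg
  have h2 : Real.posLog ‖φ x‖ ≤ ∑ v : InfinitePlace k, v.mult * Real.posLog (v x) := by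
    refine le_trans ?_ (Finset.single_le_sum (f := fun v : InfinitePlace k =>
      (v.mult : ℝ) * Real.posLog (v x)) (fun v _ => ?_) (Finset.mem_univ (InfinitePlace.mk φ)))
    · rw [InfinitePlace.apply]
      refine le_mul_of_one_le_left Real.posLog_nonneg ?_
      exact_mod_cast InfinitePlace.one_le_mult
    · exact mul_nonneg (Nat.cast_nonneg _) Real.posLog_nonneg
  have h3 : Real.log ‖φ x‖ ≤ Real.posLog ‖φ x‖ := le_max_right _ _
  linarith

/-- Liouville's inequality. -/
theorem NumberField.neg_logHeight₁_le_log_norm (φ : k →+* ℂ) (x : k) :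
    -logHeight₁ x ≤ Real.log ‖φ x‖ := by
  have := log_norm_le_logHeight₁ φ x⁻¹
  rw [map_inv₀, norm_inv, Real.log_inv, logHeight₁_inv] at this
  linarith

theorem Height.logHeight₁_div_le_logHeight {ι : Type*} [Finite ι] (x : ι → k) (i j : ι) :
    logHeight₁ (x i / x j) ≤ logHeight x := by
  rw [logHeight₁_div_eq_logHeight]
  refine le_trans (le_of_eq ?_) (logHeight_comp_le ![i, j] x)
  congr 1
  ext l
  fin_cases l <;> rfl

end Heights

section ConvergentSeries

open Filter Topology

theorem psEval_add {f g : PowerSeries ℂ} {z : ℂ}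
    (hf : Summable fun n => PowerSeries.coeff n f * z ^ n)
    (hg : Summable fun n => PowerSeries.coeff n g * z ^ n) :
    psEval (f + g) z = psEval f z + psEval g z := by
  simp only [psEval, map_add, add_mul]
  exact hf.tsum_add hg

theorem coeff_mul_mul_pow (f g : PowerSeries ℂ) (z : ℂ) (n : ℕ) :
    PowerSeries.coeff n (f * g) * z ^ n = ∑ p ∈ Finset.HasAntidiagonal.antidiagonal n,
      (PowerSeries.coeff p.1 f * z ^ p.1) * (PowerSeries.coeff p.2 g * z ^ p.2) := by
  rw [PowerSeries.coeff_mul, Finset.sum_mul]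
  refine Finset.sum_congr rfl fun p hp => ?_
  rw [← Finset.HasAntidiagonal.mem_antidiagonal.1 hp, pow_add]
  ring

theorem summable_coeff_mul {f g : PowerSeries ℂ} {z : ℂ}
    (hf : Summable fun n => PowerSeries.coeff n f * z ^ n)
    (hg : Summable fun n => PowerSeries.coeff n g * z ^ n) :
    Summable fun n => PowerSeries.coeff n (f * g) * z ^ n := by
  simp only [coeff_mul_mul_pow]
  exact (summable_norm_sum_mul_antidiagonal_of_summable_norm hf.norm hg.norm).of_norm

theorem psEval_mul {f g : PowerSeries ℂ} {z : ℂ}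
    (hf : Summable fun n => PowerSeries.coeff n f * z ^ n)
    (hg : Summable fun n => PowerSeries.coeff n g * z ^ n) :
    psEval (f * g) z = psEval f z * psEval g z := by
  simp only [psEval, coeff_mul_mul_pow]
  exact (tsum_mul_tsum_eq_tsum_sum_antidiagonal_of_summable_norm hf.norm hg.norm).symm

theorem hasSum_coeff_polynomial (p : ℂ[X]) (z : ℂ) :
    HasSum (fun n => PowerSeries.coeff n (p : PowerSeries ℂ) * z ^ n) (p.eval z) := by
  simp only [Polynomial.coeff_coe, Polynomial.eval_eq_sum, Polynomial.sum_def]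
  refine hasSum_sum_of_ne_finset_zero fun n hn => ?_
  rw [Polynomial.notMem_support_iff.1 hn, zero_mul]

theorem psEval_polynomial (p : ℂ[X]) (z : ℂ) : psEval (p : PowerSeries ℂ) z = p.eval z :=
  (hasSum_coeff_polynomial p z).tsum_eq

theorem anOnBall_polynomial (p : ℂ[X]) (r : ℝ) : AnOnBall (p : PowerSeries ℂ) r :=
  fun z _ => (hasSum_coeff_polynomial p z).summable

theorem AnOnBall.mono {f : PowerSeries ℂ} {r s : ℝ} (h : AnOnBall f s) (hrs : r ≤ s) :
    AnOnBall f r := fun z hz => h z (hz.trans_le hrs)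

theorem AnOnBall.add {f g : PowerSeries ℂ} {r : ℝ} (hf : AnOnBall f r) (hg : AnOnBall g r) :
    AnOnBall (f + g) r := fun z hz => by
  simpa only [map_add, add_mul] using (hf z hz).add (hg z hz)

theorem AnOnBall.mul {f g : PowerSeries ℂ} {r : ℝ} (hf : AnOnBall f r) (hg : AnOnBall g r) :
    AnOnBall (f * g) r := fun z hz => summable_coeff_mul (hf z hz) (hg z hz)

/-- The ring of power series with positive radius of convergence. -/
def convergentSeries : Subring (PowerSeries ℂ) where
  carrier := {f | ∃ r > 0, AnOnBall f r}
  mul_mem' := by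
    rintro f g ⟨r, hr, hf⟩ ⟨s, hs, hg⟩
    exact ⟨min r s, lt_min hr hs, (hf.mono (min_le_left _ _)).mul (hg.mono (min_le_right _ _))⟩
  add_mem' := by
    rintro f g ⟨r, hr, hf⟩ ⟨s, hs, hg⟩
    exact ⟨min r s, lt_min hr hs, (hf.mono (min_le_left _ _)).add (hg.mono (min_le_right _ _))⟩
  one_mem' := ⟨1, one_pos, by simpa using anOnBall_polynomial 1 1⟩
  zero_mem' := ⟨1, one_pos, by simpa using anOnBall_polynomial 0 1⟩
  neg_mem' := by
    rintro f ⟨r, hr, hf⟩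
    exact ⟨r, hr, fun z hz => by simpa using (hf z hz).neg⟩

theorem polynomial_mem_convergentSeries (p : ℂ[X]) : (p : PowerSeries ℂ) ∈ convergentSeries :=
  ⟨1, one_pos, anOnBall_polynomial p 1⟩

theorem eventually_summable {f : PowerSeries ℂ} (hf : f ∈ convergentSeries) :
    ∀ᶠ z in 𝓝 (0 : ℂ), Summable fun n => PowerSeries.coeff n f * z ^ n := by
  obtain ⟨r, hr, hf⟩ := hf
  filter_upwards [Metric.ball_mem_nhds (0 : ℂ) hr] with z hz
  exact hf z (by simpa using hz)

theorem exists_norm_psEval_le {f : PowerSeries ℂ} (hf : f ∈ convergentSeries) :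
    ∃ C : ℝ, 0 ≤ C ∧ ∀ᶠ z in 𝓝 (0 : ℂ), ‖psEval f z‖ ≤ C := by
  obtain ⟨r, hr, hf⟩ := hf
  have h1 := (hf ((r / 2 : ℝ) : ℂ) (by
    rw [Complex.norm_real, Real.norm_of_nonneg (by positivity)]; linarith)).norm
  refine ⟨∑' n, ‖PowerSeries.coeff n f * ((r / 2 : ℝ) : ℂ) ^ n‖,
    tsum_nonneg fun _ => norm_nonneg _, ?_⟩
  filter_upwards [Metric.ball_mem_nhds (0 : ℂ) (half_pos hr)] with z hz
  refine tsum_of_norm_bounded h1.hasSum fun n => ?_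
  rw [norm_mul, norm_mul, norm_pow, norm_pow]
  gcongr
  rw [Complex.norm_real, Real.norm_of_nonneg (by positivity)]
  simpa using (mem_ball_zero_iff.1 hz).le

theorem mem_convergentSeries_of_X_pow_mul {f : PowerSeries ℂ} {N : ℕ}
    (hf : PowerSeries.X ^ N * f ∈ convergentSeries) : f ∈ convergentSeries := by
  obtain ⟨r, hr, hf⟩ := hf
  refine ⟨r, hr, fun z hz => ?_⟩
  rcases eq_or_ne z 0 with rfl | hz0
  · refine summable_of_ne_finset_zero (s := {0}) fun n hn => ?_
    rw [zero_pow (by simpa using hn), mul_zero]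
  · have h1 := (summable_nat_add_iff N).2 (hf z hz)
    refine (h1.mul_right (z ^ N)⁻¹).congr fun n => ?_
    rw [PowerSeries.coeff_X_pow_mul, pow_add]
    field_simp

theorem eventually_psEval_mul {f g : PowerSeries ℂ} (hf : f ∈ convergentSeries)
    (hg : g ∈ convergentSeries) :
    ∀ᶠ z in 𝓝 (0 : ℂ), psEval (f * g) z = psEval f z * psEval g z := by
  filter_upwards [eventually_summable hf, eventually_summable hg] with z h1 h2
  exact psEval_mul h1 h2

theorem eventually_psEval_add {f g : PowerSeries ℂ} (hf : f ∈ convergentSeries)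
    (hg : g ∈ convergentSeries) :
    ∀ᶠ z in 𝓝 (0 : ℂ), psEval (f + g) z = psEval f z + psEval g z := by
  filter_upwards [eventually_summable hf, eventually_summable hg] with z h1 h2
  exact psEval_add h1 h2

theorem psEval_X_pow (N : ℕ) (z : ℂ) : psEval (PowerSeries.X ^ N) z = z ^ N := by
  have := psEval_polynomial (X ^ N) z
  rwa [coe_pow, coe_X, eval_pow, eval_X] at this

theorem X_pow_mem_convergentSeries (N : ℕ) :
    (PowerSeries.X ^ N : PowerSeries ℂ) ∈ convergentSeries := by
  have := polynomial_mem_convergentSeries (X ^ N)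
  rwa [coe_pow, coe_X] at this

theorem exists_norm_psEval_le_pow {f : PowerSeries ℂ} (hf : f ∈ convergentSeries) {N : ℕ}
    (hN : ∀ n < N, PowerSeries.coeff n f = 0) :
    ∃ C : ℝ, 0 ≤ C ∧ ∀ᶠ z in 𝓝 (0 : ℂ), ‖psEval f z‖ ≤ C * ‖z‖ ^ N := by
  obtain ⟨g, rfl⟩ := PowerSeries.X_pow_dvd_iff.2 hN
  have hg := mem_convergentSeries_of_X_pow_mul hf
  obtain ⟨C, hC0, hC⟩ := exists_norm_psEval_le hg
  refine ⟨C, hC0, ?_⟩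
  filter_upwards [hC, eventually_psEval_mul (X_pow_mem_convergentSeries N) hg] with z h1 h2
  rw [h2, psEval_X_pow, norm_mul, norm_pow, mul_comm]
  gcongr

theorem exists_le_norm_psEval {f : PowerSeries ℂ} (hf : f ∈ convergentSeries) (hf0 : f ≠ 0) :
    ∃ c : ℝ, 0 < c ∧ ∃ b : ℕ, ∀ᶠ z in 𝓝 (0 : ℂ), c * ‖z‖ ^ b ≤ ‖psEval f z‖ := by
  classical
  obtain ⟨b, u, hfu, hu0⟩ : ∃ (b : ℕ) (u : PowerSeries ℂ), f = PowerSeries.X ^ b * u ∧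
      PowerSeries.constantCoeff u ≠ 0 := by
    have hex := PowerSeries.exists_coeff_ne_zero_iff_ne_zero.2 hf0
    obtain ⟨b, hb, hmin⟩ : ∃ b, PowerSeries.coeff b f ≠ 0 ∧ ∀ n < b, PowerSeries.coeff n f = 0 :=
      ⟨Nat.find hex, Nat.find_spec hex, fun n hn => not_not.1 (Nat.find_min hex hn)⟩
    obtain ⟨u, rfl⟩ := PowerSeries.X_pow_dvd_iff.2 hmin
    refine ⟨b, u, rfl, fun h => hb ?_⟩
    simpa [PowerSeries.coeff_X_pow_mul'] using h
  subst hfu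
  have hu := mem_convergentSeries_of_X_pow_mul hf
  set a := PowerSeries.constantCoeff u
  have hd : u - PowerSeries.C a ∈ convergentSeries := by
    have := polynomial_mem_convergentSeries (C a)
    rw [coe_C] at this
    exact sub_mem hu this
  obtain ⟨C', hC0, hC⟩ := exists_norm_psEval_le_pow hd (N := 1) (by
    intro n hn
    obtain rfl : n = 0 := by omega
    simp [a])
  have ha : 0 < ‖a‖ := norm_pos_iff.2 hu0
  refine ⟨‖a‖ / 2, by positivity, b, ?_⟩
  have h3 := eventually_psEval_add hd (polynomial_mem_convergentSeries (C a))
  filter_upwards [hC, eventually_psEval_mul (X_pow_mem_convergentSeries b) hu, h3,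
    Metric.ball_mem_nhds (0 : ℂ) (show 0 < ‖a‖ / (2 * (C' + 1)) by positivity)] with z h1 h2 h3 h4
  rw [h2, psEval_X_pow, norm_mul, norm_pow, mul_comm]
  gcongr
  rw [psEval_polynomial, eval_C, coe_C, sub_add_cancel] at h3
  rw [mem_ball_zero_iff, lt_div_iff₀ (by positivity)] at h4
  have h5 : ‖a‖ ≤ ‖psEval u z‖ + ‖psEval (u - PowerSeries.C a) z‖ := by
    have : a = psEval u z - psEval (u - PowerSeries.C a) z := by rw [h3]; ring
    conv_lhs => rw [this]
    exact norm_sub_le _ _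
  rw [pow_one] at h1
  nlinarith [norm_nonneg z]

end ConvergentSeries

section BoxMonomials

theorem exists_sub_pow_mul_lt (s D N : ℕ) :
    ∃ m : ℕ, ((m + D + 1) ^ s - (m + 1) ^ s) * N < (m + D + 1) ^ s := by
  refine ⟨s * D * N, ?_⟩
  set n := s * D * N + D + 1
  have hle : s * D * N + 1 ≤ n := by omega
  have hn : (0 : ℝ) < n := by positivity
  have h1 : (1 : ℝ) + s * (-(D / n)) ≤ (1 + -(D / n)) ^ s := by
    refine one_add_mul_le_pow ?_ s
    have : (D : ℝ) / n ≤ 1 := (div_le_one hn).2 (by simp only [n]; push_cast; nlinarith [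
      (by positivity : (0 : ℝ) ≤ s * D * N)])
    linarith
  have h2 : ((s * D * N + 1 : ℕ) : ℝ) = n * (1 + -(D / n)) := by
    field_simp
    simp only [n]
    push_cast
    ring
  have h3 : (s * D * N : ℝ) < n := by
    simp only [n]
    push_cast
    linarith [(Nat.cast_nonneg D : (0 : ℝ) ≤ D)]
  have hpow : (0 : ℝ) < (n : ℝ) ^ s := by positivity
  have h4 : ((((n ^ s - (s * D * N + 1) ^ s) * N : ℕ)) : ℝ) < ((n ^ s : ℕ) : ℝ) := by
    rw [Nat.cast_mul, Nat.cast_sub (Nat.pow_le_pow_left hle s)]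
    rw [Nat.cast_pow, Nat.cast_pow, h2, mul_pow]
    calc ((n : ℝ) ^ s - n ^ s * (1 + -(D / n)) ^ s) * N
        = n ^ s * (1 - (1 + -(D / n)) ^ s) * N := by ring
      _ ≤ n ^ s * (s * (D / n)) * N := by gcongr; linarith
      _ = n ^ s * (s * D * N / n) := by ring
      _ < n ^ s * 1 := by
        gcongr
        exact (div_lt_one hn).2 h3
      _ = _ := mul_one _
  exact_mod_cast h4

variable {C Ω ι : Type*} [Field C] [Field Ω] [Algebra C Ω] [Fintype ι]

theorem MvPolynomial.finrank_restrictDegree (n : ℕ) :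
    Module.finrank C (MvPolynomial.restrictDegree ι C n) = (n + 1) ^ Fintype.card ι := by
  classical
  let e : {s : ι →₀ ℕ | ∀ i, s i ≤ n} ≃ (ι → Fin (n + 1)) :=
    { toFun := fun s i => ⟨s.1 i, Nat.lt_succ_of_le (s.2 i)⟩
      invFun := fun f => ⟨Finsupp.equivFunOnFinite.symm fun i => (f i : ℕ),
        fun i => Nat.le_of_lt_succ (f i).2⟩
      left_inv := fun s => by ext; rfl
      right_inv := fun f => by ext; rfl }
  have b := (MvPolynomial.basisRestrictSupport C {s : ι →₀ ℕ | ∀ i, s i ≤ n}).reindex e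
  have h := Module.finrank_eq_card_basis b
  rw [Fintype.card_fun, Fintype.card_fin] at h
  exact h

/-- If `u` is algebraically dependent over `C`, then the monomials in `u` with exponents in a large
box are spanned by a small proportion of them. -/
theorem exists_monomials_span_of_not_algebraicIndependent (u : ι → Ω)
    (hu : ¬ AlgebraicIndependent C u) (N : ℕ) :
    ∃ (n : ℕ) (κ : Type) (_ : Fintype κ) (a : κ → ι → Fin (n + 1))
      (c : κ → (ι → Fin (n + 1)) → C),
      Fintype.card κ * N < (n + 1) ^ Fintype.card ι ∧
      ∀ b : ι → Fin (n + 1), ∏ i, u i ^ (b i : ℕ) =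
        ∑ m, algebraMap C Ω (c m b) * ∏ i, u i ^ (a m i : ℕ) := by
  classical
  obtain ⟨Q, hQ, hQ0⟩ : ∃ Q : MvPolynomial ι C, MvPolynomial.aeval u Q = 0 ∧ Q ≠ 0 := by
    rw [algebraicIndependent_iff] at hu
    push Not at hu
    exact hu
  set D := Q.totalDegree
  obtain ⟨m, hm⟩ := exists_sub_pow_mul_lt (Fintype.card ι) D N
  set n := m + D
  let T : MvPolynomial.restrictDegree ι C n →ₗ[C] Ω :=
    (MvPolynomial.aeval u).toLinearMap ∘ₗ Submodule.subtype _
  have hmulmem (P : MvPolynomial.restrictDegree ι C m) :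
      Q * P.1 ∈ MvPolynomial.restrictDegree ι C n := by
    rw [MvPolynomial.mem_restrictDegree]
    intro s hs i
    have h1 : (P : MvPolynomial ι C).degreeOf i ≤ m :=
      MvPolynomial.degreeOf_le_iff.2 fun s hs => (MvPolynomial.mem_restrictDegree _ _ _).1 P.2 s hs i
    refine MvPolynomial.degreeOf_le_iff.1 ((MvPolynomial.degreeOf_mul_le i Q P.1).trans ?_) s hs
    have h2 := MvPolynomial.degreeOf_le_totalDegree Q i
    omega
  let W : MvPolynomial.restrictDegree ι C m →ₗ[C] LinearMap.ker T :=
    LinearMap.codRestrict _ (LinearMap.codRestrict _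
      (LinearMap.mulLeft C Q ∘ₗ Submodule.subtype _) hmulmem) fun P => by
        rw [LinearMap.mem_ker]
        change MvPolynomial.aeval u (Q * P.1) = 0
        rw [map_mul, hQ, zero_mul]
  have hW : Function.Injective W := by
    intro P P' h
    have h1 : Q * P.1 = Q * P'.1 := congrArg (fun x => x.1.1) h
    exact Subtype.ext (mul_left_cancel₀ hQ0 h1)
  have h1 := LinearMap.finrank_le_finrank_of_injective hW
  have h2 := LinearMap.finrank_range_add_finrank_ker T
  rw [MvPolynomial.finrank_restrictDegree] at h1 h2
  obtain ⟨κ, a, ha, hspan, hind⟩ :=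
    exists_linearIndependent' C (fun b : ι → Fin (n + 1) => ∏ i, u i ^ (b i : ℕ))
  have : Fintype κ := Fintype.ofInjective a ha
  have hcard : Fintype.card κ ≤ Module.finrank C (LinearMap.range T) := by
    rw [← finrank_span_eq_card hind, hspan]
    apply Submodule.finrank_mono
    rw [Submodule.span_le]
    rintro _ ⟨b, rfl⟩
    refine ⟨⟨MvPolynomial.monomial (Finsupp.equivFunOnFinite.symm fun i => (b i : ℕ)) 1, ?_⟩, ?_⟩
    · rw [MvPolynomial.mem_restrictDegree]
      intro s hs i
      rw [MvPolynomial.support_monomial, if_neg one_ne_zero, Finset.mem_singleton] at hs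
      subst hs
      exact Nat.le_of_lt_succ (b i).2
    · change MvPolynomial.aeval u (MvPolynomial.monomial _ 1) = _
      rw [MvPolynomial.aeval_monomial, map_one, one_mul, Finsupp.prod_fintype _ _ fun i => pow_zero _]
      rfl
  have hc (b : ι → Fin (n + 1)) : ∃ c : κ → C, ∏ i, u i ^ (b i : ℕ) =
      ∑ m, algebraMap C Ω (c m) * ∏ i, u i ^ (a m i : ℕ) := by
    have : ∏ i, u i ^ (b i : ℕ) ∈ Submodule.span C
        (Set.range ((fun b : ι → Fin (n + 1) => ∏ i, u i ^ (b i : ℕ)) ∘ a)) := by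
      rw [hspan]
      exact Submodule.subset_span ⟨b, rfl⟩
    obtain ⟨c, hc⟩ := (Submodule.mem_span_range_iff_exists_fun _).1 this
    refine ⟨c, hc.symm.trans (Finset.sum_congr rfl fun m _ => Algebra.smul_def _ _)⟩
  choose c hc using hc
  refine ⟨n, Fin (Fintype.card κ), inferInstance, a ∘ (Fintype.equivFin κ).symm,
    fun m b => c b ((Fintype.equivFin κ).symm m), ?_, fun b => ?_⟩
  · rw [Fintype.card_fin]
    refine lt_of_le_of_lt (Nat.mul_le_mul_right N ?_) hm
    omega
  · rw [hc]
    exact (Equiv.sum_comp (Fintype.equivFin κ).symm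
      fun m => algebraMap C Ω (c b m) * ∏ i, u i ^ (a m i : ℕ)).symm

end BoxMonomials

section Approximation

open Filter Topology Height

variable {k : Type*} [Field k] [Algebra k ℂ]

variable (k) in
/-- The ring of power series over `k` with positive radius of convergence. -/
noncomputable def convergentSeriesOver : Subring (PowerSeries k) :=
  convergentSeries.comap (PowerSeries.map (algebraMap k ℂ))

/-- The value at a complex point of a power series over `k`. -/
noncomputable def evalOver (f : PowerSeries k) (z : ℂ) : ℂ := psEval (f.map (algebraMap k ℂ)) z

theorem polynomial_mem_convergentSeriesOver (p : k[X]) :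
    (p : PowerSeries k) ∈ convergentSeriesOver k := by
  have := polynomial_mem_convergentSeries (p.map (algebraMap k ℂ))
  rwa [Polynomial.polynomial_map_coe] at this

theorem evalOver_polynomial (p : k[X]) (z : k) :
    evalOver (p : PowerSeries k) (algebraMap k ℂ z) = algebraMap k ℂ (p.eval z) := by
  rw [evalOver, ← Polynomial.polynomial_map_coe, psEval_polynomial, eval_map_algebraMap,
    aeval_algebraMap_apply, coe_aeval_eq_eval]

theorem eventually_evalOver_add {f g : PowerSeries k} (hf : f ∈ convergentSeriesOver k)
    (hg : g ∈ convergentSeriesOver k) :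
    ∀ᶠ z in 𝓝 (0 : ℂ), evalOver (f + g) z = evalOver f z + evalOver g z := by
  simp only [evalOver, map_add]
  exact eventually_psEval_add hf hg

theorem eventually_evalOver_mul {f g : PowerSeries k} (hf : f ∈ convergentSeriesOver k)
    (hg : g ∈ convergentSeriesOver k) :
    ∀ᶠ z in 𝓝 (0 : ℂ), evalOver (f * g) z = evalOver f z * evalOver g z := by
  simp only [evalOver, map_mul]
  exact eventually_psEval_mul hf hg

theorem eventually_evalOver_sum {ι : Type*} (s : Finset ι) (f : ι → PowerSeries k)
    (hf : ∀ i ∈ s, f i ∈ convergentSeriesOver k) :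
    ∀ᶠ z in 𝓝 (0 : ℂ), evalOver (∑ i ∈ s, f i) z = ∑ i ∈ s, evalOver (f i) z := by
  classical
  induction s using Finset.induction_on with
  | empty => simp [evalOver, psEval]
  | insert a s ha ih =>
    simp only [Finset.mem_insert, forall_eq_or_imp] at hf
    filter_upwards [ih hf.2, eventually_evalOver_add hf.1 (sum_mem hf.2)] with z h1 h2
    rw [Finset.sum_insert ha, Finset.sum_insert ha, h2, h1]

variable [NumberField k]

/-- If many sequences `x i` of elements of `k` of moderate height are expressed through few of
them by means of convergent series evaluated along `α ^ q ^ j`, then they satisfy a polynomial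
relation infinitely often. -/
theorem false_of_sum_eval_ne_zero {q : ℕ} (hq : 2 ≤ q) (l : Filter ℕ) [l.NeBot] (hl : l ≤ atTop)
    (α : k) (hα0 : α ≠ 0) (hα1 : ‖algebraMap k ℂ α‖ < 1) {ι κ : Type*} [Fintype ι] [Fintype κ]
    (x : ι → ℕ → k) (i₀ : ι) (hx0 : ∀ j, x i₀ j = 1) (C : ℝ) (hC : 0 ≤ C)
    (hxC : ∀ i j, logHeight₁ (x i j) ≤ C * q ^ j) (a : κ → ι) (g : PowerSeries k)
    (hg : g ∈ convergentSeriesOver k) (hg0 : g ≠ 0) (H : κ → ι → PowerSeries k)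
    (hH : ∀ m i, H m i ∈ convergentSeriesOver k)
    (hrel : ∀ i, ∀ᶠ j in l, evalOver g (algebraMap k ℂ α ^ q ^ j) * algebraMap k ℂ (x i j) =
      ∑ m, evalOver (H m i) (algebraMap k ℂ α ^ q ^ j) * algebraMap k ℂ (x (a m) j))
    (N₀ : ℕ) (hN₀ : logHeight₁ α + 1 ≤ N₀ * -Real.log ‖algebraMap k ℂ α‖)
    (hcard : Fintype.card κ * N₀ < Fintype.card ι)
    (hP : ∀ P : ι → k[X], P ≠ 0 → ∀ᶠ j in l, ∑ i, (P i).eval (α ^ q ^ j) * x i j ≠ 0) :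
    False := by
  set φ := algebraMap k ℂ
  set ℓ := -Real.log ‖φ α‖ with hℓ
  have hα0' : 0 < ‖φ α‖ := norm_pos_iff.2 ((map_ne_zero φ).2 hα0)
  have hqt : Tendsto (fun j : ℕ => (q : ℝ) ^ j) l atTop :=
    (tendsto_pow_atTop_atTop_of_one_lt (by exact_mod_cast hq)).mono_left hl
  have hzt : Tendsto (fun j : ℕ => φ α ^ q ^ j) l (𝓝 0) :=
    ((tendsto_pow_atTop_nhds_zero_of_norm_lt_one hα1).comp
      (tendsto_pow_atTop_atTop_of_one_lt (show 1 < q by omega))).mono_left hl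
  have hlogz (j : ℕ) : Real.log ‖φ α ^ q ^ j‖ = -(ℓ * q ^ j) := by
    rw [norm_pow, Real.log_pow, hℓ]
    push_cast
    ring
  obtain ⟨c, hc, b, hcb⟩ := exists_le_norm_psEval hg (fun h => hg0 <|
    PowerSeries.map_injective _ φ.injective (by rw [h, map_zero]))
  obtain ⟨d, hd⟩ := exists_nat_gt (b * ℓ + C + Fintype.card ι * C + 1)
  have hℓ0 : 0 < ℓ := by
    rw [hℓ, neg_pos]
    exact Real.log_neg hα0' hα1
  have hdpos : 0 < d := by
    have : (0 : ℝ) < d := lt_of_le_of_lt (by positivity) hd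
    exact_mod_cast this
  obtain ⟨P, hP0, hPd, hPN⟩ := exists_polynomials_coeff_sum_mul_eq_zero H d (N₀ * d)
    (by rw [← mul_assoc]; exact Nat.mul_lt_mul_of_pos_right hcard hdpos)
  obtain ⟨CP, hCP⟩ := exists_logHeight₁_sum_eval_mul_le P d
    fun i => natDegree_le_of_degree_le (hPd i).le
  have hmem (m) (i) : (P i : PowerSeries k) * H m i ∈ convergentSeriesOver k :=
    mul_mem (polynomial_mem_convergentSeriesOver _) (hH m i)
  choose A hA0 hA using fun m => exists_norm_psEval_le_pow
    (show (∑ i, (P i : PowerSeries k) * H m i).map φ ∈ convergentSeries from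
      sum_mem (S := convergentSeriesOver k) fun i _ => hmem m i) (N := N₀ * d)
    (fun n hn => by rw [PowerSeries.coeff_map, hPN m n hn, map_zero])
  set B := ∑ m, A m + 1
  have hB : 0 < B := add_pos_of_nonneg_of_pos (Finset.sum_nonneg fun m _ => hA0 m) one_pos
  have hsum (m) := eventually_evalOver_sum Finset.univ _ fun i _ => hmem m i
  have hmul (m) (i) := eventually_evalOver_mul (polynomial_mem_convergentSeriesOver (P i)) (hH m i)
  have hev : ∀ᶠ j in l, (q : ℝ) ^ j ≤ Real.log B - Real.log c + CP := by
    filter_upwards [hP P hP0, eventually_all.2 hrel, hzt.eventually hcb,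
      hzt.eventually (eventually_all.2 hA), hzt.eventually (eventually_all.2 hsum),
      hzt.eventually (eventually_all.2 fun m => eventually_all.2 (hmul m))]
      with j hne hrel hcb hA hsum hmul
    set z := φ α ^ q ^ j
    have hz : z = φ (α ^ q ^ j) := (map_pow _ _ _).symm
    have hz0 : 0 < ‖z‖ := by rw [norm_pow]; positivity
    set S := ∑ i, (P i).eval (α ^ q ^ j) * x i j
    have hid : evalOver g z * φ S =
        ∑ m, evalOver (∑ i, (P i : PowerSeries k) * H m i) z * φ (x (a m) j) := by
      simp only [hsum, hmul, S, map_sum, map_mul, Finset.mul_sum, Finset.sum_mul]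
      rw [Finset.sum_comm]
      refine Finset.sum_congr rfl fun i _ => ?_
      rw [mul_left_comm, hrel i, Finset.mul_sum]
      refine Finset.sum_congr rfl fun m _ => ?_
      rw [hz, evalOver_polynomial, mul_assoc]
    have hxb (i : ι) : ‖φ (x i j)‖ ≤ Real.exp (C * q ^ j) := by
      rcases eq_or_ne (x i j) 0 with h0 | h0
      · rw [h0, map_zero, norm_zero]
        positivity
      · rw [← Real.log_le_iff_le_exp (norm_pos_iff.2 ((map_ne_zero φ).2 h0))]
        exact (NumberField.log_norm_le_logHeight₁ φ _).trans (hxC i j)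
    have hS : 0 < ‖φ S‖ := norm_pos_iff.2 ((map_ne_zero φ).2 hne)
    have h1 : c * ‖z‖ ^ b * ‖φ S‖ ≤ B * ‖z‖ ^ (N₀ * d) * Real.exp (C * q ^ j) := by
      calc c * ‖z‖ ^ b * ‖φ S‖ ≤ ‖evalOver g z‖ * ‖φ S‖ := by gcongr; exact hcb
        _ ≤ ∑ m, A m * ‖z‖ ^ (N₀ * d) * Real.exp (C * q ^ j) := by
          rw [← norm_mul, hid]
          refine (norm_sum_le _ _).trans (Finset.sum_le_sum fun m _ => ?_)
          rw [norm_mul]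
          gcongr
          · exact mul_nonneg (hA0 m) (by positivity)
          · exact hA m
          · exact hxb _
        _ = (∑ m, A m) * ‖z‖ ^ (N₀ * d) * Real.exp (C * q ^ j) := by
          rw [Finset.sum_mul, Finset.sum_mul]
        _ ≤ _ := by
          gcongr
          exact (lt_add_one _).le
    have h2 := Real.log_le_log (by positivity) h1
    rw [Real.log_mul (by positivity) hS.ne', Real.log_mul hc.ne' (by positivity), Real.log_pow,
      Real.log_mul (by positivity) (Real.exp_pos _).ne', Real.log_mul hB.ne' (by positivity),
      Real.log_pow, Real.log_exp, hlogz] at h2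
    have h3 := NumberField.neg_logHeight₁_le_log_norm φ S
    have h4 := hCP (α ^ q ^ j) (fun i => x i j) ⟨i₀, hx0 j⟩
    have h5 : ∑ i, logHeight₁ (x i j) ≤ Fintype.card ι * (C * q ^ j) := by
      refine (Finset.sum_le_sum fun i _ => hxC i j).trans_eq ?_
      simp
    rw [logHeight₁_pow] at h4
    push_cast at h2 h4
    have hqj : (0 : ℝ) < (q : ℝ) ^ j := by positivity
    have h6 : (d : ℝ) * (logHeight₁ α + 1) * q ^ j ≤ d * (N₀ * ℓ) * q ^ j := by gcongr
    have h7 : (b * ℓ + C + Fintype.card ι * C + 1) * (q : ℝ) ^ j ≤ d * q ^ j := by gcongr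
    change -logHeight₁ S ≤ _ at h3
    change logHeight₁ S ≤ _ at h4
    linarith
  obtain ⟨j, h1, h2⟩ := (hev.and (hqt.eventually_gt_atTop _)).exists
  exact absurd h1 (not_le.2 h2)

end Approximation

section Freeness

open Filter Topology Height

variable {k : Type*} [Field k] [Algebra k ℂ] [NumberField k]

/-- Sequences of moderate height which are algebraically independent over `k(z)` along the orbit
`α ^ q ^ j` remain so over the field of fractions of the ring of convergent series. -/
theorem AlgebraicIndependent.extend_convergentSeriesOver {q : ℕ} (hq : 2 ≤ q) (U : Ultrafilter ℕ)
    (hU : (U : Filter ℕ) ≤ atTop) (α : k) (hα0 : α ≠ 0) (hα1 : ‖algebraMap k ℂ α‖ < 1)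
    {Ω : Type*} [Field Ω] (π : (ℕ → ℂ) →+* Ω) (hπ : ∀ f, π f = 0 ↔ ∀ᶠ j in (U : Filter ℕ), f j = 0)
    {C : Type*} [Field C] [Algebra (convergentSeriesOver k) C]
    [IsFractionRing (convergentSeriesOver k) C] [Algebra (convergentSeriesOver k) Ω] [Algebra C Ω]
    [IsScalarTower (convergentSeriesOver k) C Ω]
    (hR : ∀ G : convergentSeriesOver k, algebraMap (convergentSeriesOver k) Ω G =
      π fun j => evalOver G.1 (algebraMap k ℂ α ^ q ^ j))
    [Algebra k[X] Ω]
    (hX : ∀ p : k[X], algebraMap k[X] Ω p = π fun j => algebraMap k ℂ (p.eval (α ^ q ^ j)))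
    {ι : Type*} [Fintype ι] (u : ι → ℕ → k) (D : ℝ) (hD : 0 ≤ D)
    (huD : ∀ i j, logHeight₁ (u i j) ≤ D * q ^ j)
    (hu : AlgebraicIndependent k[X] fun i => π fun j => algebraMap k ℂ (u i j)) :
    AlgebraicIndependent C fun i => π fun j => algebraMap k ℂ (u i j) := by
  classical
  by_contra hcon
  have hℓ : 0 < -Real.log ‖algebraMap k ℂ α‖ := by
    have : 0 < ‖algebraMap k ℂ α‖ := by simpa using hα0
    linarith [Real.log_neg this hα1]
  obtain ⟨N₀, hN₀⟩ := exists_nat_ge ((logHeight₁ α + 1) / -Real.log ‖algebraMap k ℂ α‖)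
  rw [div_le_iff₀ hℓ] at hN₀
  obtain ⟨n, κ, hκ, a, c, hcard, hrel⟩ :=
    exists_monomials_span_of_not_algebraicIndependent _ hcon N₀
  obtain ⟨g, hg⟩ := IsLocalization.exist_integer_multiples_of_finite
    (nonZeroDivisors (convergentSeriesOver k)) (fun mb : κ × (ι → Fin (n + 1)) => c mb.1 mb.2)
  choose H hH using hg
  let x : (ι → Fin (n + 1)) → ℕ → k := fun b j => ∏ i, u i j ^ (b i : ℕ)
  have hx : ∀ b, (π fun j => algebraMap k ℂ (x b j)) =
      ∏ i, (π fun j => algebraMap k ℂ (u i j)) ^ (b i : ℕ) := by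
    intro b
    simp only [← map_pow, ← map_prod]
    congr 1
    funext j
    simp [x, Finset.prod_apply]
  have hg0 : (g : convergentSeriesOver k).1 ≠ 0 := by
    have := nonZeroDivisors.coe_ne_zero g
    exact fun h => this (Subtype.ext h)
  refine false_of_sum_eval_ne_zero hq (U : Filter ℕ) hU α hα0 hα1 x 0 (by intro j; simp [x])
    (Fintype.card ι * (n * D)) (by positivity) ?_ a (g : convergentSeriesOver k).1 (g : convergentSeriesOver k).2
    hg0 (fun m b => (H (m, b)).1) (fun m b => (H (m, b)).2) ?_ N₀ hN₀ ?_ ?_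
  · intro b j
    refine (logHeight₁_prod_le _ _).trans ?_
    have hq0 : (0 : ℝ) ≤ (q : ℝ) ^ j := by positivity
    calc ∑ i, logHeight₁ (u i j ^ (b i : ℕ)) ≤ ∑ _i : ι, n * D * q ^ j := by
          refine Finset.sum_le_sum fun i _ => ?_
          rw [logHeight₁_pow, mul_assoc]
          have h1 : ((b i : ℕ) : ℝ) ≤ n := by exact_mod_cast Nat.lt_succ_iff.mp (b i).2
          exact mul_le_mul h1 (huD i j) (by positivity) (by positivity)
      _ = _ := by simp; ring
  · intro b
    have h1 := hrel b
    rw [← hx b] at h1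
    have h2 := congrArg (fun t => algebraMap (convergentSeriesOver k) Ω g * t) h1
    simp only [Finset.mul_sum, ← mul_assoc] at h2
    have h3 : ∀ m, algebraMap (convergentSeriesOver k) Ω g * algebraMap C Ω (c m b) =
        algebraMap (convergentSeriesOver k) Ω (H (m, b)) := by
      intro m
      rw [IsScalarTower.algebraMap_apply (convergentSeriesOver k) C Ω, ← map_mul,
        IsScalarTower.algebraMap_apply (convergentSeriesOver k) C Ω, hH (m, b), Algebra.smul_def]
    simp only [h3] at h2
    simp only [hR, ← hx] at h2
    simp only [← map_mul, ← map_sum] at h2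
    rw [← sub_eq_zero, ← map_sub, hπ] at h2
    filter_upwards [h2] with j hj
    simpa [sub_eq_zero, Finset.sum_apply] using hj
  · simpa using hcard
  · intro P hP
    rw [Ultrafilter.eventually_not]
    intro hev
    let Q : MvPolynomial ι k[X] := ∑ b : ι → Fin (n + 1),
      MvPolynomial.monomial (Finsupp.equivFunOnFinite.symm fun i => (b i : ℕ)) (P b)
    have hQ : Q = 0 := by
      refine (algebraicIndependent_iff.1 hu) Q ?_
      simp only [Q, map_sum, MvPolynomial.aeval_monomial, hX]
      have h4 : ∀ b : ι → Fin (n + 1),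
          ((Finsupp.equivFunOnFinite.symm fun i => (b i : ℕ)).prod fun i e =>
            (π fun j => algebraMap k ℂ (u i j)) ^ e) = π fun j => algebraMap k ℂ (x b j) := by
        intro b
        rw [hx, Finsupp.prod_fintype _ _ (by simp)]
        simp
      simp only [h4, ← map_mul, ← map_sum]
      rw [hπ]
      filter_upwards [hev] with j hj
      have := congrArg (algebraMap k ℂ) hj
      simpa [Finset.sum_apply] using this
    refine hP (funext fun b => ?_)
    have h5 := congrArg (MvPolynomial.coeff (Finsupp.equivFunOnFinite.symm fun i => (b i : ℕ))) hQ
    simp only [Q, MvPolynomial.coeff_sum, MvPolynomial.coeff_monomial, MvPolynomial.coeff_zero,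
      EmbeddingLike.apply_eq_iff_eq] at h5
    rw [Finset.sum_eq_single b] at h5
    · simpa using h5
    · intro b' _ hb'
      rw [if_neg]
      intro h
      exact hb' (funext fun i => Fin.ext (congrFun h i))
    · simp

end Freeness

section Germs

open Filter Topology Height

variable {k : Type*} [Field k] [Algebra k ℂ]

theorem Ultrafilter.coeRingHom_eq_zero_iff (U : Ultrafilter ℕ) (f : ℕ → ℂ) :
    Germ.coeRingHom (U : Filter ℕ) f = 0 ↔ ∀ᶠ j in (U : Filter ℕ), f j = 0 :=
  Germ.coe_eq

theorem tendsto_pow_pow_nhds_zero {q : ℕ} (hq : 2 ≤ q) {z : ℂ} (hz : ‖z‖ < 1) :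
    Tendsto (fun j : ℕ => z ^ q ^ j) atTop (𝓝 0) :=
  (tendsto_pow_atTop_nhds_zero_of_norm_lt_one hz).comp (tendsto_pow_atTop_atTop_of_one_lt hq)

/-- The germ of the values of a convergent series along the orbit `z ^ q ^ j`. -/
noncomputable def germEval {q : ℕ} (hq : 2 ≤ q) (U : Ultrafilter ℕ) (hU : (U : Filter ℕ) ≤ atTop)
    {z : ℂ} (hz : ‖z‖ < 1) : convergentSeriesOver k →+* Germ (U : Filter ℕ) ℂ where
  toFun G := Germ.coeRingHom (U : Filter ℕ) fun j => evalOver G.1 (z ^ q ^ j)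
  map_zero' := by
    rw [Ultrafilter.coeRingHom_eq_zero_iff]
    simp [evalOver, psEval]
  map_one' := by
    rw [← map_one (Germ.coeRingHom (U : Filter ℕ))]
    congr 1
    funext j
    have := psEval_polynomial 1 (z ^ q ^ j)
    simpa [evalOver] using this
  map_add' f g := by
    rw [← map_add, ← sub_eq_zero, ← map_sub, Ultrafilter.coeRingHom_eq_zero_iff]
    filter_upwards [((tendsto_pow_pow_nhds_zero hq hz).mono_left hU).eventually
      (eventually_evalOver_add f.2 g.2)] with j hj
    simpa [sub_eq_zero] using hj
  map_mul' f g := by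
    rw [← map_mul, ← sub_eq_zero, ← map_sub, Ultrafilter.coeRingHom_eq_zero_iff]
    filter_upwards [((tendsto_pow_pow_nhds_zero hq hz).mono_left hU).eventually
      (eventually_evalOver_mul f.2 g.2)] with j hj
    simpa [sub_eq_zero] using hj

theorem germEval_injective {q : ℕ} (hq : 2 ≤ q) (U : Ultrafilter ℕ) (hU : (U : Filter ℕ) ≤ atTop)
    {z : ℂ} (hz0 : z ≠ 0) (hz : ‖z‖ < 1) :
    Function.Injective (germEval (k := k) hq U hU hz) := by
  rw [injective_iff_map_eq_zero]
  intro G hG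
  by_contra hG0
  have hmap : PowerSeries.map (algebraMap k ℂ) G.1 ≠ 0 := by
    intro h
    refine hG0 (Subtype.ext (PowerSeries.map_injective _ (algebraMap k ℂ).injective ?_))
    simpa using h
  obtain ⟨c, hc, b, hb⟩ := exists_le_norm_psEval (f := PowerSeries.map (algebraMap k ℂ) G.1) G.2 hmap
  have h1 : ∀ᶠ j in (U : Filter ℕ), evalOver G.1 (z ^ q ^ j) = 0 :=
    (Ultrafilter.coeRingHom_eq_zero_iff U _).1 hG
  have h2 := ((tendsto_pow_pow_nhds_zero hq hz).mono_left hU).eventually hb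
  obtain ⟨j, hj1, hj2⟩ := (h1.and h2).exists
  rw [evalOver] at hj1
  rw [hj1, norm_zero] at hj2
  have : 0 < c * ‖z ^ q ^ j‖ ^ b := mul_pos hc (pow_pos (norm_pos_iff.2 (pow_ne_zero _ hz0)) _)
  linarith

variable (k) in
/-- Polynomials, as convergent series. -/
noncomputable def polynomialToConvergentSeriesOver : k[X] →+* convergentSeriesOver k :=
  (Polynomial.coeToPowerSeries.ringHom (R := k)).codRestrict _ polynomial_mem_convergentSeriesOver

theorem polynomialToConvergentSeriesOver_injective :
    Function.Injective (polynomialToConvergentSeriesOver k) := by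
  intro p p' h
  exact Polynomial.coe_injective k (congrArg Subtype.val h)

variable [NumberField k]

/-- A linear relation, with coefficients of moderate height, between the values of convergent series
along the orbit `α ^ q ^ j` lifts to a linear relation between the series with algebraic
coefficients. -/
theorem exists_isAlgebraic_relation_of_values {q : ℕ} (hq : 2 ≤ q) (U : Ultrafilter ℕ)
    (hU : (U : Filter ℕ) ≤ atTop) (α : k) (hα0 : α ≠ 0) (hα1 : ‖algebraMap k ℂ α‖ < 1)
    {ι : Type*} [Fintype ι] (u : ι → ℕ → k) (D : ℝ) (hD : 0 ≤ D)
    (huD : ∀ i j, logHeight₁ (u i j) ≤ D * q ^ j) (i₀ : ι)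
    (hi₀ : ∀ᶠ j in (U : Filter ℕ), u i₀ j = 1) (F : ι → convergentSeriesOver k)
    (hF : ∀ᶠ j in (U : Filter ℕ),
      ∑ i, algebraMap k ℂ (u i j) * evalOver (F i).1 (algebraMap k ℂ α ^ q ^ j) = 0)
    {L : Type*} [Field L] [Algebra (PowerSeries ℂ) L] [IsFractionRing (PowerSeries ℂ) L]
    [Algebra ℂ[X] L] [IsScalarTower ℂ[X] (PowerSeries ℂ) L] :
    ∃ v : ι → L, v ≠ 0 ∧ (∀ i, IsAlgebraic ℂ[X] (v i)) ∧
      ∑ i, v i * algebraMap (PowerSeries ℂ) L ((F i).1.map (algebraMap k ℂ)) = 0 := by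
  classical
  let R := convergentSeriesOver k
  let C := FractionRing R
  let Ω := Germ (U : Filter ℕ) ℂ
  let E := FractionRing k[X]
  have hφα0 : algebraMap k ℂ α ≠ 0 := by simpa using hα0
  let ev : R →+* Ω := germEval hq U hU hα1
  have hev : Function.Injective ev := germEval_injective hq U hU hφα0 hα1
  let _ : Algebra R Ω := ev.toAlgebra
  let _ : Algebra C Ω := (IsFractionRing.lift (K := C) hev).toAlgebra
  have _ : IsScalarTower R C Ω := IsScalarTower.of_algebraMap_eq fun x =>
    (IsFractionRing.lift_algebraMap hev x).symm
  let _ : Algebra k[X] R := (polynomialToConvergentSeriesOver k).toAlgebra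
  have hXC : Function.Injective (algebraMap k[X] C) := by
    rw [IsScalarTower.algebraMap_eq k[X] R C]
    exact (IsFractionRing.injective R C).comp polynomialToConvergentSeriesOver_injective
  let _ : Algebra E C := (IsFractionRing.lift (K := E) hXC).toAlgebra
  have _ : IsScalarTower k[X] E C := IsScalarTower.of_algebraMap_eq fun x =>
    (IsFractionRing.lift_algebraMap hXC x).symm
  let _ : Algebra E Ω := ((algebraMap C Ω).comp (algebraMap E C)).toAlgebra
  have _ : IsScalarTower E C Ω := IsScalarTower.of_algebraMap_eq fun _ => rfl
  let _ : Algebra k[X] Ω := ((algebraMap E Ω).comp (algebraMap k[X] E)).toAlgebra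
  have _ : IsScalarTower k[X] E Ω := IsScalarTower.of_algebraMap_eq fun _ => rfl
  have _ : CharZero E := charZero_of_injective_ringHom
    (f := (algebraMap k[X] E).comp Polynomial.C)
    ((IsFractionRing.injective k[X] E).comp Polynomial.C_injective)
  have _ : CharZero C := charZero_of_injective_algebraMap (algebraMap E C).injective
  have _ : CharZero Ω := charZero_of_injective_algebraMap (algebraMap C Ω).injective
  have hR : ∀ G : R, algebraMap R Ω G =
      Germ.coeRingHom (U : Filter ℕ) fun j => evalOver G.1 (algebraMap k ℂ α ^ q ^ j) := fun _ => rfl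
  have hX : ∀ p : k[X], algebraMap k[X] Ω p =
      Germ.coeRingHom (U : Filter ℕ) fun j => algebraMap k ℂ (p.eval (α ^ q ^ j)) := by
    intro p
    have : algebraMap k[X] Ω p = algebraMap R Ω (algebraMap k[X] R p) := by
      rw [IsScalarTower.algebraMap_apply k[X] E Ω, IsScalarTower.algebraMap_apply E C Ω,
        ← IsScalarTower.algebraMap_apply k[X] E C, IsScalarTower.algebraMap_apply k[X] R C,
        ← IsScalarTower.algebraMap_apply R C Ω]
    rw [this, hR]
    congr 1
    funext j
    rw [← evalOver_polynomial, map_pow]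
    rfl
  let w : ι → Ω := fun i => Germ.coeRingHom (U : Filter ℕ) fun j => algebraMap k ℂ (u i j)
  have hfree : ∀ s : Set ι, AlgebraicIndepOn E w s → AlgebraicIndepOn C w s := by
    intro s hs
    have hs' : AlgebraicIndependent k[X] fun i : s => w i :=
      (AlgebraicIndependent.restrictScalars (IsFractionRing.injective k[X] E) hs)
    exact AlgebraicIndependent.extend_convergentSeriesOver hq U hU α hα0 hα1
      (Germ.coeRingHom (U : Filter ℕ)) (Ultrafilter.coeRingHom_eq_zero_iff U) hR hX
      (fun i : s => u i) D hD (fun i => huD i) hs'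
  have hw0 : w ≠ 0 := by
    intro h
    have h1 := congrFun h i₀
    rw [Pi.zero_apply] at h1
    have h2 := (Ultrafilter.coeRingHom_eq_zero_iff U _).1 h1
    obtain ⟨j, hj1, hj2⟩ := (hi₀.and h2).exists
    simp [hj1] at hj2
  have hsum : ∑ i, w i * algebraMap C Ω (algebraMap R C (F i)) = 0 := by
    simp only [← IsScalarTower.algebraMap_apply R C Ω, hR, w, ← map_mul, ← map_sum]
    rw [Ultrafilter.coeRingHom_eq_zero_iff]
    filter_upwards [hF] with j hj
    simpa [Finset.sum_apply] using hj
  obtain ⟨v, hv0, hvalg, hv⟩ := exists_algebraic_relation_of_free w hfree hw0 _ hsum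
  let μ : R →+* L := (algebraMap (PowerSeries ℂ) L).comp
    ((PowerSeries.map (algebraMap k ℂ)).comp R.subtype)
  have hμ : Function.Injective μ :=
    (IsFractionRing.injective (PowerSeries ℂ) L).comp
      ((PowerSeries.map_injective _ (algebraMap k ℂ).injective).comp Subtype.val_injective)
  let ν : C →+* L := IsFractionRing.lift hμ
  have hν : ∀ x : R, ν (algebraMap R C x) = μ x := IsFractionRing.lift_algebraMap hμ
  refine ⟨fun i => ν (v i), ?_, fun i => ?_, ?_⟩
  · intro h
    exact hv0 (funext fun i => ν.injective (by simpa using congrFun h i))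
  · refine ((IsFractionRing.isAlgebraic_iff k[X] E C).2 (hvalg i)).ringHom_of_comp_eq
      (Polynomial.mapRingHom (algebraMap k ℂ)) ν
      (Polynomial.map_injective _ (algebraMap k ℂ).injective) ?_
    refine RingHom.ext fun p => ?_
    have h1 : algebraMap k[X] C p = algebraMap R C (polynomialToConvergentSeriesOver k p) := rfl
    have h2 : (ν : C →+* L) (algebraMap k[X] C p) = μ (polynomialToConvergentSeriesOver k p) := by
      rw [h1, hν]
    change algebraMap ℂ[X] L (p.map (algebraMap k ℂ)) = ν (algebraMap k[X] C p)
    rw [h2, IsScalarTower.algebraMap_apply ℂ[X] (PowerSeries ℂ) L]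
    change _ = algebraMap (PowerSeries ℂ) L (PowerSeries.map (algebraMap k ℂ) (p : PowerSeries k))
    rw [PowerSeries.algebraMap_polynomial, Polynomial.polynomial_map_coe]
  · have := congrArg ν hv
    simpa [map_sum, hν, μ] using this

end Germs

section Saturation

/-- The saturation of a submodule: the elements some nonzero multiple of which lies in it. -/
def Submodule.saturation {R M : Type*} [CommRing R] [IsDomain R] [AddCommGroup M] [Module R M]
    (N : Submodule R M) : Submodule R M where
  carrier := {x | ∃ d : R, d ≠ 0 ∧ d • x ∈ N}
  zero_mem' := ⟨1, one_ne_zero, by simp⟩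
  add_mem' := by
    rintro x y ⟨d, hd, hx⟩ ⟨e, he, hy⟩
    refine ⟨d * e, mul_ne_zero hd he, ?_⟩
    rw [smul_add]
    refine N.add_mem ?_ ?_
    · rw [mul_comm, mul_smul]
      exact N.smul_mem _ hx
    · rw [mul_smul]
      exact N.smul_mem _ hy
  smul_mem' := by
    rintro c x ⟨d, hd, hx⟩
    exact ⟨d, hd, by rw [smul_comm]; exact N.smul_mem _ hx⟩

variable {R M : Type*} [CommRing R] [IsDomain R] [AddCommGroup M] [Module R M]
  {N : Submodule R M}

theorem Submodule.le_saturation : N ≤ N.saturation := fun x hx => ⟨1, one_ne_zero, by simpa⟩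

theorem Submodule.mem_saturation_of_smul_mem {d : R} (hd : d ≠ 0) {x : M}
    (h : d • x ∈ N.saturation) : x ∈ N.saturation := by
  obtain ⟨e, he, hx⟩ := h
  exact ⟨e * d, mul_ne_zero he hd, by rwa [mul_smul]⟩

end Saturation

section MahlerSystem

variable {k : Type*} [Field k] {q : ℕ} (hq : q ≠ 0)

theorem PowerSeries.polynomial_smul_def (p : k[X]) (f : PowerSeries k) :
    p • f = (p : PowerSeries k) * f := by
  rw [Algebra.smul_def, PowerSeries.algebraMap_polynomial]

theorem PowerSeries.expand_polynomial (p : k[X]) :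
    PowerSeries.expand q hq (p : PowerSeries k) = (Polynomial.expand k q p : k[X]) := by
  ext n
  rw [PowerSeries.coeff_expand, Polynomial.coeff_coe, Polynomial.coeff_coe,
    Polynomial.coeff_expand (Nat.pos_of_ne_zero hq)]

theorem PowerSeries.rescale_expand (ζ : k) (f : PowerSeries k) :
    PowerSeries.rescale ζ (PowerSeries.expand q hq f) =
      PowerSeries.expand q hq (PowerSeries.rescale (ζ ^ q) f) := by
  ext n
  rw [PowerSeries.coeff_rescale, PowerSeries.coeff_expand, PowerSeries.coeff_expand]
  split_ifs with h
  · obtain ⟨m, rfl⟩ := h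
    rw [Nat.mul_div_cancel_left _ (Nat.pos_of_ne_zero hq), PowerSeries.coeff_rescale, pow_mul]
  · simp

variable {ι : Type*} [Fintype ι] {F : ι → PowerSeries k} {b : k[X]} {B : Matrix ι ι k[X]}

theorem expand_mem_saturation
    (hF : ∀ i, PowerSeries.expand q hq (F i) ∈ (Submodule.span k[X] (Set.range F)).saturation)
    {g : PowerSeries k} (hg : g ∈ (Submodule.span k[X] (Set.range F)).saturation) :
    PowerSeries.expand q hq g ∈ (Submodule.span k[X] (Set.range F)).saturation := by
  obtain ⟨d, hd, hg⟩ := hg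
  refine Submodule.mem_saturation_of_smul_mem (d := Polynomial.expand k q d)
    ((Polynomial.expand_ne_zero (Nat.pos_of_ne_zero hq)).2 hd) ?_
  rw [PowerSeries.polynomial_smul_def, ← PowerSeries.expand_polynomial hq, ← map_mul,
    ← PowerSeries.polynomial_smul_def]
  obtain ⟨c, hc⟩ := (Submodule.mem_span_range_iff_exists_fun _).1 hg
  rw [← hc, map_sum]
  refine Submodule.sum_mem _ fun i _ => ?_
  rw [PowerSeries.polynomial_smul_def, map_mul, PowerSeries.expand_polynomial hq,
    ← PowerSeries.polynomial_smul_def]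
  exact Submodule.smul_mem _ _ (hF i)

variable [DecidableEq ι]

theorem expand_mem_saturation_of_system
    (hrel : ∀ i, b • F i = ∑ j, B i j • PowerSeries.expand q hq (F j)) (hB : B.det ≠ 0) (i : ι) :
    PowerSeries.expand q hq (F i) ∈ (Submodule.span k[X] (Set.range F)).saturation := by
  refine ⟨B.det, hB, ?_⟩
  have h : B.det • PowerSeries.expand q hq (F i) = ∑ l, (B.adjugate i l * b) • F l := by
    simp only [mul_smul, hrel, Finset.smul_sum]
    rw [Finset.sum_comm]
    simp only [← mul_smul, ← Finset.sum_smul]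
    have h2 : ∀ j, ∑ l, B.adjugate i l * B l j = (B.det • (1 : Matrix ι ι k[X])) i j := by
      intro j
      rw [← Matrix.adjugate_mul, Matrix.mul_apply]
    simp only [h2, Matrix.smul_apply, Matrix.one_apply, smul_eq_mul, mul_ite, mul_one, mul_zero,
      ite_smul, zero_smul, Finset.sum_ite_eq, Finset.mem_univ, if_true]
  rw [h]
  exact Submodule.sum_mem _ fun l _ =>
    Submodule.smul_mem _ _ (Submodule.subset_span (Set.mem_range_self l))

/-- The space spanned by the solutions of a Mahler system is stable under the rotations by roots
of unity of order a power of `q`. -/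
theorem rescale_mem_saturation
    (hrel : ∀ i, b • F i = ∑ j, B i j • PowerSeries.expand q hq (F j)) (hb : b ≠ 0)
    (hB : B.det ≠ 0) (n : ℕ) (ζ : k) (hζ : ζ ^ q ^ n = 1) (i : ι) :
    PowerSeries.rescale ζ (F i) ∈ (Submodule.span k[X] (Set.range F)).saturation := by
  induction n generalizing ζ i with
  | zero =>
    have : ζ = 1 := by simpa using hζ
    subst this
    rw [PowerSeries.rescale_one]
    exact Submodule.le_saturation (Submodule.subset_span (Set.mem_range_self i))
  | succ n ih =>
    have hζ0 : ζ ≠ 0 := by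
      rintro rfl
      rw [zero_pow (pow_ne_zero _ hq)] at hζ
      exact zero_ne_one hζ
    have hb' : b.comp (C ζ * X) ≠ 0 := by
      intro h
      have h1 : PowerSeries.rescale ζ⁻¹ (PowerSeries.rescale ζ (b : PowerSeries k)) = 0 := by
        rw [← Polynomial.coe_comp_C_mul_X, h]
        simp
      rw [PowerSeries.rescale_rescale, mul_inv_cancel₀ hζ0, PowerSeries.rescale_one] at h1
      exact hb (Polynomial.coe_injective k (by simpa using h1))
    refine Submodule.mem_saturation_of_smul_mem hb' ?_
    have h2 := congrArg (PowerSeries.rescale ζ) (hrel i)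
    simp only [PowerSeries.polynomial_smul_def, map_mul, map_sum, ← Polynomial.coe_comp_C_mul_X,
      PowerSeries.rescale_expand] at h2
    rw [PowerSeries.polynomial_smul_def, h2]
    refine Submodule.sum_mem _ fun j _ => ?_
    rw [← PowerSeries.polynomial_smul_def]
    refine Submodule.smul_mem _ _ (expand_mem_saturation hq
      (expand_mem_saturation_of_system hq hrel hB) (ih (ζ ^ q) ?_ j))
    rw [← pow_mul, ← pow_succ', hζ]

end MahlerSystem

section MahlerDisjoint

theorem infinite_roots_of_unity_pow {q : ℕ} (hq : 2 ≤ q) :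
    {ζ : ℂˣ | ∃ n : ℕ, (ζ : ℂ) ^ q ^ n = 1}.Infinite := by
  have hprim (n : ℕ) := Complex.isPrimitiveRoot_exp (q ^ n) (by positivity)
  refine Set.infinite_of_injective_forall_mem
    (f := fun n : ℕ => ((hprim n).isUnit (by positivity)).unit) ?_ ?_
  · intro m n h
    have h' : Complex.exp (2 * Real.pi * Complex.I / (q ^ m : ℕ)) =
        Complex.exp (2 * Real.pi * Complex.I / (q ^ n : ℕ)) := congrArg Units.val h
    have := (hprim m).eq_orderOf
    rw [h', ← (hprim n).eq_orderOf] at this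
    exact Nat.pow_right_injective hq this
  · intro n
    exact ⟨n, (hprim n).pow_eq_one⟩

/-- The solutions of a Mahler system satisfy no linear relation with algebraic coefficients unless
they satisfy one with rational coefficients. -/
theorem eq_zero_of_isAlgebraic_of_mahler {q : ℕ} (hq : 2 ≤ q) (hq0 : q ≠ 0) {ι : Type*} [Fintype ι]
    [DecidableEq ι] {F : ι → PowerSeries ℂ} {b : ℂ[X]} {B : Matrix ι ι ℂ[X]}
    (hrel : ∀ i, b • F i = ∑ j, B i j • PowerSeries.expand q hq0 (F j)) (hb : b ≠ 0)
    (hB : B.det ≠ 0) (hind : LinearIndependent ℂ[X] F)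
    {L : Type*} [Field L] [Algebra (PowerSeries ℂ) L] [IsFractionRing (PowerSeries ℂ) L]
    [Algebra ℂ[X] L] [IsScalarTower ℂ[X] (PowerSeries ℂ) L] [Algebra (RatFunc ℂ) L]
    [IsScalarTower ℂ[X] (RatFunc ℂ) L]
    (v : ι → L) (hv : ∀ i, IsAlgebraic ℂ[X] (v i))
    (h : ∑ i, v i * algebraMap (PowerSeries ℂ) L (F i) = 0) : v = 0 := by
  refine eq_zero_of_isAlgebraic_of_sum_mul_eq_zero
    (fun i => algebraMap (PowerSeries ℂ) L (F i)) ?_ _ (infinite_roots_of_unity_pow hq) ?_ v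
    (fun i => (IsFractionRing.isAlgebraic_iff ℂ[X] (RatFunc ℂ) L).1 (hv i)) h
  · rw [← LinearIndependent.iff_fractionRing ℂ[X] (RatFunc ℂ)]
    exact hind.map' (IsScalarTower.toAlgHom ℂ[X] (PowerSeries ℂ) L).toLinearMap
      (LinearMap.ker_eq_bot.2 (IsFractionRing.injective (PowerSeries ℂ) L))
  · rintro ζ ⟨n, hn⟩ j
    obtain ⟨d, hd, hmem⟩ := rescale_mem_saturation hq0 hrel hb hB n ζ hn j
    obtain ⟨c, hc⟩ := (Submodule.mem_span_range_iff_exists_fun _).1 hmem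
    refine ⟨fun i => algebraMap ℂ[X] (RatFunc ℂ) (c i) / algebraMap ℂ[X] (RatFunc ℂ) d, ?_⟩
    have hd' : algebraMap ℂ[X] L d ≠ 0 := by
      rw [IsScalarTower.algebraMap_apply ℂ[X] (RatFunc ℂ) L]
      simpa using hd
    have h2 := congrArg (algebraMap (PowerSeries ℂ) L) hc
    simp only [Algebra.smul_def, map_sum, map_mul, ← IsScalarTower.algebraMap_apply] at h2
    rw [rotate_algebraMap]
    simp only [map_div₀, ← IsScalarTower.algebraMap_apply, div_mul_eq_mul_div, ← Finset.sum_div]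
    rw [h2, mul_div_cancel_left₀ _ hd']

end MahlerDisjoint

section Orbit

open Filter Topology Height

theorem summable_coeff_expand_iff {q : ℕ} (hq : q ≠ 0) (f : PowerSeries ℂ) (z : ℂ) :
    Summable (fun n => PowerSeries.coeff n (PowerSeries.expand q hq f) * z ^ n) ↔
      Summable (fun n => PowerSeries.coeff n f * (z ^ q) ^ n) := by
  rw [← (mul_right_injective₀ hq).summable_iff]
  · refine summable_congr fun n => ?_
    simp [pow_mul]
  · intro n hn
    rw [PowerSeries.coeff_expand_of_not_dvd, zero_mul]
    rintro ⟨m, rfl⟩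
    exact hn ⟨m, rfl⟩

theorem psEval_expand {q : ℕ} (hq : q ≠ 0) (f : PowerSeries ℂ) (z : ℂ) :
    psEval (PowerSeries.expand q hq f) z = psEval f (z ^ q) := by
  rw [psEval, ← (mul_right_injective₀ hq).tsum_eq]
  · refine tsum_congr fun n => ?_
    simp [pow_mul]
  · intro n hn
    by_contra hn'
    refine hn ?_
    change PowerSeries.coeff n (PowerSeries.expand q hq f) * z ^ n = 0
    rw [PowerSeries.coeff_expand_of_not_dvd, zero_mul]
    rintro ⟨m, rfl⟩
    exact hn' ⟨m, rfl⟩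

theorem psEval_sum_smul {ι : Type*} (s : Finset ι) (p : ι → ℂ[X]) (F : ι → PowerSeries ℂ) (z : ℂ)
    (hF : ∀ i ∈ s, Summable fun n => PowerSeries.coeff n (F i) * z ^ n) :
    Summable (fun n => PowerSeries.coeff n (∑ i ∈ s, p i • F i) * z ^ n) ∧
    psEval (∑ i ∈ s, p i • F i) z = ∑ i ∈ s, (p i).eval z * psEval (F i) z := by
  classical
  induction s using Finset.induction_on with
  | empty => simp [psEval]
  | insert a s ha ih =>
    simp only [Finset.mem_insert, forall_eq_or_imp] at hF
    obtain ⟨h1, h2⟩ := ih hF.2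
    have hp := (hasSum_coeff_polynomial (p a) z).summable
    have h3 : Summable (fun n => PowerSeries.coeff n (p a • F a) * z ^ n) := by
      rw [PowerSeries.polynomial_smul_def]
      exact summable_coeff_mul hp hF.1
    rw [Finset.sum_insert ha, Finset.sum_insert ha]
    refine ⟨?_, ?_⟩
    · simpa [add_mul] using h3.add h1
    · rw [psEval_add h3 h1, h2, PowerSeries.polynomial_smul_def, psEval_mul hp hF.1,
        psEval_polynomial]

variable {k : Type*} [Field k] {ι : Type*} [Fintype ι]

/-- The coefficients of a linear relation transported along the orbit `α ^ q ^ j`. -/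
def transport (q : ℕ) (B : Matrix ι ι k[X]) (α : k) (τ : ι → k) : ℕ → ι → k
  | 0 => τ
  | j + 1 => fun l => ∑ i, (B i l).eval (α ^ q ^ j) * transport q B α τ j i

theorem transport_ne_zero [DecidableEq ι] (q : ℕ) (B : Matrix ι ι k[X]) (α : k) {τ : ι → k}
    (hτ : τ ≠ 0) (hB : ∀ j : ℕ, B.det.eval (α ^ q ^ j) ≠ 0) (j : ℕ) : transport q B α τ j ≠ 0 := by
  induction j with
  | zero => exact hτ
  | succ j ih =>
    intro h
    refine ih (Matrix.eq_zero_of_vecMul_eq_zero (M := B.map (eval (α ^ q ^ j))) ?_ ?_)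
    · have := hB j
      rwa [← coe_evalRingHom, RingHom.map_det] at this
    · rw [← h]
      funext l
      simp [transport, Matrix.vecMul, dotProduct, mul_comm]

theorem exists_logHeight_transport_le [NumberField k] {q : ℕ} (hq : 2 ≤ q) (B : Matrix ι ι k[X]) (α : k)
    (τ : ι → k) : ∃ D : ℝ, 0 ≤ D ∧ ∀ j, logHeight (transport q B α τ j) ≤ D * q ^ j := by
  choose C hC using fun il : ι × ι => exists_logHeight₁_eval_le (B il.2 il.1)
  set c₀ : ℝ := totalWeight k * Real.log (Nat.card ι) + ∑ il, |C il| with hc₀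
  set c₁ : ℝ := ∑ il : ι × ι, ((B il.2 il.1).natDegree : ℝ) * logHeight₁ α with hc₁
  have hc₀' : 0 ≤ c₀ := by positivity
  have hc₁' : 0 ≤ c₁ := Finset.sum_nonneg fun _ _ => mul_nonneg (by positivity) (zero_le_logHeight₁ _)
  have hstep : ∀ j, logHeight (transport q B α τ (j + 1)) ≤
      c₀ + c₁ * q ^ j + logHeight (transport q B α τ j) := by
    intro j
    have h1 := logHeight_linearMap_apply_le
      (fun il : ι × ι => (B il.2 il.1).eval (α ^ q ^ j)) (transport q B α τ j)
    have h2 : logHeight (fun il : ι × ι => (B il.2 il.1).eval (α ^ q ^ j)) ≤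
        ∑ il, |C il| + c₁ * q ^ j := by
      refine (logHeight_le_sum_logHeight₁ _).trans ?_
      rw [hc₁, Finset.sum_mul, ← Finset.sum_add_distrib]
      refine Finset.sum_le_sum fun il _ => (hC il _).trans ?_
      rw [logHeight₁_pow]
      push_cast
      have := le_abs_self (C il)
      linarith
    simp only [transport]
    linarith
  refine ⟨logHeight τ + c₀ + c₁, by have := logHeight_nonneg τ; positivity, fun j => ?_⟩
  induction j with
  | zero =>
    simp only [transport, pow_zero]
    linarith
  | succ j ih =>
    have hτ := logHeight_nonneg τ
    have hq1 : (1 : ℝ) ≤ (q : ℝ) ^ j := one_le_pow₀ (by exact_mod_cast (by omega : 1 ≤ q))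
    have hq2 : (2 : ℝ) ≤ q := by exact_mod_cast hq
    have h3 : c₀ ≤ c₀ * q ^ j := le_mul_of_one_le_right hc₀' hq1
    have h4 : (logHeight τ + c₀ + c₁) * (2 * q ^ j) ≤ (logHeight τ + c₀ + c₁) * (q ^ (j + 1)) := by
      rw [pow_succ, mul_comm ((q : ℝ) ^ j)]
      gcongr
    have h5 : 0 ≤ logHeight τ * (q : ℝ) ^ j := by positivity
    nlinarith [hstep j]

variable [Algebra k ℂ]

theorem sum_transport_mul_evalOver_eq_zero {q : ℕ} (hq : q ≠ 0) {F : ι → PowerSeries k} {b : k[X]}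
    {B : Matrix ι ι k[X]} (hrel : ∀ i, b • F i = ∑ j, B i j • PowerSeries.expand q hq (F j))
    {ε : ℝ} (hε : ε ≤ 1) (hF : ∀ i, AnOnBall ((F i).map (algebraMap k ℂ)) ε) {α : k}
    (hα : ‖algebraMap k ℂ α‖ < ε) {τ : ι → k}
    (h : ∑ i, algebraMap k ℂ (τ i) * evalOver (F i) (algebraMap k ℂ α) = 0) (j : ℕ) :
    ∑ i, algebraMap k ℂ (transport q B α τ j i) *
      evalOver (F i) (algebraMap k ℂ α ^ q ^ j) = 0 := by
  induction j with
  | zero => simpa [transport] using h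
  | succ j ih =>
    set z : ℂ := algebraMap k ℂ α ^ q ^ j with hz
    have hznorm : ‖z‖ < ε := by
      rw [hz, norm_pow]
      exact (pow_le_of_le_one (norm_nonneg _) (hα.le.trans hε) (pow_ne_zero _ hq)).trans_lt hα
    have hzq : ‖z ^ q‖ < ε := by
      rw [norm_pow]
      exact (pow_le_of_le_one (norm_nonneg _) (hznorm.le.trans hε) hq).trans_lt hznorm
    have hrel' : ∀ i, (b.eval (α ^ q ^ j) : k) • evalOver (F i) z =
        ∑ l, ((B i l).eval (α ^ q ^ j) : k) • evalOver (F l) (z ^ q) := by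
      intro i
      have h1 := congrArg (PowerSeries.map (algebraMap k ℂ)) (hrel i)
      simp only [PowerSeries.polynomial_smul_def, map_mul, map_sum, PowerSeries.map_expand,
        ← Polynomial.polynomial_map_coe] at h1
      simp only [← PowerSeries.polynomial_smul_def] at h1
      have h2 := congrArg (fun f => psEval f z) h1
      beta_reduce at h2
      rw [(psEval_sum_smul _ _ _ z fun l _ =>
        (summable_coeff_expand_iff hq _ z).2 (hF l _ hzq)).2] at h2
      have h3 := (psEval_sum_smul {i} (fun _ => b.map (algebraMap k ℂ))
        (fun l => (F l).map (algebraMap k ℂ)) z fun l _ => hF l _ hznorm).2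
      simp only [Finset.sum_singleton] at h3
      rw [h3] at h2
      simp only [psEval_expand] at h2
      simp only [Algebra.smul_def, evalOver]
      convert h2 using 2
      · rw [hz, ← map_pow, eval_map_algebraMap, aeval_algebraMap_apply, coe_aeval_eq_eval]
      · rw [hz, ← map_pow, eval_map_algebraMap, aeval_algebraMap_apply, coe_aeval_eq_eval]
    have h4 := congrArg (fun t => algebraMap k ℂ (b.eval (α ^ q ^ j)) * t) ih
    simp only [Finset.mul_sum, mul_zero] at h4
    rw [← h4]
    have h5 : algebraMap k ℂ α ^ q ^ (j + 1) = z ^ q := by rw [hz, ← pow_mul, pow_succ]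
    rw [h5]
    have h6 : ∀ i, algebraMap k ℂ (b.eval (α ^ q ^ j)) *
        (algebraMap k ℂ (transport q B α τ j i) * evalOver (F i) z) =
        ∑ l, algebraMap k ℂ (transport q B α τ j i) *
          (algebraMap k ℂ ((B i l).eval (α ^ q ^ j)) * evalOver (F l) (z ^ q)) := by
      intro i
      have := hrel' i
      simp only [Algebra.smul_def] at this
      rw [← Finset.mul_sum, ← this]
      ring
    rw [Finset.sum_congr rfl fun i _ => h6 i, Finset.sum_comm]
    refine Finset.sum_congr rfl fun l _ => ?_
    simp only [transport, map_sum, map_mul, Finset.sum_mul]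
    exact Finset.sum_congr rfl fun i _ => by ring

end Orbit

section Values

open Filter Topology Height

/-- At a regular algebraic point, the values of linearly independent solutions of a Mahler system
are linearly independent over the algebraic numbers. -/
theorem sum_mul_evalOver_ne_zero {k : Type*} [Field k] [NumberField k] [Algebra k ℂ] {ι : Type*}
    [Fintype ι] [DecidableEq ι] {q : ℕ} (hq : 2 ≤ q) (hq0 : q ≠ 0) {F : ι → PowerSeries k} {b : k[X]}
    {B : Matrix ι ι k[X]} (hb : b ≠ 0)
    (hrel : ∀ i, b • F i = ∑ j, B i j • PowerSeries.expand q hq0 (F j))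
    (hind : LinearIndependent ℂ[X] fun i => (F i).map (algebraMap k ℂ))
    {ε : ℝ} (hε : ε ≤ 1) (hF : ∀ i, AnOnBall ((F i).map (algebraMap k ℂ)) ε)
    (hdet : ∀ z : k, z ≠ 0 → ‖algebraMap k ℂ z‖ < ε → B.det.eval z ≠ 0) {α : k} (hα0 : α ≠ 0)
    (hα : ‖algebraMap k ℂ α‖ < ε) {τ : ι → k} (hτ : τ ≠ 0) :
    ∑ i, algebraMap k ℂ (τ i) * evalOver (F i) (algebraMap k ℂ α) ≠ 0 := by
  intro h
  have hε0 : 0 < ε := (norm_nonneg _).trans_lt hα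
  let U : Ultrafilter ℕ := hyperfilter ℕ
  have hU : (U : Filter ℕ) ≤ atTop := by
    rw [← Nat.cofinite_eq_atTop]
    exact hyperfilter_le_cofinite
  let y := transport q B α τ
  have hy : ∀ j, y j ≠ 0 := transport_ne_zero q B α hτ fun j => by
    refine hdet _ (pow_ne_zero _ hα0) ?_
    rw [map_pow, norm_pow]
    exact (pow_le_of_le_one (norm_nonneg _) (hα.le.trans hε) (pow_ne_zero _ hq0)).trans_lt hα
  obtain ⟨i₀, hi₀⟩ : ∃ i₀, ∀ᶠ j in (U : Filter ℕ), y j i₀ ≠ 0 := by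
    rw [← Ultrafilter.eventually_exists_iff]
    exact .of_forall fun j => Function.ne_iff.1 (hy j)
  obtain ⟨D, hD, hyD⟩ := exists_logHeight_transport_le hq B α τ
  have hmem : ∀ i, F i ∈ convergentSeriesOver k := fun i => ⟨ε, hε0, hF i⟩
  let L := FractionRing (PowerSeries ℂ)
  have hXL : Function.Injective (algebraMap ℂ[X] L) := by
    rw [IsScalarTower.algebraMap_eq ℂ[X] (PowerSeries ℂ) L]
    refine (IsFractionRing.injective (PowerSeries ℂ) L).comp fun p p' hp => ?_
    replace hp : algebraMap ℂ[X] (PowerSeries ℂ) p = algebraMap ℂ[X] (PowerSeries ℂ) p' := hp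
    rw [PowerSeries.algebraMap_polynomial, PowerSeries.algebraMap_polynomial] at hp
    exact Polynomial.coe_injective ℂ hp
  let _ : Algebra (RatFunc ℂ) L := (IsFractionRing.lift (K := RatFunc ℂ) hXL).toAlgebra
  have _ : IsScalarTower ℂ[X] (RatFunc ℂ) L := IsScalarTower.of_algebraMap_eq fun x =>
    (IsFractionRing.lift_algebraMap hXL x).symm
  obtain ⟨v, hv0, hvalg, hv⟩ := exists_isAlgebraic_relation_of_values hq U hU α hα0
    (hα.trans_le hε) (fun i j => y j i / y j i₀) D hD
    (fun i j => (logHeight₁_div_le_logHeight (y j) i i₀).trans (hyD j)) i₀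
    (by filter_upwards [hi₀] with j hj using div_self hj) (fun i => ⟨F i, hmem i⟩)
    (.of_forall fun j => by
      have := sum_transport_mul_evalOver_eq_zero hq0 hrel hε hF hα h j
      simp only [map_div₀, div_mul_eq_mul_div, ← Finset.sum_div]
      rw [this, zero_div]) (L := L)
  refine hv0 (eq_zero_of_isAlgebraic_of_mahler hq hq0
    (F := fun i => (F i).map (algebraMap k ℂ)) (b := b.map (algebraMap k ℂ))
    (B := B.map (Polynomial.map (algebraMap k ℂ))) ?_ ?_ ?_ hind v hvalg hv)
  · intro i
    have h1 := congrArg (PowerSeries.map (algebraMap k ℂ)) (hrel i)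
    simp only [PowerSeries.polynomial_smul_def, map_mul, map_sum, PowerSeries.map_expand,
      ← Polynomial.polynomial_map_coe] at h1
    simpa only [← PowerSeries.polynomial_smul_def, Matrix.map_apply] using h1
  · rwa [Polynomial.map_ne_zero_iff (algebraMap k ℂ).injective]
  · have h2 : B.det ≠ 0 := fun h0 => hdet α hα0 hα (by rw [h0, eval_zero])
    have h3 := (RingHom.map_det (Polynomial.mapRingHom (algebraMap k ℂ)) B)
    rw [RingHom.mapMatrix_apply, coe_mapRingHom] at h3
    rw [← h3]
    rwa [Polynomial.map_ne_zero_iff (algebraMap k ℂ).injective]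

end Values

section Descent

theorem Polynomial.exists_coeff_eq_apply {A B : Type*} [Semiring A] [Semiring B] (u : A →+ B)
    (p : A[X]) : ∃ p' : B[X], ∀ n, p'.coeff n = u (p.coeff n) := by
  refine ⟨∑ n ∈ p.support, monomial n (u (p.coeff n)), fun n => ?_⟩
  rw [finsetSum_coeff]
  simp only [coeff_monomial, Finset.sum_ite_eq', mem_support_iff]
  split_ifs with h
  · rfl
  · rw [notMem_support_iff.1 h, map_zero]

/-- Linear independence over polynomials is preserved by extension of the field of coefficients. -/
theorem LinearIndependent.powerSeries_map {k K ι : Type*} [Field k] [Field K] [Algebra k K]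
    {F : ι → PowerSeries k} (hF : LinearIndependent k[X] F) :
    LinearIndependent K[X] fun i => (F i).map (algebraMap k K) := by
  rw [linearIndependent_iff'] at hF ⊢
  intro s p hp i hi
  ext n
  rw [coeff_zero, ← Module.forall_dual_apply_eq_zero_iff k]
  intro u
  choose p' hp' using fun i => Polynomial.exists_coeff_eq_apply u.toAddMonoidHom (p i)
  have h : ∑ i ∈ s, p' i • F i = 0 := by
    ext N
    have h1 := congrArg (fun g => u (PowerSeries.coeff N g)) hp
    simp only [map_sum, PowerSeries.polynomial_smul_def, PowerSeries.coeff_mul, map_zero,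
      PowerSeries.coeff_map, Polynomial.coeff_coe] at h1 ⊢
    rw [← h1]
    refine Finset.sum_congr rfl fun i _ => Finset.sum_congr rfl fun ab _ => ?_
    rw [hp', mul_comm ((p i).coeff ab.1), ← Algebra.smul_def, map_smul, smul_eq_mul, mul_comm]
    rfl
  have := hF s p' h i hi
  have h2 := hp' i n
  rw [this, coeff_zero] at h2
  exact h2.symm

end Descent

section Expand

variable {k : Type*} [Field k] {q : ℕ} (hq : q ≠ 0)

/-- The operator extracting the coefficients of index congruent to `r` modulo `q`. -/
noncomputable def PowerSeries.coeffSection (q r : ℕ) : PowerSeries k →ₗ[k] PowerSeries k where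
  toFun f := PowerSeries.mk fun n => PowerSeries.coeff (q * n + r) f
  map_add' f g := by ext; simp
  map_smul' c f := by ext; simp

theorem PowerSeries.coeffSection_mul_expand {r : ℕ} (hr : r < q) (f g : PowerSeries k) :
    PowerSeries.coeffSection q r (f * PowerSeries.expand q hq g) = PowerSeries.coeffSection q r f * g := by
  ext n
  simp only [PowerSeries.coeffSection, LinearMap.coe_mk, AddHom.coe_mk, PowerSeries.coeff_mk,
    PowerSeries.coeff_mul]
  symm
  refine Finset.sum_of_injOn (fun ab => (q * ab.1 + r, q * ab.2)) ?_ ?_ ?_ ?_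
  · rintro ⟨a, b⟩ - ⟨c, d⟩ - h
    simp only [Prod.mk.injEq, Nat.add_right_cancel_iff, mul_eq_mul_left_iff, hq, or_false] at h
    ext <;> simp [h]
  · rintro ⟨a, b⟩ h
    simp only [Finset.mem_coe, Finset.HasAntidiagonal.mem_antidiagonal] at h ⊢
    rw [← h]
    ring
  · rintro ⟨a, b⟩ h h'
    by_cases hb : q ∣ b
    · obtain ⟨c, rfl⟩ := hb
      rw [Finset.HasAntidiagonal.mem_antidiagonal] at h
      exfalso
      have h1 : a % q = r := by
        have := congrArg (· % q) h
        simpa [Nat.add_mod, Nat.mod_eq_of_lt hr] using this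
      refine h' ⟨(a / q, c), ?_, ?_⟩
      · simp only [Finset.mem_coe, Finset.HasAntidiagonal.mem_antidiagonal]
        have h2 := Nat.div_add_mod a q
        have h3 : q * (a / q + c) = q * n := by
          rw [mul_add]
          simp only at h
          omega
        exact Nat.eq_of_mul_eq_mul_left (Nat.pos_of_ne_zero hq) h3
      · have h2 := Nat.div_add_mod a q
        simp only [Prod.mk.injEq, and_true]
        omega
    · rw [PowerSeries.coeff_expand_of_not_dvd _ _ _ hb, mul_zero]
  · rintro ⟨a, b⟩ -
    simp

theorem LinearIndependent.powerSeries_expand {ι : Type*} {F : ι → PowerSeries k}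
    (hF : LinearIndependent k[X] F) :
    LinearIndependent k[X] fun i => PowerSeries.expand q hq (F i) := by
  rw [linearIndependent_iff'] at hF ⊢
  intro s p hp i hi
  ext n
  have hr : n % q < q := Nat.mod_lt _ (Nat.pos_of_ne_zero hq)
  have hsec : ∀ i, ∃ p' : k[X], ∀ m, p'.coeff m = (p i).coeff (q * m + n % q) := by
    intro i
    refine ⟨PowerSeries.trunc ((p i).natDegree + 1)
      (PowerSeries.coeffSection q (n % q) (p i : PowerSeries k)), fun m => ?_⟩
    rw [PowerSeries.coeff_trunc]
    simp only [PowerSeries.coeffSection, LinearMap.coe_mk, AddHom.coe_mk, PowerSeries.coeff_mk,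
      Polynomial.coeff_coe]
    split_ifs with h
    · rfl
    · rw [coeff_eq_zero_of_natDegree_lt]
      have : m ≤ q * m := Nat.le_mul_of_pos_left _ (Nat.pos_of_ne_zero hq)
      omega
  choose p' hp' using hsec
  have h : ∑ i ∈ s, p' i • F i = 0 := by
    have h1 := congrArg (PowerSeries.coeffSection q (n % q)) hp
    simp only [map_sum, PowerSeries.polynomial_smul_def, PowerSeries.coeffSection_mul_expand hq hr,
      map_zero] at h1
    rw [← h1]
    refine Finset.sum_congr rfl fun i _ => ?_
    rw [PowerSeries.polynomial_smul_def]
    congr 1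
    ext m
    simp [PowerSeries.coeffSection, hp']
  have h2 := hp' i (n / q)
  rw [hF s p' h i hi, coeff_zero, Nat.div_add_mod] at h2
  rw [← h2, coeff_zero]

end Expand

section Convergence

theorem norm_coeff_polynomial_mul_le (p : ℂ[X]) (G : PowerSeries ℂ) (N : ℕ) {T : ℝ} (hT : 0 ≤ T)
    (h : ∀ a c, a + c = N → p.coeff a ≠ 0 → ‖PowerSeries.coeff c G‖ ≤ T) :
    ‖PowerSeries.coeff N ((p : PowerSeries ℂ) * G)‖ ≤ (∑ a ∈ p.support, ‖p.coeff a‖) * T := by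
  rw [PowerSeries.coeff_mul, Finset.Nat.sum_antidiagonal_eq_sum_range_succ_mk]
  calc _ ≤ ∑ a ∈ Finset.range N.succ, ‖p.coeff a‖ * T := by
        refine (norm_sum_le _ _).trans (Finset.sum_le_sum fun a ha => ?_)
        rw [norm_mul, Polynomial.coeff_coe]
        by_cases hpa : p.coeff a = 0
        · simp [hpa]
        · have ha' := Finset.mem_range.1 ha
          exact mul_le_mul_of_nonneg_left (h a (N - a) (by omega) hpa) (norm_nonneg _)
    _ ≤ ∑ a ∈ Finset.range N.succ ∪ p.support, ‖p.coeff a‖ * T :=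
        Finset.sum_le_sum_of_subset_of_nonneg Finset.subset_union_left
          fun _ _ _ => by positivity
    _ = ∑ a ∈ p.support, ‖p.coeff a‖ * T := by
        refine (Finset.sum_subset Finset.subset_union_right fun a _ ha => ?_).symm
        simp [notMem_support_iff.1 ha]
    _ = _ := by rw [Finset.sum_mul]

theorem anOnBall_of_norm_coeff_le {f : PowerSeries ℂ} {A M : ℝ} (hM : 0 < M)
    (h : ∀ n, ‖PowerSeries.coeff n f‖ ≤ A * M ^ n) : AnOnBall f M⁻¹ := by
  intro z hz
  have hz' : M * ‖z‖ < 1 := by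
    rw [← mul_inv_cancel₀ hM.ne']
    exact mul_lt_mul_of_pos_left hz hM
  refine Summable.of_norm_bounded (g := fun n => A * (M * ‖z‖) ^ n)
    ((summable_geometric_of_lt_one (by positivity) hz').mul_left A) fun n => ?_
  rw [norm_mul, norm_pow, mul_pow, ← mul_assoc]
  exact mul_le_mul_of_nonneg_right (h n) (by positivity)

/-- The solutions of a Mahler system have positive radius of convergence. -/
theorem exists_anOnBall_of_mahler {q : ℕ} (hq : 2 ≤ q) (hq0 : q ≠ 0) {ι : Type*} [Fintype ι]
    {F : ι → PowerSeries ℂ} {b : ℂ[X]} {B : Matrix ι ι ℂ[X]}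
    (hrel : ∀ i, b • F i = ∑ j, B i j • PowerSeries.expand q hq0 (F j)) (hb : b ≠ 0) :
    ∃ r > 0, ∀ i, AnOnBall (F i) r := by
  classical
  set v := b.natTrailingDegree with hv
  have hbv : b.coeff v ≠ 0 := trailingCoeff_nonzero_iff_nonzero.2 hb
  let b' : ℂ[X] := b - monomial v (b.coeff v)
  let S : ℝ := (∑ a ∈ b'.support, ‖b'.coeff a‖) +
    ∑ i, ∑ j, ∑ a ∈ (B i j).support, ‖(B i j).coeff a‖
  let M : ℝ := 1 + S / ‖b.coeff v‖
  let A : ℝ := ∑ i, ∑ n ∈ Finset.range (v + 1), ‖PowerSeries.coeff n (F i)‖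
  have hS : 0 ≤ S := by positivity
  have hA : 0 ≤ A := by positivity
  have hM : 1 ≤ M := by
    have : 0 ≤ S / ‖b.coeff v‖ := by positivity
    linarith
  have hSM : S ≤ ‖b.coeff v‖ * M := by
    have : 0 < ‖b.coeff v‖ := norm_pos_iff.2 hbv
    rw [mul_add, mul_div_cancel₀ _ this.ne']
    linarith
  have key : ∀ n i, ‖PowerSeries.coeff n (F i)‖ ≤ A * M ^ n := by
    intro n
    induction n using Nat.strong_induction_on with
    | _ n ih =>
    intro i
    rcases Nat.lt_or_ge v n with hn | hn
    · have hlt : ∀ c < n, ∀ j, ‖PowerSeries.coeff c (F j)‖ ≤ A * M ^ (n - 1) := fun c hc j =>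
        (ih c hc j).trans (mul_le_mul_of_nonneg_left
          (pow_le_pow_right₀ hM (by omega)) hA)
      have hT : 0 ≤ A * M ^ (n - 1) := by positivity
      have h1 := congrArg (PowerSeries.coeff (n + v)) (hrel i)
      have h2 : (b : PowerSeries ℂ) = (b' : PowerSeries ℂ) + (monomial v (b.coeff v) : ℂ[X]) := by
        rw [← Polynomial.coe_add, sub_add_cancel]
      have h3 : PowerSeries.coeff (n + v) ((monomial v (b.coeff v) : ℂ[X]) * F i : PowerSeries ℂ) =
          b.coeff v * PowerSeries.coeff n (F i) := by
        rw [← C_mul_X_pow_eq_monomial, Polynomial.coe_mul, Polynomial.coe_C, Polynomial.coe_pow,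
          Polynomial.coe_X, mul_assoc, PowerSeries.coeff_C_mul, PowerSeries.coeff_X_pow_mul]
      simp only [PowerSeries.polynomial_smul_def] at h1
      rw [h2, add_mul, map_add, h3, map_sum] at h1
      have h4 := norm_coeff_polynomial_mul_le b' (F i) (n + v) hT (by
        intro a c hac ha
        refine hlt c ?_ i
        by_contra hc
        have hav : a ≤ v := by omega
        refine ha ?_
        simp only [b', coeff_sub, coeff_monomial]
        split_ifs with hva
        · rw [hva, sub_self]
        · rw [sub_zero]
          exact coeff_eq_zero_of_lt_natTrailingDegree (by omega))
      have h5 := fun j => norm_coeff_polynomial_mul_le (B i j) (PowerSeries.expand q hq0 (F j))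
        (n + v) hT (by
          intro a c hac _
          rw [PowerSeries.coeff_expand]
          split_ifs with hc
          · refine hlt _ ?_ j
            refine Nat.div_lt_of_lt_mul ?_
            nlinarith
          · simpa using hT)
      have h6 : ‖b.coeff v‖ * ‖PowerSeries.coeff n (F i)‖ ≤ S * (A * M ^ (n - 1)) := by
        rw [← norm_mul]
        have h7 : b.coeff v * PowerSeries.coeff n (F i) =
            ∑ j, PowerSeries.coeff (n + v) ((B i j : PowerSeries ℂ) * PowerSeries.expand q hq0 (F j))
              - PowerSeries.coeff (n + v) ((b' : PowerSeries ℂ) * F i) := by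
          rw [← h1]
          ring
        rw [h7]
        refine (norm_sub_le _ _).trans ?_
        have h8 : ‖∑ j, PowerSeries.coeff (n + v)
            ((B i j : PowerSeries ℂ) * PowerSeries.expand q hq0 (F j))‖ ≤
            (∑ i, ∑ j, ∑ a ∈ (B i j).support, ‖(B i j).coeff a‖) * (A * M ^ (n - 1)) := by
          refine (norm_sum_le _ _).trans ((Finset.sum_le_sum fun j _ => h5 j).trans ?_)
          rw [← Finset.sum_mul]
          refine mul_le_mul_of_nonneg_right ?_ hT
          exact Finset.single_le_sum
            (f := fun i => ∑ j, ∑ a ∈ (B i j).support, ‖(B i j).coeff a‖)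
            (fun _ _ => by positivity) (Finset.mem_univ i)
        simp only [S, add_mul]
        linarith
      have h9 : ‖b.coeff v‖ * ‖PowerSeries.coeff n (F i)‖ ≤ ‖b.coeff v‖ * (A * M ^ n) := by
        refine h6.trans ((mul_le_mul_of_nonneg_right hSM hT).trans_eq ?_)
        obtain ⟨n, rfl⟩ : ∃ m, n = m + 1 := ⟨n - 1, by omega⟩
        rw [Nat.add_sub_cancel, pow_succ]
        ring
      exact le_of_mul_le_mul_left h9 (norm_pos_iff.2 hbv)
    · have h1 : ‖PowerSeries.coeff n (F i)‖ ≤ A := by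
        refine (Finset.single_le_sum (f := fun n => ‖PowerSeries.coeff n (F i)‖)
          (fun _ _ => norm_nonneg _) (Finset.mem_range.2 (by omega : n < v + 1))).trans ?_
        exact Finset.single_le_sum
          (f := fun i => ∑ n ∈ Finset.range (v + 1), ‖PowerSeries.coeff n (F i)‖)
          (fun _ _ => by positivity) (Finset.mem_univ i)
      exact h1.trans (le_mul_of_one_le_right hA (one_le_pow₀ hM))
  exact ⟨M⁻¹, by positivity, fun i => anOnBall_of_norm_coeff_le (by linarith) fun n => key n i⟩

end Convergence

section Values

/-- At a regular algebraic point, the values of linearly independent solutions of a Mahler system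
over a number field are linearly independent over the algebraic numbers. -/
theorem sum_mul_psEval_ne_zero {K : Subfield ℂ} [FiniteDimensional ℚ K] {ι : Type*}
    [Fintype ι] [DecidableEq ι] {q : ℕ} (hq : 2 ≤ q) (hq0 : q ≠ 0) {F : ι → PowerSeries K}
    {b : K[X]} {B : Matrix ι ι K[X]} (hb : b ≠ 0)
    (hrel : ∀ i, b • F i = ∑ j, B i j • PowerSeries.expand q hq0 (F j))
    (hind : LinearIndependent K[X] F) {ε : ℝ} (hε : ε ≤ 1)
    (hF : ∀ i, AnOnBall ((F i).map (algebraMap K ℂ)) ε)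
    (hdet : ∀ z : ℂ, z ≠ 0 → ‖z‖ < ε → (B.det.map (algebraMap K ℂ)).eval z ≠ 0)
    {α : ℂ} (hα : IsAlgebraic ℚ α) (hα0 : α ≠ 0) (hαε : ‖α‖ < ε) {τ : ι → ℂ}
    (hτ : ∀ i, IsAlgebraic ℚ (τ i)) (hτ0 : τ ≠ 0) :
    ∑ i, τ i * psEval ((F i).map (algebraMap K ℂ)) α ≠ 0 := by
  let S : Set ℂ := insert α (Set.range τ)
  have hS : ∀ x ∈ S, IsIntegral K x := by
    rintro x (rfl | ⟨i, rfl⟩)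
    · exact (hα.tower_top K).isIntegral
    · exact ((hτ i).tower_top K).isIntegral
  have hSfin : S.Finite := (Set.finite_range τ).insert α
  let k : IntermediateField K ℂ := IntermediateField.adjoin K S
  have : Finite S := hSfin
  have _ : FiniteDimensional K k := IntermediateField.finiteDimensional_adjoin hS
  have _ : FiniteDimensional ℚ k := FiniteDimensional.trans ℚ K k
  have _ : NumberField k := ⟨⟩
  have hmem : ∀ x ∈ S, x ∈ k := fun x hx => IntermediateField.subset_adjoin K S hx
  let α' : k := ⟨α, hmem α (Set.mem_insert _ _)⟩
  let τ' : ι → k := fun i => ⟨τ i, hmem _ (Set.mem_insert_of_mem _ ⟨i, rfl⟩)⟩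
  have hcomp : (algebraMap k ℂ).comp (algebraMap K k) = algebraMap K ℂ :=
    (IsScalarTower.algebraMap_eq K k ℂ).symm
  have hmap : ∀ f : PowerSeries K,
      (f.map (algebraMap K k)).map (algebraMap k ℂ) = f.map (algebraMap K ℂ) := by
    intro f
    rw [← hcomp]
    ext n
    simp
  have hsmul : ∀ (p : K[X]) (f : PowerSeries K),
      (p • f).map (algebraMap K k) = p.map (algebraMap K k) • f.map (algebraMap K k) := by
    intro p f
    rw [PowerSeries.polynomial_smul_def, PowerSeries.polynomial_smul_def, map_mul,
      ← Polynomial.polynomial_map_coe]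
  have key := sum_mul_evalOver_ne_zero (k := k) hq hq0 (F := fun i => (F i).map (algebraMap K k))
    (b := b.map (algebraMap K k)) (B := (Polynomial.mapRingHom (algebraMap K k)).mapMatrix B)
    ((Polynomial.map_ne_zero_iff (algebraMap K k).injective).2 hb) ?_ ?_ hε ?_ ?_
    (α := α') ?_ hαε (τ := τ') ?_
  · simp only [evalOver, hmap] at key
    exact key
  · intro i
    rw [← hsmul, hrel, map_sum]
    refine Finset.sum_congr rfl fun j _ => ?_
    rw [hsmul, PowerSeries.map_expand]
    rfl
  · simp only [hmap]
    exact hind.powerSeries_map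
  · simpa only [hmap] using hF
  · intro z hz0 hz h0
    refine hdet (algebraMap k ℂ z) (by simpa using hz0) hz ?_
    rw [← RingHom.map_det, coe_mapRingHom] at h0
    rw [← hcomp, ← Polynomial.map_map, eval_map_algebraMap, aeval_algebraMap_apply,
      coe_aeval_eq_eval, h0, map_zero]
  · intro h
    exact hα0 (congrArg Subtype.val h)
  · intro h
    exact hτ0 (funext fun i => congrArg Subtype.val (congrFun h i))

end Values

section Saturation

variable {R M : Type*} [CommRing R] [IsDomain R] [AddCommGroup M] [Module R M]

theorem Submodule.saturation_le_saturation {N P : Submodule R M} (h : N ≤ P.saturation) :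
    N.saturation ≤ P.saturation := by
  rintro x ⟨d, hd, hx⟩
  exact Submodule.mem_saturation_of_smul_mem hd (h hx)

/-- Finitely many elements of the saturation of a span have a common denominator. -/
theorem exists_smul_eq_sum_of_mem_saturation {κ ι : Type*} [Fintype κ] [Fintype ι] {F : ι → M}
    {g : κ → M} (hg : ∀ j, g j ∈ (Submodule.span R (Set.range F)).saturation) :
    ∃ d : R, d ≠ 0 ∧ ∃ A : Matrix κ ι R, ∀ j, d • g j = ∑ i, A j i • F i := by
  classical
  choose d hd hdg using hg
  choose c hc using fun j => (Submodule.mem_span_range_iff_exists_fun _).1 (hdg j)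
  refine ⟨∏ j, d j, Finset.prod_ne_zero_iff.2 fun j _ => hd j,
    fun j i => (∏ l ∈ Finset.univ.erase j, d l) * c j i, fun j => ?_⟩
  rw [← Finset.prod_erase_mul _ _ (Finset.mem_univ j), mul_smul, ← hc, Finset.smul_sum]
  simp only [mul_smul]

/-- More than `card ι` elements of the saturation of the span of a family indexed by `ι` are
linearly dependent. -/
theorem not_linearIndependent_of_mem_saturation {κ ι : Type*} [Fintype κ] [Fintype ι] {F : ι → M}
    {g : κ → M} (hg : ∀ j, g j ∈ (Submodule.span R (Set.range F)).saturation)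
    (hcard : Fintype.card ι < Fintype.card κ) : ¬ LinearIndependent R g := by
  intro hind
  obtain ⟨d, hd, A, hA⟩ := exists_smul_eq_sum_of_mem_saturation hg
  have hdep : ¬ LinearIndependent R (fun j => A j) := by
    intro h
    have := h.fintype_card_le_finrank
    rw [Module.finrank_fintype_fun_eq_card] at this
    omega
  obtain ⟨x, hx, j, hj⟩ := Fintype.not_linearIndependent_iff.1 hdep
  have h0 : ∑ j, (x j * d) • g j = 0 := by
    simp only [mul_smul, hA, Finset.smul_sum]
    rw [Finset.sum_comm]
    refine Finset.sum_eq_zero fun i _ => ?_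
    have := congrFun hx i
    simp only [Finset.sum_apply, Pi.smul_apply, Pi.zero_apply, smul_eq_mul] at this
    simp only [← mul_smul]
    rw [← Finset.sum_smul, this, zero_smul]
  have := Fintype.linearIndependent_iff.1 hind _ h0 j
  exact (mul_ne_zero hj hd) this

end Saturation

section System

variable {k : Type*} [Field k] {q : ℕ} (hq : q ≠ 0)

theorem PowerSeries.expand_polynomial_smul (p : k[X]) (f : PowerSeries k) :
    PowerSeries.expand q hq (p • f) = Polynomial.expand k q p • PowerSeries.expand q hq f := by
  rw [PowerSeries.polynomial_smul_def, map_mul, PowerSeries.expand_polynomial,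
    PowerSeries.polynomial_smul_def]

theorem PowerSeries.expand_pow_succ (n : ℕ) (f : PowerSeries k) :
    PowerSeries.expand (q ^ (n + 1)) (pow_ne_zero _ hq) f =
      PowerSeries.expand (q ^ n) (pow_ne_zero _ hq) (PowerSeries.expand q hq f) := by
  rw [← PowerSeries.expand_mul]
  rfl

theorem PowerSeries.expand_pow_zero (f : PowerSeries k) :
    PowerSeries.expand (q ^ 0) (pow_ne_zero _ hq) f = f :=
  PowerSeries.expand_one_apply f

variable {ι : Type*} [Fintype ι] {F : ι → PowerSeries k}

theorem expand_pow_mem_saturation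
    (hF : ∀ i, PowerSeries.expand q hq (F i) ∈ (Submodule.span k[X] (Set.range F)).saturation)
    (n : ℕ) {g : PowerSeries k} (hg : g ∈ (Submodule.span k[X] (Set.range F)).saturation) :
    PowerSeries.expand (q ^ n) (pow_ne_zero _ hq) g ∈
      (Submodule.span k[X] (Set.range F)).saturation := by
  induction n generalizing g with
  | zero => exact (PowerSeries.expand_pow_zero hq g).symm ▸ hg
  | succ n ih =>
    rw [PowerSeries.expand_pow_succ hq]
    exact ih (expand_mem_saturation hq hF hg)

/-- Linearly independent series spanning a space stable under the Mahler operator satisfy an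
invertible Mahler system. -/
theorem exists_mahler_system [DecidableEq ι] (hF : LinearIndependent k[X] F)
    (hsat : ∀ i, PowerSeries.expand q hq (F i) ∈ (Submodule.span k[X] (Set.range F)).saturation) :
    ∃ (b : k[X]) (B : Matrix ι ι k[X]), b ≠ 0 ∧ B.det ≠ 0 ∧
      ∀ i, b • F i = ∑ j, B i j • PowerSeries.expand q hq (F j) := by
  obtain ⟨d, hd, A, hA⟩ := exists_smul_eq_sum_of_mem_saturation hsat
  have hdet : A.det ≠ 0 := by
    intro h
    obtain ⟨v, hv, hvA⟩ := Matrix.exists_vecMul_eq_zero_iff.2 h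
    have h0 : ∑ j, (v j * d) • PowerSeries.expand q hq (F j) = 0 := by
      simp only [mul_smul, hA, Finset.smul_sum]
      rw [Finset.sum_comm]
      refine Finset.sum_eq_zero fun i _ => ?_
      have := congrFun hvA i
      simp only [Matrix.vecMul, dotProduct, Pi.zero_apply] at this
      simp only [← mul_smul]
      rw [← Finset.sum_smul, this, zero_smul]
    have h1 := Fintype.linearIndependent_iff.1 (hF.powerSeries_expand hq) _ h0
    exact hv (funext fun j => (mul_eq_zero.1 (h1 j)).resolve_right hd)
  refine ⟨A.det, d • A.adjugate, hdet, ?_, fun i => ?_⟩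
  · rw [Matrix.det_smul, Matrix.det_adjugate]
    exact mul_ne_zero (pow_ne_zero _ hd) (pow_ne_zero _ hdet)
  · have h1 : ∀ j, (d • A.adjugate) i j • PowerSeries.expand q hq (F j) =
        ∑ l, (A.adjugate i j * A j l) • F l := by
      intro j
      rw [Matrix.smul_apply, smul_eq_mul, mul_comm, mul_smul, hA, Finset.smul_sum]
      simp only [mul_smul]
    simp only [h1]
    rw [Finset.sum_comm]
    simp only [← Finset.sum_smul]
    have h2 : ∀ l, ∑ j, A.adjugate i j * A j l = A.det * (1 : Matrix ι ι k[X]) i l := by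
      intro l
      have := congrFun (congrFun A.adjugate_mul i) l
      rwa [Matrix.mul_apply] at this
    simp only [h2]
    rw [Finset.sum_eq_single i]
    · simp
    · intro j _ hj
      simp [Matrix.one_apply_ne hj.symm]
    · simp

/-- The solutions of a Mahler system are combinations of their iterates under the operator. -/
theorem mem_saturation_expand_pow {b : k[X]} {B : Matrix ι ι k[X]} (hb : b ≠ 0)
    (hrel : ∀ i, b • F i = ∑ j, B i j • PowerSeries.expand q hq (F j)) (n : ℕ) (i : ι) :
    F i ∈ (Submodule.span k[X]
      (Set.range fun j => PowerSeries.expand (q ^ n) (pow_ne_zero _ hq) (F j))).saturation := by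
  induction n with
  | zero =>
    refine Submodule.le_saturation (Submodule.subset_span ⟨i, ?_⟩)
    exact PowerSeries.expand_pow_zero hq (F i)
  | succ n ih =>
    refine Submodule.saturation_le_saturation (Submodule.span_le.2 ?_) ih
    rintro _ ⟨j, rfl⟩
    refine ⟨Polynomial.expand k (q ^ n) b,
      (Polynomial.expand_ne_zero (pow_pos (Nat.pos_of_ne_zero hq) n)).2 hb, ?_⟩
    beta_reduce
    rw [← PowerSeries.expand_polynomial_smul, hrel, map_sum]
    refine Submodule.sum_mem _ fun l _ => ?_
    rw [PowerSeries.expand_polynomial_smul, ← PowerSeries.expand_pow_succ]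
    exact Submodule.smul_mem _ _ (Submodule.subset_span ⟨l, rfl⟩)

end System

section Basis

theorem linearIndependent_of_notMem_saturation {R M : Type*} [CommRing R] [IsDomain R]
    [AddCommGroup M] [Module R M] {H : ℕ → M} {m : ℕ}
    (h : ∀ j < m, H j ∉ (Submodule.span R (Set.range fun i : Fin j => H i)).saturation) :
    LinearIndependent R fun i : Fin m => H i := by
  induction m with
  | zero => exact linearIndependent_empty_type
  | succ m ih =>
    rw [Fintype.linearIndependent_iff]
    intro c hc
    rw [Fin.sum_univ_castSucc] at hc
    have hlast : c (Fin.last m) = 0 := by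
      by_contra h0
      refine h m m.lt_succ_self ⟨c (Fin.last m), h0, ?_⟩
      rw [show c (Fin.last m) • H m = -∑ i : Fin m, c i.castSucc • H i from
        eq_neg_of_add_eq_zero_right hc]
      exact Submodule.neg_mem _ (Submodule.sum_mem _ fun i _ =>
        Submodule.smul_mem _ _ (Submodule.subset_span ⟨i, rfl⟩))
    rw [hlast, zero_smul, add_zero] at hc
    have := Fintype.linearIndependent_iff.1 (ih fun j hj => h j (hj.trans m.lt_succ_self))
      (fun i => c i.castSucc) hc
    intro i
    exact Fin.lastCases hlast this i

variable {k : Type*} [Field k] {q : ℕ} (hq : q ≠ 0)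

/-- A series with linearly dependent iterates lies in a space stable under the Mahler operator,
with a basis that contains `1`. -/
theorem exists_mahler_basis {f : PowerSeries k} {N : ℕ}
    (hf : ¬ LinearIndependent k[X]
      fun i : Fin N => PowerSeries.expand (q ^ (i : ℕ)) (pow_ne_zero _ hq) f) :
    ∃ (m : ℕ) (F : Fin (m + 1) → PowerSeries k), F 0 = 1 ∧ LinearIndependent k[X] F ∧
      (∀ i, PowerSeries.expand q hq (F i) ∈ (Submodule.span k[X] (Set.range F)).saturation) ∧
      f ∈ (Submodule.span k[X] (Set.range F)).saturation := by
  classical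
  let H : ℕ → PowerSeries k := fun i =>
    i.casesOn 1 fun j => PowerSeries.expand (q ^ j) (pow_ne_zero _ hq) f
  have hH : ∀ i, PowerSeries.expand q hq (H (i + 1)) = H (i + 2) := by
    intro i
    change PowerSeries.expand q hq (PowerSeries.expand (q ^ i) _ f) =
      PowerSeries.expand (q ^ (i + 1)) _ f
    rw [← PowerSeries.expand_mul]
    congr 1
    simp only [pow_succ']
  have hex : ∃ m, H m ∈ (Submodule.span k[X] (Set.range fun i : Fin m => H i)).saturation := by
    by_contra! hno
    exact hf ((linearIndependent_of_notMem_saturation (m := N + 1) fun j _ => hno j).comp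
      Fin.succ (Fin.succ_injective N))
  obtain ⟨m, hm⟩ : ∃ m, Nat.find hex = m + 1 := by
    refine Nat.exists_eq_succ_of_ne_zero fun h => ?_
    have h0 := Nat.find_spec hex
    rw [h] at h0
    obtain ⟨d, hd, hd1⟩ := h0
    rw [Set.range_eq_empty, Submodule.span_empty, Submodule.mem_bot,
      PowerSeries.polynomial_smul_def] at hd1
    exact hd (Polynomial.coe_eq_zero_iff.1 (by simpa [H] using hd1))
  have hspec := Nat.find_spec hex
  rw [hm] at hspec
  have hstep : ∀ i ≤ m + 1,
      H i ∈ (Submodule.span k[X] (Set.range fun i : Fin (m + 1) => H i)).saturation := by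
    intro i hi
    rcases hi.lt_or_eq with h | rfl
    · exact Submodule.le_saturation (Submodule.subset_span ⟨⟨i, h⟩, rfl⟩)
    · exact hspec
  refine ⟨m, fun i => H i, rfl,
    linearIndependent_of_notMem_saturation fun j hj => Nat.find_min hex (by omega), ?_, ?_⟩
  · rintro ⟨i, hi⟩
    cases i with
    | zero =>
      change PowerSeries.expand q hq 1 ∈ _
      rw [map_one]
      exact hstep 0 (by omega)
    | succ i =>
      change PowerSeries.expand q hq (H (i + 1)) ∈ _
      rw [hH]
      exact hstep (i + 2) (by omega)
  · have := hstep 1 (by omega)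
    rwa [show H 1 = f from PowerSeries.expand_pow_zero hq f] at this

end Basis

section Bezout

/-- A nonzero vector over a principal ideal domain is a multiple of a unimodular one. -/
theorem exists_eq_mul_unimodular {R ι : Type*} [CommRing R] [IsDomain R] [IsPrincipalIdealRing R]
    [Fintype ι] {c : ι → R} (hc : c ≠ 0) :
    ∃ (e : R) (p x : ι → R), (∀ i, c i = e * p i) ∧ ∑ i, x i * p i = 1 := by
  let I : Ideal R := Ideal.span (Set.range c)
  let e : R := Submodule.IsPrincipal.generator I
  have hmem : ∀ i, ∃ p, c i = e * p := fun i =>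
    (Submodule.IsPrincipal.mem_iff_generator_dvd I).1 (Ideal.subset_span ⟨i, rfl⟩)
  choose p hp using hmem
  obtain ⟨x, hx⟩ := (Submodule.mem_span_range_iff_exists_fun R).1
    (Submodule.IsPrincipal.generator_mem I)
  have he : e ≠ 0 := fun h => hc (funext fun i => by rw [hp, h, zero_mul]; rfl)
  refine ⟨e, p, x, hp, mul_left_cancel₀ he ?_⟩
  rw [mul_one, Finset.mul_sum]
  refine Eq.trans (Finset.sum_congr rfl fun i _ => ?_) hx
  rw [smul_eq_mul, hp]
  ring

end Bezout

section Roots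

theorem Polynomial.exists_eval_ne_zero_of_norm_lt {p : ℂ[X]} (hp : p ≠ 0) :
    ∃ r > 0, ∀ z : ℂ, z ≠ 0 → ‖z‖ < r → p.eval z ≠ 0 := by
  have hfin : {z : ℂ | p.eval z = 0 ∧ z ≠ 0}.Finite := by
    refine (p.roots.toFinset.finite_toSet).subset fun z hz => ?_
    simpa [hp] using hz.1
  obtain ⟨r, hr, h⟩ := Metric.mem_nhds_iff.1
    (hfin.isClosed.isOpen_compl.mem_nhds (x := (0 : ℂ)) (by simp))
  exact ⟨r, hr, fun z hz hzr h0 => h (by simpa using hzr) ⟨h0, hz⟩⟩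

end Roots

section Transcendence

theorem PowerSeries.map_polynomial_smul {k L : Type*} [Field k] [Field L] (u : k →+* L) (p : k[X])
    (f : PowerSeries k) : (p • f).map u = p.map u • f.map u := by
  rw [PowerSeries.polynomial_smul_def, PowerSeries.polynomial_smul_def, map_mul,
    ← Polynomial.polynomial_map_coe]

theorem isAlgebraic_eval_map {K : Subfield ℂ} [FiniteDimensional ℚ K] (p : K[X]) {β : ℂ}
    (hβ : IsAlgebraic ℚ β) : IsAlgebraic ℚ ((p.map (algebraMap K ℂ)).eval β) := by
  rw [eval_map, eval₂_eq_sum, Polynomial.sum]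
  refine sum_mem (S := Subalgebra.algebraicClosure ℚ ℂ) fun i _ => ?_
  exact ((Algebra.IsAlgebraic.isAlgebraic (R := ℚ) (p.coeff i)).algebraMap).mul (hβ.pow i)

variable {K : Subfield ℂ} [FiniteDimensional ℚ K] {q : ℕ}

/-- An irrational Mahler function is, up to rational functions, a Mahler function that takes
transcendental values at all nonzero algebraic points of a given disk. -/
theorem exists_purely_transcendental (hq : 2 ≤ q) (hq0 : q ≠ 0) {f : PowerSeries K} {N : ℕ}
    (hf : ¬ LinearIndependent K[X]
      fun i : Fin N => PowerSeries.expand (q ^ (i : ℕ)) (pow_ne_zero _ hq0) f)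
    (hirr : ∀ d c : K[X], d ≠ 0 → d • f ≠ (c : PowerSeries K)) {R : ℝ} (hR0 : 0 < R) (hR1 : R < 1) :
    ∃ (d c e : K[X]) (g : PowerSeries K), d ≠ 0 ∧ d • f = (c : PowerSeries K) + e • g ∧
      (∃ N : ℕ, ¬ LinearIndependent K[X]
        fun i : Fin N => PowerSeries.expand (q ^ (i : ℕ)) (pow_ne_zero _ hq0) g) ∧
      AnOnBall (g.map (algebraMap K ℂ)) R ∧
      ∀ β : ℂ, IsAlgebraic ℚ β → 0 < ‖β‖ → ‖β‖ < R →
        Transcendental ℚ (psEval (g.map (algebraMap K ℂ)) β) := by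
  obtain ⟨m, F, hF1, hind, hsat, hfF⟩ := exists_mahler_basis hq0 hf
  obtain ⟨b, B, hb, hB, hrel⟩ := exists_mahler_system hq0 hind hsat
  have hinj : Function.Injective (algebraMap K ℂ) := (algebraMap K ℂ).injective
  obtain ⟨r, hr, hFr⟩ := exists_anOnBall_of_mahler hq hq0
    (F := fun i => (F i).map (algebraMap K ℂ)) (b := b.map (algebraMap K ℂ))
    (B := fun i j => (B i j).map (algebraMap K ℂ))
    (fun i => by
      rw [← PowerSeries.map_polynomial_smul, hrel, map_sum]
      refine Finset.sum_congr rfl fun j _ => ?_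
      rw [PowerSeries.map_polynomial_smul, PowerSeries.map_expand])
    ((Polynomial.map_ne_zero_iff hinj).2 hb)
  obtain ⟨r', hr', hdet⟩ := Polynomial.exists_eval_ne_zero_of_norm_lt
    ((Polynomial.map_ne_zero_iff hinj).2 hB)
  obtain ⟨ε, hε0, hεr, hεr', hε1⟩ : ∃ ε > 0, ε ≤ r ∧ ε ≤ r' ∧ ε ≤ 1 :=
    ⟨min r (min r' 1), by positivity, min_le_left _ _, (min_le_right _ _).trans (min_le_left _ _),
      (min_le_right _ _).trans (min_le_right _ _)⟩
  obtain ⟨n, hn⟩ := exists_pow_lt_of_lt_one hε0 hR1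
  have hsmall : ∀ z : ℂ, ‖z‖ < R → ‖z ^ q ^ n‖ < ε := by
    intro z hz
    rw [norm_pow]
    calc ‖z‖ ^ q ^ n ≤ R ^ q ^ n := by gcongr
      _ ≤ R ^ n := pow_le_pow_of_le_one hR0.le hR1.le (Nat.lt_pow_self (by omega)).le
      _ < ε := hn
  have hfn : f ∈ (Submodule.span K[X] (Set.range fun j =>
      PowerSeries.expand (q ^ n) (pow_ne_zero _ hq0) (F j))).saturation :=
    Submodule.saturation_le_saturation (Submodule.span_le.2 (by
      rintro _ ⟨i, rfl⟩
      exact mem_saturation_expand_pow hq0 hb hrel n i)) hfF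
  obtain ⟨d, hd, hdf⟩ := hfn
  obtain ⟨c, hc⟩ := (Submodule.mem_span_range_iff_exists_fun _).1 hdf
  rw [Fin.sum_univ_succ, hF1, map_one, PowerSeries.polynomial_smul_def, mul_one] at hc
  have hc0 : (fun i : Fin m => c i.succ) ≠ 0 := by
    intro h
    refine hirr d (c 0) hd ?_
    rw [← hc, Finset.sum_eq_zero, add_zero]
    intro i _
    rw [show c i.succ = 0 from congrFun h i, zero_smul]
  obtain ⟨e, p, x, hp, hx⟩ := exists_eq_mul_unimodular hc0
  let g : PowerSeries K :=
    ∑ i : Fin m, p i • PowerSeries.expand (q ^ n) (pow_ne_zero _ hq0) (F i.succ)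
  have hgmap : g.map (algebraMap K ℂ) = ∑ i : Fin m, (p i).map (algebraMap K ℂ) •
      PowerSeries.expand (q ^ n) (pow_ne_zero _ hq0) ((F i.succ).map (algebraMap K ℂ)) := by
    rw [map_sum]
    refine Finset.sum_congr rfl fun i _ => ?_
    rw [PowerSeries.map_polynomial_smul, PowerSeries.map_expand]
  have hgz : ∀ z : ℂ, ‖z‖ < R →
      (Summable fun j => PowerSeries.coeff j (g.map (algebraMap K ℂ)) * z ^ j) ∧
      psEval (g.map (algebraMap K ℂ)) z = ∑ i : Fin m, ((p i).map (algebraMap K ℂ)).eval z *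
        psEval ((F i.succ).map (algebraMap K ℂ)) (z ^ q ^ n) := by
    intro z hz
    have h := psEval_sum_smul Finset.univ (fun i => (p i).map (algebraMap K ℂ))
      (fun i : Fin m => PowerSeries.expand (q ^ n) (pow_ne_zero _ hq0)
        ((F i.succ).map (algebraMap K ℂ))) z fun i _ =>
          (summable_coeff_expand_iff _ _ _).2 (hFr i.succ _ ((hsmall z hz).trans_le hεr))
    simpa only [← hgmap, psEval_expand] using h
  have hgF : g ∈ (Submodule.span K[X] (Set.range F)).saturation :=
    Submodule.sum_mem _ fun i _ => Submodule.smul_mem _ _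
      (expand_pow_mem_saturation hq0 hsat n (Submodule.le_saturation (Submodule.subset_span ⟨i.succ, rfl⟩)))
  refine ⟨d, c 0, e, g, hd, ?_, ⟨m + 2, not_linearIndependent_of_mem_saturation
    (fun j => expand_pow_mem_saturation hq0 hsat j hgF) (by simp)⟩, fun z hz => (hgz z hz).1, ?_⟩
  · rw [← hc, Finset.smul_sum]
    congr 1
    refine Finset.sum_congr rfl fun i _ => ?_
    rw [hp, mul_smul]
  · intro β hβ hβ0 hβR hγ
    have hβ0' : β ≠ 0 := norm_pos_iff.1 hβ0
    refine sum_mul_psEval_ne_zero hq hq0 hb hrel hind hε1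
      (fun i z hz => hFr i z (hz.trans_le hεr))
      (fun z hz hzε => hdet z hz (hzε.trans_le hεr')) (hβ.pow (q ^ n)) (pow_ne_zero _ hβ0')
      (hsmall β hβR) (τ := Fin.cons (-psEval (g.map (algebraMap K ℂ)) β)
        fun i => ((p i).map (algebraMap K ℂ)).eval β) ?_ ?_ ?_
    · intro i
      refine Fin.cases ?_ (fun i => ?_) i
      · exact IsAlgebraic.neg hγ
      · exact isAlgebraic_eval_map _ hβ
    · intro h
      have h1 := congrArg (fun p : K[X] => (p.map (algebraMap K ℂ)).eval β) hx
      simp only [Polynomial.map_sum, Polynomial.map_mul, eval_finsetSum, eval_mul,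
        Polynomial.map_one, eval_one] at h1
      refine zero_ne_one (α := ℂ) (Eq.trans (Eq.symm (Finset.sum_eq_zero fun i _ => ?_)) h1)
      have h2 : ((p i).map (algebraMap K ℂ)).eval β = 0 := congrFun h i.succ
      rw [h2, mul_zero]
    · have h1 : psEval ((F 0).map (algebraMap K ℂ)) (β ^ q ^ n) = 1 := by
        have := psEval_polynomial (1 : ℂ[X]) (β ^ q ^ n)
        rw [hF1, map_one]
        simpa using this
      rw [Fin.sum_univ_succ, h1]
      simp only [Fin.cons_zero, Fin.cons_succ]
      rw [← (hgz β hβR).2]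
      ring

end Transcendence

section Lacunary

variable (k : Type*) [Field k] (q : ℕ)

open Classical in
/-- The lacunary series `∑ X ^ (q ^ i)`. -/
noncomputable def lacunarySeries : PowerSeries k :=
  PowerSeries.mk fun n => if ∃ i, n = q ^ i then 1 else 0

variable {k q}

theorem coeff_lacunarySeries_pow (i : ℕ) : PowerSeries.coeff (q ^ i) (lacunarySeries k q) = 1 := by
  rw [lacunarySeries, PowerSeries.coeff_mk, if_pos ⟨i, rfl⟩]

theorem coeff_lacunarySeries_of_ne {n : ℕ} (hn : ∀ i, n ≠ q ^ i) :
    PowerSeries.coeff n (lacunarySeries k q) = 0 := by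
  rw [lacunarySeries, PowerSeries.coeff_mk, if_neg (not_exists.2 hn)]

theorem expand_lacunarySeries (hq : 2 ≤ q) (hq0 : q ≠ 0) :
    PowerSeries.expand q hq0 (lacunarySeries k q) =
      lacunarySeries k q - ((X : k[X]) : PowerSeries k) := by
  ext n
  rw [PowerSeries.coeff_expand, map_sub, Polynomial.coeff_coe, Polynomial.coeff_X]
  by_cases hn : ∃ i, n = q ^ i
  · obtain ⟨i, rfl⟩ := hn
    cases i with
    | zero =>
      have h1 : ¬ q ∣ 1 := by
        intro h
        have := Nat.le_of_dvd one_pos h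
        omega
      have h := coeff_lacunarySeries_pow (k := k) (q := q) 0
      rw [pow_zero] at h ⊢
      rw [if_neg h1, if_pos rfl, h, sub_self]
    | succ i =>
      have h1 : 1 ≠ q ^ (i + 1) := (Nat.one_lt_pow (by omega) (by omega)).ne
      rw [if_neg h1, if_pos (dvd_pow_self q (by omega)), coeff_lacunarySeries_pow, pow_succ,
        Nat.mul_div_cancel _ (by omega), coeff_lacunarySeries_pow, sub_zero]
  · rw [not_exists] at hn
    have h1 : 1 ≠ n := fun h => hn 0 (by rw [pow_zero, h])
    rw [if_neg h1, coeff_lacunarySeries_of_ne hn, sub_zero]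
    split_ifs with h
    · obtain ⟨l, rfl⟩ := h
      rw [Nat.mul_div_cancel_left _ (by omega)]
      refine coeff_lacunarySeries_of_ne fun i hi => hn (i + 1) ?_
      rw [hi, pow_succ']
    · rfl

theorem not_linearIndependent_expand_lacunarySeries (hq : 2 ≤ q) (hq0 : q ≠ 0) :
    ¬ LinearIndependent k[X] fun i : Fin 3 =>
      PowerSeries.expand (q ^ (i : ℕ)) (pow_ne_zero _ hq0) (lacunarySeries k q) := by
  have hmem : ∀ i, ![1, lacunarySeries k q] i ∈
      Submodule.span k[X] (Set.range ![1, lacunarySeries k q]) := fun i =>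
    Submodule.subset_span ⟨i, rfl⟩
  refine not_linearIndependent_of_mem_saturation (F := ![1, lacunarySeries k q])
    (fun j => expand_pow_mem_saturation hq0 ?_ j (Submodule.le_saturation (hmem 1))) (by simp)
  intro i
  refine Submodule.le_saturation ?_
  fin_cases i
  · change PowerSeries.expand q hq0 1 ∈ _
    rw [map_one]
    exact hmem 0
  · change PowerSeries.expand q hq0 (lacunarySeries k q) ∈ _
    rw [expand_lacunarySeries hq]
    refine Submodule.sub_mem _ (hmem 1) ?_
    have := Submodule.smul_mem _ (X : k[X]) (hmem 0)
    rwa [PowerSeries.polynomial_smul_def, Matrix.cons_val_zero, mul_one] at this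

theorem smul_lacunarySeries_ne (hq : 2 ≤ q) (d c : k[X]) (hd : d ≠ 0) :
    d • lacunarySeries k q ≠ (c : PowerSeries k) := by
  intro h
  obtain ⟨N, hNd, hNc, hN⟩ : ∃ N, d.natDegree ≤ N ∧ c.natDegree ≤ N ∧ N < q ^ N :=
    ⟨d.natDegree + c.natDegree, by omega, by omega, Nat.lt_pow_self (by omega)⟩
  have h1 := congrArg (PowerSeries.coeff (d.natDegree + q ^ N)) h
  rw [PowerSeries.polynomial_smul_def, PowerSeries.coeff_mul, Polynomial.coeff_coe c,
    coeff_eq_zero_of_natDegree_lt (by omega),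
    Finset.sum_eq_single (d.natDegree, q ^ N)] at h1
  · rw [coeff_lacunarySeries_pow, mul_one, Polynomial.coeff_coe] at h1
    exact hd (leadingCoeff_eq_zero.1 h1)
  · rintro ⟨a, l⟩ hal hne
    rw [Finset.HasAntidiagonal.mem_antidiagonal] at hal
    simp only at hal
    rcases lt_or_ge d.natDegree a with ha | ha
    · rw [Polynomial.coeff_coe, coeff_eq_zero_of_natDegree_lt ha, zero_mul]
    · rw [coeff_lacunarySeries_of_ne, mul_zero]
      rintro i rfl
      have hi : N < i := by
        by_contra! hle
        have h2 : q ^ i ≤ q ^ N := Nat.pow_le_pow_right (by omega) hle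
        exact hne (by ext <;> simp <;> omega)
      have h3 : q ^ (N + 1) ≤ q ^ i := Nat.pow_le_pow_right (by omega) hi
      have h4 : 2 * q ^ N ≤ q ^ (N + 1) := by
        rw [pow_succ']
        exact Nat.mul_le_mul_right _ hq
      omega
  · intro hnot
    exact absurd (by rw [Finset.HasAntidiagonal.mem_antidiagonal]) hnot

end Lacunary

section MahlerFunctions

theorem psSigma_eq_expand {q : ℕ} (hq : q ≠ 0) (f : PowerSeries ℂ) :
    psSigma q f = PowerSeries.expand q hq f := by
  ext n
  rw [psSigma, PowerSeries.coeff_mk, PowerSeries.coeff_expand]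

theorem psSigma_iterate {q : ℕ} (hq : q ≠ 0) (i : ℕ) (f : PowerSeries ℂ) :
    (psSigma q)^[i] f = PowerSeries.expand (q ^ i) (pow_ne_zero _ hq) f := by
  induction i generalizing f with
  | zero => exact (PowerSeries.expand_pow_zero hq f).symm
  | succ i ih =>
    rw [Function.iterate_succ_apply, ih, psSigma_eq_expand hq, PowerSeries.expand_pow_succ hq]

theorem polyPS_mul (p : ℂ[X]) (f : PowerSeries ℂ) : polyPS p * f = p • f :=
  (PowerSeries.polynomial_smul_def p f).symm

variable {K : Subfield ℂ} {q : ℕ}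

theorem IsM.not_linearIndependent (hq : q ≠ 0) {f : PowerSeries K}
    (hf : IsM q (f.map (algebraMap K ℂ))) :
    ∃ N : ℕ, ¬ LinearIndependent K[X]
      fun i : Fin N => PowerSeries.expand (q ^ (i : ℕ)) (pow_ne_zero _ hq) f := by
  obtain ⟨-, m, p, -, ⟨i, him, hi⟩, hsum⟩ := hf
  refine ⟨m + 1, fun hind => hi ?_⟩
  have h := hind.powerSeries_map (K := ℂ)
  simp only [PowerSeries.map_expand] at h
  rw [Finset.sum_range] at hsum
  simp only [polyPS_mul, psSigma_iterate hq] at hsum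
  exact Fintype.linearIndependent_iff.1 h (fun i => p i) hsum ⟨i, by omega⟩

theorem isM_map [FiniteDimensional ℚ K] (hq : q ≠ 0) {f : PowerSeries K} {N : ℕ}
    (hf : ¬ LinearIndependent K[X]
      fun i : Fin N => PowerSeries.expand (q ^ (i : ℕ)) (pow_ne_zero _ hq) f) :
    IsM q (f.map (algebraMap K ℂ)) := by
  have halg : ∀ x : K, IsAlgebraic ℚ (algebraMap K ℂ x) := fun x =>
    (Algebra.IsAlgebraic.isAlgebraic (R := ℚ) x).algebraMap
  obtain ⟨c, hc, i, hi⟩ := Fintype.not_linearIndependent_iff.1 hf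
  obtain ⟨m, rfl⟩ : ∃ m, N = m + 1 := Nat.exists_eq_succ_of_ne_zero (by rintro rfl; exact i.elim0)
  let p : ℕ → K[X] := fun j => if h : j < m + 1 then c ⟨j, h⟩ else 0
  have hp : ∀ j : Fin (m + 1), p j = c j := fun j => dif_pos j.2
  refine ⟨fun n => by rw [PowerSeries.coeff_map]; exact halg _, m,
    fun j => (p j).map (algebraMap K ℂ), fun j n => by rw [coeff_map]; exact halg _,
    ⟨i, by omega, ?_⟩, ?_⟩
  · beta_reduce
    rw [hp]
    exact (Polynomial.map_ne_zero_iff (algebraMap K ℂ).injective).2 hi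
  · rw [Finset.sum_range]
    simp only [polyPS_mul, psSigma_iterate hq, hp, ← PowerSeries.map_expand,
      ← PowerSeries.map_polynomial_smul]
    rw [← map_sum, hc, map_zero]

end MahlerFunctions

/-- Every M_q-function `f ∈ K[[z]]` over a number field `K` decomposes as
`f = R₁ + R₂ g` with `R₁, R₂ ∈ K(z)` (written `R₁ = A₁/B₁`, `R₂ = A₂/B₂`) and `g ∈ K[[z]]`
an M_q-function analytic and purely transcendental on `D(0,R)`. -/
theorem Mq_decomposition
    (q : ℕ) (hq : 2 ≤ q)
    (K : Subfield ℂ) [FiniteDimensional ℚ K] (hKalg : ∀ x ∈ K, IsAlgebraic ℚ x)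
    (f : PowerSeries ℂ) (hf : IsM q f) (hfK : ∀ n, PowerSeries.coeff n f ∈ K)
    (R : ℝ) (hR0 : 0 < R) (hR1 : R < 1) :
    ∃ A₁ B₁ A₂ B₂ : Polynomial ℂ,
      (∀ k, A₁.coeff k ∈ K) ∧ (∀ k, B₁.coeff k ∈ K) ∧
      (∀ k, A₂.coeff k ∈ K) ∧ (∀ k, B₂.coeff k ∈ K) ∧
      B₁ ≠ 0 ∧ B₂ ≠ 0 ∧
      ∃ g : PowerSeries ℂ, IsM q g ∧ (∀ n, PowerSeries.coeff n g ∈ K) ∧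
        AnOnBall g R ∧
        (∀ β : ℂ, IsAlgebraic ℚ β → 0 < ‖β‖ → ‖β‖ < R →
          Transcendental ℚ (psEval g β)) ∧
        polyPS (B₁ * B₂) * f = polyPS (A₁ * B₂) + polyPS (A₂ * B₁) * g := by
  have hq0 : q ≠ 0 := by omega
  obtain ⟨f, rfl⟩ : ∃ f' : PowerSeries K, f'.map (algebraMap K ℂ) = f :=
    ⟨PowerSeries.mk fun n => ⟨PowerSeries.coeff n f, hfK n⟩, by ext n; simp; rfl⟩
  have hmem : ∀ (p : K[X]) (n : ℕ), (p.map (algebraMap K ℂ)).coeff n ∈ K := fun p n => by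
    rw [coeff_map]
    exact (p.coeff n).2
  have hmem' : ∀ (h : PowerSeries K) (n : ℕ), PowerSeries.coeff n (h.map (algebraMap K ℂ)) ∈ K :=
    fun h n => by
      rw [PowerSeries.coeff_map]
      exact (PowerSeries.coeff n h).2
  have hne : ∀ {p : K[X]}, p ≠ 0 → p.map (algebraMap K ℂ) ≠ 0 := fun hp =>
    (Polynomial.map_ne_zero_iff (algebraMap K ℂ).injective).2 hp
  have hcoe : ∀ p : K[X], polyPS (p.map (algebraMap K ℂ)) =
      (p : PowerSeries K).map (algebraMap K ℂ) := fun p => Polynomial.polynomial_map_coe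
  obtain ⟨N, hN⟩ := hf.not_linearIndependent hq0
  by_cases hrat : ∃ d c : K[X], d ≠ 0 ∧ d • f = (c : PowerSeries K)
  · obtain ⟨d, c, hd, hdc⟩ := hrat
    obtain ⟨-, -, -, g, -, -, ⟨N', hN'⟩, hg, hgβ⟩ := exists_purely_transcendental (K := K) hq hq0
      (not_linearIndependent_expand_lacunarySeries hq hq0) (smul_lacunarySeries_ne hq) hR0 hR1
    refine ⟨c.map (algebraMap K ℂ), d.map (algebraMap K ℂ), 0, 1, hmem c, hmem d, by simp,
      ?_, hne hd, one_ne_zero, _, isM_map hq0 hN', hmem' g, hg, hgβ, ?_⟩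
    · simpa using hmem 1
    · rw [mul_one, mul_one, zero_mul, map_zero, zero_mul, add_zero, hcoe, hcoe, ← map_mul,
        ← PowerSeries.polynomial_smul_def, hdc]
  · push Not at hrat
    obtain ⟨d, c, e, g, hd, hdf, ⟨N', hN'⟩, hg, hgβ⟩ :=
      exists_purely_transcendental hq hq0 hN hrat hR0 hR1
    refine ⟨c.map (algebraMap K ℂ), d.map (algebraMap K ℂ), e.map (algebraMap K ℂ),
      d.map (algebraMap K ℂ), hmem c, hmem d, hmem e, hmem d, hne hd, hne hd, _,
      isM_map hq0 hN', hmem' g, hg, hgβ, ?_⟩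
    rw [PowerSeries.polynomial_smul_def, PowerSeries.polynomial_smul_def] at hdf
    have h := congrArg (PowerSeries.map (algebraMap K ℂ)) hdf
    simp only [map_add, map_mul, ← hcoe] at h ⊢
    rw [mul_assoc, h]
    ring
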